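/- arXiv:1810.09117 — 4 statements merged into one kernel-verified Lean document; each statement's English description precedes it below -/
import Mathlib

section
/- Let P ⊆ ℂ be a nonempty compact set and for i = 1, …, N let A_i : P → ℂ^{n_i×n_i} and B_i : P → ℂ^{n_i×m} be continuous such that each pair (A_i, B_i) is uniformly ensemble reachable on C(P, ℂ^{n_i}). Assume that the spectral sets spec A_i := ∪_{θ∈P} σ(A_i(θ)) are pairwise disjoint and that ℂ \ spec A_i is connected for every i = 1, …, N. Then the pair consisting of the block-diagonal matrix function θ ↦ diag(A_1(θ), …, A_N(θ)) ∈ ℂ^{n̄×n̄} and the stacked input matrix function θ ↦ (B_1(θ); …; B_N(θ)) ∈ ℂ^{n̄×m}, where n̄ = n_1 + ⋯ + n_N, is uniformly ensemble reachable on C(P, ℂ^{n̄}). -/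
open Polynomial Matrix

/-- Uniform ensemble reachability of a pair `(A, B)` on `C(P, ℂ^ι)`. -/
def UniformEnsembleReachable {ι κ : Type*} [Fintype ι] [DecidableEq ι] [Fintype κ]
    (P : Set ℂ) (A : P → Matrix ι ι ℂ) (B : P → Matrix ι κ ℂ) : Prop :=
  ∀ f : P → ι → ℂ, Continuous f → ∀ ε : ℝ, 0 < ε →
    ∃ p : κ → Polynomial ℂ, ∀ θ : P,
      ‖(∑ j : κ, (Polynomial.aeval (A θ) (p j)).mulVec fun i => B θ i j) - f θ‖ < ε

namespace Ens
open Set Filter Topology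

def HasLog (K : Set ℂ) (w : ℂ) : Prop :=
  ∃ L : ℂ → ℂ, ContinuousOn L K ∧ ∀ z ∈ K, Complex.exp (L z) = z - w

lemma HasLog.step {K : Set ℂ} {w w' : ℂ} (h : HasLog K w)
    (hw : ∀ z ∈ K, ‖w - w'‖ < ‖z - w‖) : HasLog K w' := by
  obtain ⟨L, hL, hLe⟩ := h
  have hne : ∀ z ∈ K, z - w ≠ 0 := fun z hz => by
    have := (norm_nonneg _).trans_lt (hw z hz)
    exact norm_pos_iff.mp this
  have hs : ∀ z ∈ K, 1 + (w - w') / (z - w) ∈ Complex.slitPlane := fun z hz => by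
    apply Complex.mem_slitPlane_of_norm_lt_one
    rw [norm_div, div_lt_one (norm_pos_iff.mpr (hne z hz))]
    exact hw z hz
  refine ⟨fun z => L z + Complex.log (1 + (w - w') / (z - w)), ?_, ?_⟩
  · refine hL.add (ContinuousOn.clog ?_ hs)
    refine continuousOn_const.add (continuousOn_const.div (by fun_prop) hne)
  · intro z hz
    rw [Complex.exp_add, hLe z hz, Complex.exp_log (Complex.slitPlane_ne_zero (hs z hz))]
    have := hne z hz
    field_simp
    ring

lemma hasLog_far {K : Set ℂ} {w : ℂ} (hw : ∀ z ∈ K, ‖z‖ < ‖w‖) (h0 : w ≠ 0) : HasLog K w := by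
  have hs : ∀ z ∈ K, 1 + (-z / w) ∈ Complex.slitPlane := fun z hz => by
    apply Complex.mem_slitPlane_of_norm_lt_one
    rw [norm_div, norm_neg, div_lt_one (norm_pos_iff.mpr h0)]
    exact hw z hz
  refine ⟨fun z => Complex.log (-w) + Complex.log (1 + (-z / w)), ?_, ?_⟩
  · refine continuousOn_const.add (ContinuousOn.clog ?_ hs)
    fun_prop
  · intro z hz
    rw [Complex.exp_add, Complex.exp_log (neg_ne_zero.mpr h0),
      Complex.exp_log (Complex.slitPlane_ne_zero (hs z hz))]
    field_simp
    ring

lemma hasLog_of_preconnected {K : Set ℂ} (hK : IsCompact K) (hc : IsPreconnected Kᶜ)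
    {w : ℂ} (hw : w ∉ K) : HasLog K w := by
  have key : ∀ w, w ∉ K → ∃ d > 0, ∀ w', ‖w - w'‖ < d → w' ∉ K ∧ (HasLog K w ↔ HasLog K w') := by
    intro w hw
    obtain ⟨d, hd, hdK⟩ := Metric.isOpen_iff.mp hK.isClosed.isOpen_compl w hw
    have hz : ∀ z ∈ K, d ≤ ‖z - w‖ := by
      intro z hz
      by_contra hlt
      exact hdK (by rw [Metric.mem_ball, dist_eq_norm]; exact not_le.mp hlt) hz
    refine ⟨d / 2, by positivity, fun w' hw' => ⟨?_, fun h => ?_, fun h => ?_⟩⟩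
    · intro hK'
      have := hz w' hK'
      rw [norm_sub_rev] at this
      linarith
    · exact h.step fun z hzK => by have := hz z hzK; linarith
    · refine h.step fun z hzK => ?_
      have h1 := hz z hzK
      have h2 : ‖z - w‖ ≤ ‖z - w'‖ + ‖w' - w‖ := by
        simpa using norm_add_le (z - w') (w' - w)
      rw [norm_sub_rev w' w] at h2 ⊢
      linarith
  obtain ⟨R, hR⟩ := hK.isBounded.exists_norm_le
  have hfar : ∀ z ∈ K, ‖z‖ < ‖((|R| + 1 : ℝ) : ℂ)‖ := by
    intro z hz
    rw [Complex.norm_real, Real.norm_eq_abs]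
    have := hR z hz
    have := le_abs_self R
    have := le_abs_self (|R| + 1)
    linarith
  have hf0 : ((|R| + 1 : ℝ) : ℂ) ≠ 0 := by
    have : (0:ℝ) < |R| + 1 := by positivity
    exact_mod_cast this.ne'
  have hUo : IsOpen {w | w ∉ K ∧ HasLog K w} := by
    rw [Metric.isOpen_iff]
    rintro w ⟨hw, hl⟩
    obtain ⟨d, hd, h⟩ := key w hw
    refine ⟨d, hd, fun w' hw' => ?_⟩
    rw [Metric.mem_ball, dist_comm, dist_eq_norm] at hw'
    exact ⟨(h w' hw').1, (h w' hw').2.mp hl⟩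
  have hVo : IsOpen {w | w ∉ K ∧ ¬ HasLog K w} := by
    rw [Metric.isOpen_iff]
    rintro w ⟨hw, hl⟩
    obtain ⟨d, hd, h⟩ := key w hw
    refine ⟨d, hd, fun w' hw' => ?_⟩
    rw [Metric.mem_ball, dist_comm, dist_eq_norm] at hw'
    exact ⟨(h w' hw').1, fun hh => hl ((h w' hw').2.mpr hh)⟩
  have := hc.subset_left_of_subset_union hUo hVo
    (by rw [Set.disjoint_left]; rintro x ⟨_, h⟩ ⟨_, h'⟩; exact h' h)
    (fun x hx => by by_cases h : HasLog K x; exacts [Or.inl ⟨hx, h⟩, Or.inr ⟨hx, h⟩])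
    ⟨((|R| + 1 : ℝ) : ℂ), show _ ∉ K from fun h => (hfar _ h).ne rfl,
      show _ ∉ K from fun h => (hfar _ h).ne rfl, hasLog_far hfar hf0⟩
  exact (this hw).2

lemma hasLog_iUnion {ι : Type*} [Finite ι] {K : ι → Set ℂ} (hK : ∀ i, IsCompact (K i))
    (hd : ∀ i j, i ≠ j → Disjoint (K i) (K j)) {w : ℂ} (h : ∀ i, HasLog (K i) w) :
    HasLog (⋃ i, K i) w := by
  classical
  choose L hL hLe using h
  let M : ℂ → ℂ := fun z => if hz : ∃ i, z ∈ K i then L hz.choose z else 0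
  have hM : ∀ i, ∀ z ∈ K i, M z = L i z := by
    intro i z hz
    have hex : ∃ i, z ∈ K i := ⟨i, hz⟩
    have : hex.choose = i := by
      by_contra hne
      exact Set.disjoint_left.mp (hd _ _ hne) hex.choose_spec hz
    simp only [M, dif_pos hex, this]
  refine ⟨M, ?_, ?_⟩
  · refine (locallyFinite_of_finite K).continuousOn_iUnion (fun i => (hK i).isClosed) fun i => ?_
    exact (hL i).congr (hM i)
  · intro z hz
    obtain ⟨i, hi⟩ := mem_iUnion.mp hz
    rw [hM i z hi, hLe i z hi]

/-- No continuous nonvanishing function on the plane is `z - w` near infinity. -/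
lemma no_ext {g : ℂ → ℂ} (hg : Continuous g) (h0 : ∀ z, g z ≠ 0) {w : ℂ} {R : ℝ}
    (hR : 0 < R) (h : ∀ z, ‖z - w‖ = R → g z = z - w) : False := by
  obtain ⟨F, ⟨-, hF⟩, -⟩ := Complex.isCoveringMapOn_exp.existsUnique_continuousMap_lifts
    (⟨g, hg⟩ : C(ℂ, ℂ)) (a₀ := 0) (Complex.exp_log (h0 0)) (fun a => h0 a)
  have hF' : ∀ z, Complex.exp (F z) = g z := fun z => congr_fun hF z
  let u : ℝ → ℂ := fun t => w + R * Complex.exp (t * Complex.I)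
  have hu : Continuous u := by fun_prop
  have hun : ∀ t, ‖u t - w‖ = R := fun t => by
    simp [u, Complex.norm_exp_ofReal_mul_I, abs_of_pos hR]
  let q : ℝ → ℂ := fun t => (F (u t) - Complex.log R - t * Complex.I) / (2 * Real.pi * Complex.I)
  have hpi : (2 * Real.pi * Complex.I : ℂ) ≠ 0 := Complex.two_pi_I_ne_zero
  have hq : Continuous q := by
    have := F.continuous.comp hu
    simp only [q]
    fun_prop
  have hqi : ∀ t, ∃ n : ℤ, q t = n := by
    intro t
    have : Complex.exp (F (u t)) = Complex.exp (Complex.log R + t * Complex.I) := by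
      rw [hF', h _ (hun t), Complex.exp_add, Complex.exp_log (by exact_mod_cast hR.ne')]
      simp [u]
    obtain ⟨n, hn⟩ := Complex.exp_eq_exp_iff_exists_int.mp this
    refine ⟨n, ?_⟩
    simp only [q, hn]
    rw [div_eq_iff hpi]
    ring
  have hconst : ∀ s t, q s = q t := by
    choose m hm using hqi
    have hmc : Continuous m := by
      rw [Int.isClosedEmbedding_coe_real.continuous_iff]
      have : Continuous fun t => (q t).re := Complex.continuous_re.comp hq
      refine this.congr fun t => ?_
      simp [hm]
    intro s t
    rw [hm, hm, PreconnectedSpace.constant inferInstance hmc (x := s) (y := t)]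
  have h1 := hconst 0 (2 * Real.pi)
  have h2 : u (2 * Real.pi) = u 0 := by simp [u, Complex.exp_two_pi_mul_I]
  simp only [q, h2] at h1
  rw [div_left_inj' hpi] at h1
  push_cast at h1
  apply hpi
  linear_combination h1

lemma unbounded_component {K : Set ℂ} (hK : IsCompact K) {w : ℂ} (hw : w ∉ K)
    (h : HasLog K w) : ¬ Bornology.IsBounded (connectedComponentIn Kᶜ w) := by
  classical
  intro hb
  set W := connectedComponentIn Kᶜ w with hWdef
  have hWo : IsOpen W := hK.isClosed.isOpen_compl.connectedComponentIn
  have hwW : w ∈ W := mem_connectedComponentIn hw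
  have hfr : frontier W ⊆ K := by
    intro x hx
    by_contra hxK
    rw [hWo.frontier_eq] at hx
    have hpre : IsPreconnected (insert x W) :=
      isPreconnected_connectedComponentIn.subset_closure (subset_insert _ _)
        (insert_subset hx.1 subset_closure)
    exact hx.2 (hpre.subset_connectedComponentIn (mem_insert_of_mem _ hwW)
      (insert_subset hxK (connectedComponentIn_subset _ _)) (mem_insert _ _))
  obtain ⟨L, hL, hLe⟩ := h
  obtain ⟨G, hG⟩ := ContinuousMap.exists_restrict_eq hK.isClosed
    (⟨K.domRestrict L, continuousOn_iff_continuous_domRestrict.mp hL⟩ : C(K, ℂ))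
  have hG' : ∀ z ∈ K, G z = L z := fun z hz => congr($hG ⟨z, hz⟩)
  let g : ℂ → ℂ := W.piecewise (fun z => Complex.exp (G z)) (fun z => z - w)
  have hg : Continuous g := by
    refine Continuous.piecewise ?_ (by fun_prop) (by fun_prop)
    intro a ha
    rw [hG' a (hfr ha), hLe a (hfr ha)]
  have hg0 : ∀ z, g z ≠ 0 := by
    intro z
    by_cases hz : z ∈ W
    · simp [g, hz, Complex.exp_ne_zero]
    · simp only [g, Set.piecewise_eq_of_notMem _ _ _ hz]
      intro h0
      exact hz (by rwa [sub_eq_zero.mp h0])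
  obtain ⟨R, hR⟩ := hb.subset_closedBall w
  refine no_ext hg hg0 (w := w) (R := |R| + 1) (by positivity) fun z hz => ?_
  refine Set.piecewise_eq_of_notMem _ _ _ fun hzW => ?_
  have := hR hzW
  rw [Metric.mem_closedBall, dist_eq_norm, hz] at this
  linarith [le_abs_self R]

lemma liouville_step {ι : Type*} [Fintype ι] [DecidableEq ι] {R : ι → Type*} [∀ i, NormedRing (R i)]
    [∀ i, NormedAlgebra ℂ (R i)] [∀ i, CompleteSpace (R i)] (a : ∀ i, R i)
    (hd : ∀ i j, i ≠ j → Disjoint (spectrum ℂ (a i)) (spectrum ℂ (a j)))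
    {F : Type*} [NormedAddCommGroup F] [NormedSpace ℂ F] (l : (∀ i, R i) →L[ℂ] F)
    (hl : ∀ z : ℂ, (∀ j, z ∉ spectrum ℂ (a j)) → l (fun j => resolvent (a j) z) = 0) (i : ι) :
    l (Pi.single i 1) = 0 := by
  classical
  let lj : ∀ j, R j →L[ℂ] F := fun j => l.comp (ContinuousLinearMap.single ℂ R j)
  have hlj : ∀ j x, lj j x = l (Pi.single j x) := fun j x => rfl
  let Fj : ι → ℂ → F := fun j z => lj j (resolvent (a j) z)
  let G : ℂ → F := fun z => - ∑ j ∈ Finset.univ.erase i, Fj j z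
  have hFd : ∀ j z, z ∉ spectrum ℂ (a j) → DifferentiableAt ℂ (Fj j) z := fun j z hz =>
    (lj j).differentiableAt.comp z
      (spectrum.hasDerivAt_resolvent_const_left (spectrum.notMem_iff.mp hz)).differentiableAt
  have hGd : ∀ z, (∀ j, j ≠ i → z ∉ spectrum ℂ (a j)) → DifferentiableAt ℂ G z := fun z hz => by
    refine DifferentiableAt.neg (DifferentiableAt.fun_sum fun j hj => hFd j z (hz j ?_))
    exact (Finset.mem_erase.mp hj).1
  have hFG : ∀ z, (∀ j, z ∉ spectrum ℂ (a j)) → Fj i z = G z := by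
    intro z hz
    have h1 := hl z hz
    rw [← Finset.univ_sum_single (fun j => resolvent (a j) z), map_sum,
      ← Finset.add_sum_erase _ _ (Finset.mem_univ i)] at h1
    exact eq_neg_of_add_eq_zero_left h1
  let H : ℂ → F := fun z => if z ∈ spectrum ℂ (a i) then G z else Fj i z
  have hcl : ∀ j, IsClosed (spectrum ℂ (a j)) := fun j => spectrum.isClosed _
  have hHd : Differentiable ℂ H := by
    intro z
    by_cases hz : z ∈ spectrum ℂ (a i)
    · have hz' : ∀ j, j ≠ i → z ∉ spectrum ℂ (a j) := fun j hj hzj =>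
        Set.disjoint_left.mp (hd j i hj) hzj hz
      refine (hGd z hz').congr_of_eventuallyEq ?_
      have : ∀ᶠ y in 𝓝 z, ∀ j, j ≠ i → y ∉ spectrum ℂ (a j) := by
        rw [eventually_all]
        intro j
        by_cases hj : j = i
        · simp [hj]
        · filter_upwards [(hcl j).isOpen_compl.mem_nhds (hz' j hj)] with y hy _ using hy
      filter_upwards [this] with y hy
      by_cases hyi : y ∈ spectrum ℂ (a i)
      · simp only [H, if_pos hyi]
      · simp only [H, if_neg hyi]
        refine hFG y fun j => ?_
        by_cases hj : j = i
        · subst hj; exact hyi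
        · exact hy j hj
    · refine (hFd i z hz).congr_of_eventuallyEq ?_
      filter_upwards [(hcl i).isOpen_compl.mem_nhds hz] with y hy
      exact if_neg hy
  have hHe : H =ᶠ[cocompact ℂ] Fj i := by
    filter_upwards [(spectrum.isCompact (𝕜 := ℂ) (a i)).compl_mem_cocompact] with y hy
    exact if_neg hy
  have hres : Tendsto (resolvent (a i)) (cocompact ℂ) (𝓝 0) := by
    rw [← Metric.cobounded_eq_cocompact]
    exact spectrum.resolvent_tendsto_cobounded (a i)
  have hF0 : Tendsto (Fj i) (cocompact ℂ) (𝓝 0) := by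
    have := ((lj i).continuous.tendsto 0).comp hres
    rwa [map_zero] at this
  have hH0 : ∀ z, H z = 0 := fun z => hHd.apply_eq_of_tendsto_cocompact z (hF0.congr' hHe.symm)
  -- z • resolvent = 1 + a * resolvent
  have h1 : Tendsto (fun z => lj i (1 + a i * resolvent (a i) z)) (cocompact ℂ) (𝓝 (lj i 1)) := by
    have : Tendsto (fun z => 1 + a i * resolvent (a i) z) (cocompact ℂ) (𝓝 (1 + a i * 0)) :=
      tendsto_const_nhds.add (tendsto_const_nhds.mul hres)
    rw [mul_zero, add_zero] at this
    exact ((lj i).continuous.tendsto _).comp this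
  have h2 : (fun z => lj i (1 + a i * resolvent (a i) z)) =ᶠ[cocompact ℂ] fun _ => 0 := by
    filter_upwards [hHe, (spectrum.isCompact (𝕜 := ℂ) (a i)).compl_mem_cocompact] with z hz hzs
    rw [hH0] at hz
    have hu : IsUnit (algebraMap ℂ (R i) z - a i) := spectrum.notMem_iff.mp hzs
    have h3 : (algebraMap ℂ (R i) z - a i) * resolvent (a i) z = 1 := Ring.mul_inverse_cancel _ hu
    have h4 : 1 + a i * resolvent (a i) z = z • resolvent (a i) z := by
      rw [← h3, sub_mul, sub_add_cancel, Algebra.smul_def]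
    rw [h4, map_smul]
    change z • Fj i z = 0
    rw [← hz, smul_zero]
  exact tendsto_nhds_unique (h1.congr' h2) tendsto_const_nhds

lemma approx {ι : Type*} [Fintype ι] [DecidableEq ι] {R : ι → Type*} [∀ i, NormedRing (R i)]
    [∀ i, NormedAlgebra ℂ (R i)] [∀ i, CompleteSpace (R i)] (a : ∀ i, R i)
    (hd : ∀ i j, i ≠ j → Disjoint (spectrum ℂ (a i)) (spectrum ℂ (a j)))
    (hc : ∀ i, IsPreconnected (spectrum ℂ (a i))ᶜ) (i : ι) {ε : ℝ} (hε : 0 < ε) :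
    ∃ p : ℂ[X], ∀ j, ‖aeval (a j) p - (Pi.single i 1 : ∀ j, R j) j‖ < ε := by
  classical
  let S : Subalgebra ℂ (∀ i, R i) := (aeval (R := ℂ) a).range.topologicalClosure
  have hS : IsClosed (S : Set (∀ i, R i)) := Subalgebra.isClosed_topologicalClosure _
  have haS : a ∈ S := Subalgebra.le_topologicalClosure _ ⟨X, by simp⟩
  have hspec : spectrum ℂ a = ⋃ j, spectrum ℂ (a j) := Pi.spectrum_eq a
  have hres : ∀ z : ℂ, (∀ j, z ∉ spectrum ℂ (a j)) → (fun j => resolvent (a j) z) ∈ S := by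
    intro z hz
    have hzu : z ∉ ⋃ j, spectrum ℂ (a j) := by simpa using hz
    have hub : ¬ Bornology.IsBounded (connectedComponentIn (⋃ j, spectrum ℂ (a j))ᶜ z) :=
      unbounded_component (isCompact_iUnion fun j => spectrum.isCompact _) hzu
        (hasLog_iUnion (fun j => spectrum.isCompact _) hd
          fun j => hasLog_of_preconnected (spectrum.isCompact _) (hc j) (hz j))
    have hzS : z ∉ spectrum ℂ (⟨a, haS⟩ : S) := by
      intro hmem
      have := Subalgebra.spectrum_isBounded_connectedComponentIn S (hS := hS) _ hmem
      rw [hspec] at this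
      exact hub this
    obtain ⟨u, hu⟩ := spectrum.notMem_iff.mp hzS
    have h1 : ((↑u⁻¹ : S) : ∀ i, R i) = fun j => resolvent (a j) z := by
      funext j
      have hj : IsUnit (algebraMap ℂ (R j) z - a j) := spectrum.notMem_iff.mp (hz j)
      have h2 : (u : S) * (↑u⁻¹ : S) = 1 := u.mul_inv
      have h3 : (algebraMap ℂ (R j) z - a j) * ((↑u⁻¹ : S) : ∀ i, R i) j = 1 := by
        have := congr_fun (congr_arg (Subtype.val) h2) j
        rw [hu] at this
        exact this
      have h4 : (algebraMap ℂ (R j) z - a j) * resolvent (a j) z = 1 := Ring.mul_inverse_cancel _ hj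
      exact hj.mul_left_cancel (h3.trans h4.symm)
    rw [← h1]
    exact (↑u⁻¹ : S).2
  let T : Submodule ℂ (∀ i, R i) := Subalgebra.toSubmodule S
  have : IsClosed (T : Set (∀ i, R i)) := hS
  have hT : Pi.single i 1 ∈ T := by
    have := liouville_step a hd T.mkQL (fun z hz => by
      rw [Submodule.mkQL_apply, Submodule.mkQ_apply, Submodule.Quotient.mk_eq_zero]
      exact hres z hz) i
    rwa [Submodule.mkQL_apply, Submodule.mkQ_apply, Submodule.Quotient.mk_eq_zero] at this
  have hT' : (Pi.single i 1 : ∀ i, R i) ∈ closure ((aeval (R := ℂ) a).range : Set (∀ i, R i)) := by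
    rw [← Subalgebra.topologicalClosure_coe]
    exact hT
  obtain ⟨_, ⟨p, rfl⟩, hp⟩ := Metric.mem_closure_iff.mp hT' ε hε
  refine ⟨p, fun j => ?_⟩
  rw [dist_comm, dist_eq_norm] at hp
  have h5 := (norm_le_pi_norm _ j).trans_lt hp
  have h6 : (aeval (R := ℂ) a) p j = aeval (a j) p :=
    (Polynomial.aeval_algHom_apply (Pi.evalAlgHom ℂ R j) a p).symm
  rw [← h6]
  exact h5

noncomputable def Phi (n : ℕ) : Matrix (Fin n) (Fin n) ℂ ≃ₐ[ℂ] ((Fin n → ℂ) →L[ℂ] (Fin n → ℂ)) :=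
  Matrix.toLinAlgEquiv'.trans (Module.End.toContinuousLinearMap (Fin n → ℂ))

lemma Phi_apply (n : ℕ) (M : Matrix (Fin n) (Fin n) ℂ) (v : Fin n → ℂ) :
    Phi n M v = M.mulVec v := rfl

lemma Phi_continuous (n : ℕ) : Continuous (Phi n) :=
  LinearMap.continuous_of_finiteDimensional (Phi n).toLinearMap

noncomputable def bdHom {N : ℕ} (n : Fin N → ℕ) :
    (∀ i, Matrix (Fin (n i)) (Fin (n i)) ℂ) →ₐ[ℂ]
      Matrix ((i : Fin N) × Fin (n i)) ((i : Fin N) × Fin (n i)) ℂ :=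
  { Matrix.blockDiagonal'RingHom (fun i => Fin (n i)) ℂ with
    commutes' := fun c => by
      change Matrix.blockDiagonal' (algebraMap ℂ (∀ i, Matrix (Fin (n i)) (Fin (n i)) ℂ) c) = _
      rw [Algebra.algebraMap_eq_smul_one, Algebra.algebraMap_eq_smul_one,
        Matrix.blockDiagonal'_smul, Matrix.blockDiagonal'_one] }

lemma aeval_bd {N : ℕ} (n : Fin N → ℕ) (M : ∀ i, Matrix (Fin (n i)) (Fin (n i)) ℂ) (p : ℂ[X]) :
    aeval (Matrix.blockDiagonal' M) p = Matrix.blockDiagonal' fun i => aeval (M i) p := by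
  have h := Polynomial.aeval_algHom_apply (bdHom n) M p
  have h2 : (aeval (R := ℂ) M) p = fun i => aeval (M i) p := by
    funext j
    exact (Polynomial.aeval_algHom_apply
      (Pi.evalAlgHom ℂ (fun i => Matrix (Fin (n i)) (Fin (n i)) ℂ) j) M p).symm
  rw [h2] at h
  exact h

lemma mulVec_bd {N : ℕ} (n : Fin N → ℕ) (M : ∀ i, Matrix (Fin (n i)) (Fin (n i)) ℂ)
    (v : ((i : Fin N) × Fin (n i)) → ℂ) (i : Fin N) (x : Fin (n i)) :
    (Matrix.blockDiagonal' M).mulVec v ⟨i, x⟩ = (M i).mulVec (fun y => v ⟨i, y⟩) x := by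
  simp only [Matrix.mulVec, dotProduct, Fintype.sum_sigma]
  rw [Finset.sum_eq_single i]
  · simp [Matrix.blockDiagonal'_apply_eq]
  · intro j _ hj
    refine Finset.sum_eq_zero fun y _ => ?_
    rw [Matrix.blockDiagonal'_apply_ne _ _ _ hj.symm, zero_mul]
  · simp

end Ens

/-- parallel connection of uniformly ensemble reachable pairs whose spectral
sets are pairwise disjoint and do not separate the plane is uniformly ensemble
reachable. -/
theorem stmt_2 {N m : ℕ} (P : Set ℂ) (hP : IsCompact P) (hPne : P.Nonempty)
    (n : Fin N → ℕ)
    (A : (i : Fin N) → P → Matrix (Fin (n i)) (Fin (n i)) ℂ)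
    (B : (i : Fin N) → P → Matrix (Fin (n i)) (Fin m) ℂ)
    (hA : ∀ i, Continuous (A i)) (hB : ∀ i, Continuous (B i))
    (hUER : ∀ i, UniformEnsembleReachable P (A i) (B i))
    (hdisj : ∀ i j, i ≠ j →
      Disjoint (⋃ θ : P, spectrum ℂ (A i θ)) (⋃ θ : P, spectrum ℂ (A j θ)))
    (hconn : ∀ i, IsConnected ((⋃ θ : P, spectrum ℂ (A i θ))ᶜ)) :
    UniformEnsembleReachable P
      (fun θ => Matrix.blockDiagonal' fun i => A i θ)
      (fun θ => Matrix.of fun (a : (i : Fin N) × Fin (n i)) (j : Fin m) => B a.1 θ a.2 j) := by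
  classical
  haveI : CompactSpace P := isCompact_iff_compactSpace.mp hP
  intro f hf ε hε
  let R : Fin N → Type := fun i => C(P, (Fin (n i) → ℂ) →L[ℂ] (Fin (n i) → ℂ))
  letI : ∀ i, NormedRing (R i) := fun i =>
    inferInstanceAs (NormedRing C(P, (Fin (n i) → ℂ) →L[ℂ] (Fin (n i) → ℂ)))
  letI : ∀ i, NormedAlgebra ℂ (R i) := fun i =>
    inferInstanceAs (NormedAlgebra ℂ C(P, (Fin (n i) → ℂ) →L[ℂ] (Fin (n i) → ℂ)))
  haveI : ∀ i, CompleteSpace (R i) := fun i =>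
    inferInstanceAs (CompleteSpace C(P, (Fin (n i) → ℂ) →L[ℂ] (Fin (n i) → ℂ)))
  let a : ∀ i, R i := fun i => (⟨fun θ => Ens.Phi (n i) (A i θ), (Ens.Phi_continuous _).comp (hA i)⟩ :
    C(P, (Fin (n i) → ℂ) →L[ℂ] (Fin (n i) → ℂ)))
  have hspec : ∀ i, spectrum ℂ (a i) = ⋃ θ : P, spectrum ℂ (A i θ) := by
    intro i
    ext z
    rw [Set.mem_iUnion, spectrum.mem_iff,
      ContinuousMap.isUnit_iff_forall_isUnit, not_forall]
    refine exists_congr fun θ => ?_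
    rw [← AlgEquiv.spectrum_eq (Ens.Phi (n i)) (A i θ), spectrum.mem_iff]
    rfl
  have happ := fun k (η : ℝ) (hη : 0 < η) => Ens.approx a
    (fun i j hij => by rw [hspec, hspec]; exact hdisj i j hij)
    (fun i => by rw [hspec]; exact (hconn i).isPreconnected) k hη
  have haev : ∀ i θ (p : ℂ[X]) , (aeval (a i) p : C(P, (Fin (n i) → ℂ) →L[ℂ] (Fin (n i) → ℂ))) θ
      = Ens.Phi (n i) (aeval (A i θ) p) := by
    intro i θ p
    let ev : R i →ₐ[ℂ] ((Fin (n i) → ℂ) →L[ℂ] (Fin (n i) → ℂ)) :=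
      { toFun := fun g => (g : C(P, (Fin (n i) → ℂ) →L[ℂ] (Fin (n i) → ℂ))) θ
        map_one' := rfl
        map_mul' := fun _ _ => rfl
        map_zero' := rfl
        map_add' := fun _ _ => rfl
        commutes' := fun _ => rfl }
    have h1 := Polynomial.aeval_algHom_apply ev (a i) p
    have h2 := Polynomial.aeval_algHom_apply (Ens.Phi (n i)).toAlgHom (A i θ) p
    exact h1.symm.trans h2
  have hex := fun i => hUER i (fun θ x => f θ ⟨i, x⟩) (by fun_prop) (ε / 2) (by positivity)
  choose p hp using hex
  let v : ∀ k i : Fin N, C(P, Fin (n i) → ℂ) := fun k i =>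
    ⟨fun θ => ∑ j, (aeval (A i θ) (p k j)).mulVec fun x => B i θ x j, by
      refine continuous_finsetSum _ fun j _ => Continuous.matrix_mulVec ?_ ?_
      · exact (Polynomial.continuous_aeval (p k j)).comp (hA i)
      · have := hB i
        fun_prop⟩
  let M : ℝ := 1 + ∑ k, ∑ i, ‖v k i‖
  have hM0 : 0 < M := by positivity
  have hM : ∀ k i θ, ‖v k i θ‖ ≤ M := by
    intro k i θ
    have h1 : ‖v k i‖ ≤ ∑ i, ‖v k i‖ :=
      Finset.single_le_sum (f := fun i => ‖v k i‖) (fun _ _ => norm_nonneg _) (Finset.mem_univ i)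
    have h2 : ∑ i, ‖v k i‖ ≤ ∑ k, ∑ i, ‖v k i‖ :=
      Finset.single_le_sum (f := fun k => ∑ i, ‖v k i‖) (fun _ _ => by positivity) (Finset.mem_univ k)
    have h3 := (v k i).norm_coe_le_norm θ
    simp only [M]
    linarith
  let η : ℝ := ε / 2 / (M * (N + 1))
  have hη : 0 < η := by positivity
  have happ' := fun k => happ k η hη
  choose h hh using happ'
  refine ⟨fun j => ∑ k, h k * p k j, fun θ => ?_⟩
  have hblock : ∀ i (x : Fin (n i)), (∑ j : Fin m, (aeval (Matrix.blockDiagonal' fun i => A i θ)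
      (∑ k, h k * p k j)).mulVec fun b : (i : Fin N) × Fin (n i) => B b.1 θ b.2 j) ⟨i, x⟩
      = (∑ k, Ens.Phi (n i) (aeval (A i θ) (h k)) (v k i θ)) x := by
    intro i x
    have h1 : ∀ k, Ens.Phi (n i) (aeval (A i θ) (h k)) (v k i θ) =
        ∑ j, (aeval (A i θ) (h k * p k j)).mulVec fun x => B i θ x j := by
      intro k
      change Ens.Phi (n i) (aeval (A i θ) (h k)) (∑ j, _) = _
      rw [map_sum]
      refine Finset.sum_congr rfl fun j _ => ?_
      rw [Ens.Phi_apply, Matrix.mulVec_mulVec, map_mul]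
    simp only [h1]
    rw [Finset.sum_comm, Finset.sum_apply, Finset.sum_apply]
    refine Finset.sum_congr rfl fun j _ => ?_
    rw [Ens.aeval_bd, Ens.mulVec_bd, map_sum, Matrix.sum_mulVec]
  have hmain : ∀ i, ‖(∑ k, Ens.Phi (n i) (aeval (A i θ) (h k)) (v k i θ)) - fun x => f θ ⟨i, x⟩‖
      < ε := by
    intro i
    let D : Fin N → ((Fin (n i) → ℂ) →L[ℂ] (Fin (n i) → ℂ)) := fun k =>
      ((Pi.single k 1 : ∀ j, R j) i : C(P, (Fin (n i) → ℂ) →L[ℂ] (Fin (n i) → ℂ))) θ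
    have hD : ∑ k, D k (v k i θ) = v i i θ := by
      rw [Finset.sum_eq_single i]
      · simp only [D, Pi.single_eq_same]
        rfl
      · intro k _ hk
        simp only [D, Pi.single_eq_of_ne hk.symm]
        rfl
      · simp
    have hdiff : ∀ k, ‖Ens.Phi (n i) (aeval (A i θ) (h k)) - D k‖ ≤ η := by
      intro k
      have h1 := (ContinuousMap.norm_coe_le_norm
        (aeval (a i) (h k) - (Pi.single k 1 : ∀ j, R j) i :
          C(P, (Fin (n i) → ℂ) →L[ℂ] (Fin (n i) → ℂ))) θ).trans (hh k i).le
      rw [ContinuousMap.sub_apply, haev] at h1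
      exact h1
    have hsplit : (∑ k, Ens.Phi (n i) (aeval (A i θ) (h k)) (v k i θ)) - (fun x => f θ ⟨i, x⟩)
        = (∑ k, (Ens.Phi (n i) (aeval (A i θ) (h k)) - D k) (v k i θ))
          + (v i i θ - fun x => f θ ⟨i, x⟩) := by
      simp only [_root_.sub_apply, Finset.sum_sub_distrib, hD]
      abel
    have hsum : ‖∑ k, (Ens.Phi (n i) (aeval (A i θ) (h k)) - D k) (v k i θ)‖ ≤ ε / 2 := by
      calc _ ≤ ∑ k : Fin N, η * M := by
            refine norm_sum_le_of_le _ fun k _ => ?_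
            refine (ContinuousLinearMap.le_opNorm _ _).trans ?_
            exact mul_le_mul (hdiff k) (hM k i θ) (norm_nonneg _) hη.le
        _ = (N / (N + 1)) * (ε / 2) := by
            simp only [Finset.sum_const, Finset.card_univ, Fintype.card_fin, nsmul_eq_mul, η]
            field_simp
        _ ≤ 1 * (ε / 2) := by
            refine mul_le_mul_of_nonneg_right ?_ (by positivity)
            rw [div_le_one (by positivity)]
            linarith
        _ = ε / 2 := one_mul _
    have hlast : ‖v i i θ - fun x => f θ ⟨i, x⟩‖ < ε / 2 := hp i θ
    rw [hsplit]
    refine (norm_add_le _ _).trans_lt ?_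
    linarith
  rw [pi_norm_lt_iff hε]
  rintro ⟨i, x⟩
  have h1 := (norm_le_pi_norm _ x).trans_lt (hmain i)
  rw [Pi.sub_apply, ← hblock i x] at h1
  exact h1
end

section
/- Let P ⊆ ℂ be compact and contractible and let A : P → ℂ^{n×n} be continuous. Suppose Γ_1, …, Γ_k are maps from P to the nonempty compact subsets of ℂ that are continuous with respect to the Hausdorff metric, pairwise pointwise disjoint (Γ_i(θ) ∩ Γ_j(θ) = ∅ for all i ≠ j and all θ ∈ P), and satisfy Γ_1(θ) ∪ ⋯ ∪ Γ_k(θ) = σ(A(θ)) for all θ ∈ P. Then there exist positive integers n_1, …, n_k with n_1 + ⋯ + n_k = n, a continuous map T : P → GL_n(ℂ), and continuous maps A_i : P → ℂ^{n_i×n_i} such that T(θ)^{−1} A(θ) T(θ) = diag(A_1(θ), …, A_k(θ)) and σ(A_i(θ)) = Γ_i(θ) for all θ ∈ P and all i = 1, …, k. -/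
open Polynomial Matrix

theorem aux_triv {n : ℕ} {ι X : Type} [Fintype ι] [DecidableEq ι] [TopologicalSpace X] [CompactSpace X]
    [ContractibleSpace X] (p : ι → X → Matrix (Fin n) (Fin n) ℂ) (hp : ∀ i, Continuous (p i))
    (hidem : ∀ i x, p i x * p i x = p i x) (horth : ∀ i j x, i ≠ j → p i x * p j x = 0)
    (hsum : ∀ x, ∑ i, p i x = 1) :
    ∃ (x₀ : X) (T : X → Matrix (Fin n) (Fin n) ℂ), Continuous T ∧ (∀ x, IsUnit (T x)) ∧
      ∀ i x, p i x * T x = T x * p i x₀ := by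
  obtain ⟨x₀, ⟨H⟩⟩ := id_nullhomotopic X
  let Q : unitInterval → unitInterval → Prop := fun s t =>
    ∃ T : X → Matrix (Fin n) (Fin n) ℂ, Continuous T ∧ (∀ x, IsUnit (T x)) ∧
      ∀ i x, p i (H (s, x)) * T x = T x * p i (H (t, x))
  have hcinv : ∀ T : X → Matrix (Fin n) (Fin n) ℂ, Continuous T → (∀ x, IsUnit (T x)) →
      Continuous fun x => (T x)⁻¹ := by
    intro T hT hu
    simp only [Matrix.inv_def, Ring.inverse_eq_inv']
    exact (hT.matrix_det.inv₀ fun x => ((Matrix.isUnit_iff_isUnit_det _).1 (hu x)).ne_zero).smul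
      hT.matrix_adjugate
  have hsymm : ∀ s t, Q s t → Q t s := by
    rintro s t ⟨T, hT, hu, h⟩
    refine ⟨fun x => (T x)⁻¹, hcinv T hT hu, fun x => by
      rw [Matrix.isUnit_nonsing_inv_iff]; exact hu x, fun i x => ?_⟩
    have hd := (Matrix.isUnit_iff_isUnit_det _).1 (hu x)
    have := h i x
    calc p i (H (t, x)) * (T x)⁻¹ = (T x)⁻¹ * (T x * p i (H (t, x))) * (T x)⁻¹ := by
          rw [Matrix.nonsing_inv_mul_cancel_left _ _ hd]
      _ = (T x)⁻¹ * p i (H (s, x)) := by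
          rw [← this, ← Matrix.mul_assoc, Matrix.mul_nonsing_inv_cancel_right _ _ hd]
  have htrans : ∀ s t u, Q s t → Q t u → Q s u := by
    rintro s t u ⟨T, hT, hu, h⟩ ⟨T', hT', hu', h'⟩
    refine ⟨fun x => T x * T' x, hT.mul hT', fun x => (hu x).mul (hu' x), fun i x => ?_⟩
    rw [← Matrix.mul_assoc, h, Matrix.mul_assoc, h', Matrix.mul_assoc]
  have hloc : ∀ s, ∀ᶠ t in nhds s, Q s t := by
    intro s
    let W : unitInterval → X → Matrix (Fin n) (Fin n) ℂ :=
      fun t x => ∑ i, p i (H (s, x)) * p i (H (t, x))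
    have hW : Continuous fun z : unitInterval × X => W z.1 z.2 := by
      refine continuous_finsetSum _ fun i _ => Continuous.mul ?_ ?_
      · exact (hp i).comp (H.continuous.comp (by fun_prop))
      · exact (hp i).comp (H.continuous.comp (by fun_prop))
    have hW1 : ∀ x, W s x = 1 := fun x => by simp only [W, hidem, hsum]
    have hev : ∀ᶠ t in nhds s, ∀ x ∈ (Set.univ : Set X), (W t x).det ≠ 0 := by
      refine isCompact_univ.eventually_forall_of_forall_eventually fun x _ => ?_
      have hc : Continuous fun z : unitInterval × X => (W z.1 z.2).det := hW.matrix_det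
      refine hc.continuousAt.eventually_ne ?_
      simp [hW1]
    filter_upwards [hev] with t ht
    refine ⟨W t, hW.comp (Continuous.prodMk_right t), fun x => ?_, fun i x => ?_⟩
    · rw [Matrix.isUnit_iff_isUnit_det]; exact (ht x trivial).isUnit
    · simp only [W, Finset.mul_sum, Finset.sum_mul]
      rw [Finset.sum_eq_single i, Finset.sum_eq_single i]
      · rw [← Matrix.mul_assoc, hidem, Matrix.mul_assoc, hidem]
      · intro j _ hj
        rw [Matrix.mul_assoc, horth _ _ _ hj, Matrix.mul_zero]
      · simp
      · intro j _ hj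
        rw [← Matrix.mul_assoc, horth _ _ _ hj.symm, Matrix.zero_mul]
      · simp
  have : Std.Symm Q := ⟨hsymm⟩
  obtain ⟨T, hT, hu, h⟩ := PreconnectedSpace.induction₂ Q hloc ⟨htrans⟩ 0 1
  refine ⟨x₀, T, hT, hu, fun i x => ?_⟩
  simpa using h i x

theorem aux_tuple {α : Type} {n : ℕ} (m : Multiset α) (h : m.card = n) :
    ∃ z : Fin n → α, m = (Finset.univ : Finset (Fin n)).val.map z := by
  subst h
  induction m using Quotient.inductionOn with
  | h l =>
    refine ⟨l.get, ?_⟩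
    change (l : Multiset α) = ((List.finRange l.length : List _) : Multiset _).map l.get
    rw [Multiset.map_coe, ← List.ofFn_eq_map, List.ofFn_get]

theorem aux_eig {m : Type} [Fintype m] [DecidableEq m] (B : Matrix m m ℂ) (l : ℂ) :
    l ∈ spectrum ℂ B ↔ ∃ v : m → ℂ, v ≠ 0 ∧ B *ᵥ v = l • v := by
  rw [← Matrix.spectrum_toLin', ← Module.End.hasEigenvalue_iff_mem_spectrum]
  constructor
  · intro h
    obtain ⟨v, hv⟩ := h.exists_hasEigenvector
    exact ⟨v, hv.2, by simpa using hv.apply_eq_smul⟩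
  · rintro ⟨v, h0, hv⟩
    exact Module.End.hasEigenvalue_of_hasEigenvector (x := v)
      ⟨by rw [Module.End.mem_eigenspace_iff]; simpa using hv, h0⟩

theorem aux_aeval {m : Type} [Fintype m] [DecidableEq m] (B : Matrix m m ℂ) (l : ℂ) (v : m → ℂ)
    (h : B *ᵥ v = l • v) (q : ℂ[X]) : (aeval B q) *ᵥ v = q.eval l • v := by
  induction q using Polynomial.induction_on' with
  | add p q hp hq => simp [Matrix.add_mulVec, hp, hq, add_smul]
  | monomial k a =>
    have : ∀ k : ℕ, (B ^ k) *ᵥ v = l ^ k • v := by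
      intro k
      induction k with
      | zero => simp
      | succ k ih => rw [pow_succ, ← Matrix.mulVec_mulVec, h, Matrix.mulVec_smul, ih, smul_smul,
          pow_succ, mul_comm]
    rw [aeval_monomial, ← Matrix.mulVec_mulVec, this, Algebra.algebraMap_eq_smul_one,
      Matrix.smul_mulVec, Matrix.one_mulVec, smul_smul, eval_monomial]

theorem aux_mem {X : Type} [TopologicalSpace X] (G : X → TopologicalSpace.NonemptyCompacts ℂ)
    (hG : Continuous G) : IsClosed {y : X × ℂ | y.2 ∈ (G y.1 : Set ℂ)} := by
  have hL : Continuous fun p : ℂ × TopologicalSpace.NonemptyCompacts ℂ =>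
    Metric.infDist p.1 p.2 := Metric.lipschitz_infDist.continuous
  have hg : Continuous fun y : X × ℂ => (y.2, G y.1) :=
    continuous_snd.prodMk (hG.comp continuous_fst)
  have hc := hL.comp hg
  have : {y : X × ℂ | y.2 ∈ (G y.1 : Set ℂ)} =
      {y : X × ℂ | Metric.infDist y.2 (G y.1 : Set ℂ) = 0} := by
    ext y
    exact (G y.1).isCompact.isClosed.mem_iff_infDist_zero (G y.1).nonempty
  rw [this]
  exact isClosed_eq hc continuous_const

theorem aux_bdd {X : Type} [TopologicalSpace X] [CompactSpace X]
    (G : X → TopologicalSpace.NonemptyCompacts ℂ)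
    (hG : Continuous G) : ∃ r, ∀ θ, ∀ z ∈ (G θ : Set ℂ), ‖z‖ ≤ r := by
  have hK : IsCompact (Set.range G) := isCompact_range hG
  obtain ⟨r, hr⟩ := hK.isBounded.subset_closedBall
    (⟨⟨{0}, isCompact_singleton⟩, Set.singleton_nonempty 0⟩ :
      TopologicalSpace.NonemptyCompacts ℂ)
  refine ⟨r, fun θ z hz => ?_⟩
  have h1 := hr ⟨θ, rfl⟩
  rw [Metric.mem_closedBall, Metric.NonemptyCompacts.dist_eq] at h1
  have h2 := Metric.infDist_le_hausdorffDist_of_mem hz (t := ({0} : Set ℂ))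
    (Metric.hausdorffEDist_ne_top_of_nonempty_of_bounded (G θ).nonempty
      (Set.singleton_nonempty 0) (G θ).isCompact.isBounded Bornology.isBounded_singleton)
  rw [Metric.infDist_singleton, dist_zero_right] at h2
  exact h2.trans h1

set_option maxHeartbeats 1000000 in
theorem aux_cont {n k : ℕ} {X : Type} [TopologicalSpace X] [CompactSpace X] [T2Space X]
    (A : X → Matrix (Fin n) (Fin n) ℂ) (hA : Continuous A)
    (Γ : Fin k → X → TopologicalSpace.NonemptyCompacts ℂ)
    (hΓcont : ∀ i, Continuous (Γ i))
    (hΓdisj : ∀ i j, i ≠ j → ∀ θ : X, Disjoint (Γ i θ : Set ℂ) (Γ j θ : Set ℂ))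
    (hΓspec : ∀ θ : X, (⋃ i : Fin k, (Γ i θ : Set ℂ)) = spectrum ℂ (A θ)) :
    ∃ p : Fin k → X → ℂ[X], (∀ i, Continuous fun θ => aeval (A θ) (p i θ)) ∧
      (∀ θ, ∏ i, p i θ = (A θ).charpoly) ∧
      (∀ i θ l, (p i θ).eval l = 0 ↔ l ∈ (Γ i θ : Set ℂ)) := by
  classical
  let p : Fin k → X → ℂ[X] := fun i θ =>
    (((A θ).charpoly.roots.filter (· ∈ (Γ i θ : Set ℂ))).map (fun r => Polynomial.X - C r)).prod
  let R : Set (X × (Fin n → ℂ) × (Fin n → Fin k)) :=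
    {x | (∀ l, x.2.1 l ∈ (Γ (x.2.2 l) x.1 : Set ℂ)) ∧
      ∀ w, ∏ l, (w - x.2.1 l) = (Matrix.scalar (Fin n) w - A x.1).det}
  have hRp : ∀ x ∈ R, (A x.1).charpoly = ∏ l, (Polynomial.X - C (x.2.1 l)) := by
    intro x hx
    refine Polynomial.funext fun w => ?_
    rw [Matrix.eval_charpoly, ← hx.2 w, eval_prod]
    simp
  have hRi : ∀ x ∈ R, ∀ i, p i x.1 = ∏ l with x.2.2 l = i, (Polynomial.X - C (x.2.1 l)) := by
    intro x hx i
    have hr : (A x.1).charpoly.roots = (Finset.univ : Finset (Fin n)).val.map x.2.1 := by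
      rw [hRp x hx, Polynomial.roots_prod _ _
        (Finset.prod_ne_zero_iff.2 fun l _ => X_sub_C_ne_zero _)]
      simp
    simp only [p]
    rw [hr, Multiset.filter_map, Multiset.map_map]
    have : (Finset.univ : Finset (Fin n)).val.filter ((· ∈ (Γ i x.1 : Set ℂ)) ∘ x.2.1) =
        (Finset.univ.filter fun l => x.2.2 l = i).val := by
      rw [Finset.filter_val]
      refine Multiset.filter_congr fun l _ => ?_
      constructor
      · intro h
        by_contra hne
        exact Set.disjoint_left.1 (hΓdisj _ _ hne x.1) (hx.1 l) h
      · intro h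
        have := hx.1 l
        rw [h] at this
        exact this
    rw [this]
    rfl
  have hsurj : ∀ θ, ∃ x ∈ R, x.1 = θ := by
    intro θ
    have hsp : (A θ).charpoly.Splits := IsAlgClosed.splits _
    have hcard : (A θ).charpoly.roots.card = n := by
      rw [← hsp.natDegree_eq_card_roots, Matrix.charpoly_natDegree_eq_dim, Fintype.card_fin]
    obtain ⟨z, hz⟩ := aux_tuple _ hcard
    have hzm : ∀ l, ∃ i, z l ∈ (Γ i θ : Set ℂ) := by
      intro l
      have h1 : z l ∈ (A θ).charpoly.roots := by
        rw [hz]; exact Multiset.mem_map_of_mem _ (Finset.mem_univ l)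
      have h2 : z l ∈ spectrum ℂ (A θ) :=
        Matrix.mem_spectrum_iff_isRoot_charpoly.2 (Polynomial.isRoot_of_mem_roots h1)
      rw [← hΓspec θ] at h2
      exact Set.mem_iUnion.1 h2
    choose c hc using hzm
    refine ⟨(θ, z, c), ⟨hc, fun w => ?_⟩, rfl⟩
    rw [← Matrix.eval_charpoly, hsp.eq_prod_roots_of_monic (Matrix.charpoly_monic _), hz]
    rw [Multiset.map_map]
    change _ = eval w (∏ l, (Polynomial.X - C (z l)))
    rw [eval_prod]
    simp
  refine ⟨p, ?_, ?_, ?_⟩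
  · intro i
    have hmem : ∀ j, IsClosed {y : X × ℂ | y.2 ∈ (Γ j y.1 : Set ℂ)} := by
      intro j
      exact aux_mem _ (hΓcont j)
    have hRclosed : IsClosed R := by
      have h1 : R = {x | ∀ l, x ∈ {x : X × (Fin n → ℂ) × (Fin n → Fin k) |
          ∀ j, x.2.2 l = j → (x.1, x.2.1 l) ∈ {y : X × ℂ | y.2 ∈ (Γ j y.1 : Set ℂ)}}} ∩
          {x | ∀ w, ∏ l, (w - x.2.1 l) = (Matrix.scalar (Fin n) w - A x.1).det} := by
        ext x; simp [R]
      rw [h1]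
      refine IsClosed.inter ?_ ?_
      · simp only [Set.ofPred_forall]
        refine isClosed_iInter fun l => ?_
        simp only [Set.ofPred_mem_eq]
        refine isClosed_iInter fun j => ?_
        refine isClosed_imp ?_ ((hmem j).preimage (by fun_prop))
        exact (isOpen_discrete {j}).preimage
          (f := fun x : X × (Fin n → ℂ) × (Fin n → Fin k) => x.2.2 l) (by fun_prop)
      · simp only [Set.ofPred_forall]
        refine isClosed_iInter fun w => isClosed_eq (by fun_prop) ?_
        exact (continuous_const.sub (hA.comp continuous_fst)).matrix_det
    have hRc : IsCompact R := by
      have hb : ∀ j, ∃ r, ∀ θ, ∀ z ∈ (Γ j θ : Set ℂ), ‖z‖ ≤ r := by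
        intro j
        exact aux_bdd _ (hΓcont j)
      choose r hr using hb
      have hsub : R ⊆ Set.univ ×ˢ
          (Set.pi Set.univ (fun _ : Fin n => Metric.closedBall (0 : ℂ) (∑ j, |r j|)) ×ˢ Set.univ) := by
        intro x hx
        refine ⟨trivial, fun l _ => ?_, trivial⟩
        rw [mem_closedBall_zero_iff]
        refine (hr _ _ _ (hx.1 l)).trans ((le_abs_self _).trans ?_)
        exact Finset.single_le_sum (f := fun j => |r j|) (fun _ _ => abs_nonneg _)
          (Finset.mem_univ _)
      exact (isCompact_univ.prod ((isCompact_univ_pi fun _ =>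
        isCompact_closedBall _ _).prod isCompact_univ)).of_isClosed_subset hRclosed hsub
    have : CompactSpace R := isCompact_iff_compactSpace.1 hRc
    have hq : Topology.IsQuotientMap (fun x : R => x.1.1) := by
      refine Topology.IsQuotientMap.of_surjective_continuous ?_ (by fun_prop)
      intro θ
      obtain ⟨x, hx, h⟩ := hsurj θ
      exact ⟨⟨x, hx⟩, h⟩
    rw [hq.continuous_iff]
    have hF : ((fun θ => aeval (A θ) (p i θ)) ∘ fun x : R => x.1.1) = fun x : R =>
        ((List.finRange n).map fun l => if x.1.2.2 l = i then
          A x.1.1 - Matrix.scalar (Fin n) (x.1.2.1 l) else 1).prod := by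
      funext x
      simp only [Function.comp]
      rw [hRi x.1 x.2 i, Finset.prod_filter]
      have : ∀ f : Fin n → ℂ[X], ∏ l, f l = ((List.finRange n).map f).prod := by
        intro f
        rw [← List.ofFn_eq_map, List.prod_ofFn]
      rw [this, map_list_prod, List.map_map]
      congr 2
      funext l
      simp only [Function.comp]
      split_ifs
      · simp [Matrix.algebraMap_eq_diagonal, Pi.algebraMap_def]
      · simp
    rw [hF]
    refine continuous_list_prod _ fun l _ => ?_
    refine Continuous.if ?_ ?_ continuous_const
    · intro x hx
      have : IsClopen {x : R | x.1.2.2 l = i} :=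
        (isClopen_discrete {i}).preimage (f := fun x : R => x.1.2.2 l) (by fun_prop)
      rw [this.frontier_eq] at hx
      exact hx.elim
    · have h1 : Continuous fun x : R => Matrix.scalar (Fin n) (x.1.2.1 l) := by
        have : Continuous fun x : R => x.1.2.1 l := by fun_prop
        exact Continuous.matrix_diagonal (continuous_pi fun _ => this)
      exact (hA.comp (by fun_prop)).sub h1
  · intro θ
    obtain ⟨x, hx, rfl⟩ := hsurj θ
    rw [hRp x hx]
    simp only [hRi x hx]
    exact Finset.prod_fiberwise _ _ _
  · intro i θ l
    simp only [p]
    rw [Polynomial.eval_multiset_prod, Multiset.prod_eq_zero_iff]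
    simp only [Multiset.map_map, Multiset.mem_map, Multiset.mem_filter, Function.comp, eval_sub,
      eval_X, eval_C, sub_eq_zero]
    constructor
    · rintro ⟨a, ⟨_, h⟩, rfl⟩; exact h
    · intro h
      refine ⟨l, ⟨?_, h⟩, rfl⟩
      rw [Polynomial.mem_roots (Matrix.charpoly_monic _).ne_zero,
        ← Matrix.mem_spectrum_iff_isRoot_charpoly, ← hΓspec θ]
      exact Set.mem_iUnion.2 ⟨i, h⟩

theorem aux_alg {n k : ℕ} (B : Matrix (Fin n) (Fin n) ℂ) (p : Fin k → ℂ[X])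
    (hp : ∏ i, p i = B.charpoly)
    (hd : ∀ i j, i ≠ j → ∀ l, (p i).eval l = 0 → (p j).eval l ≠ 0) :
    IsUnit (∑ i, aeval B (∏ j ∈ Finset.univ.erase i, p j)) ∧
    ∀ E : Fin k → Matrix (Fin n) (Fin n) ℂ,
      (∀ i, E i = aeval B (∏ j ∈ Finset.univ.erase i, p j) *
        (∑ i, aeval B (∏ j ∈ Finset.univ.erase i, p j))⁻¹) →
      (∀ i, E i * E i = E i) ∧ (∀ i j, i ≠ j → E i * E j = 0) ∧ (∑ i, E i = 1) ∧
      (∀ i, B * E i = E i * B) ∧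
      (∀ i l u, (p i).eval l = 0 → B *ᵥ u = l • u → E i *ᵥ u = u) := by
  classical
  set c : Fin k → ℂ[X] := fun i => ∏ j ∈ Finset.univ.erase i, p j with hc
  have hce : ∀ i j, i ≠ j → ∀ l, (p i).eval l = 0 → (c j).eval l = 0 := by
    intro i j hij l hl
    simp only [hc, eval_prod]
    exact Finset.prod_eq_zero (Finset.mem_erase.2 ⟨hij, Finset.mem_univ i⟩) hl
  have hse : ∀ i l, (p i).eval l = 0 → (∑ j, c j).eval l = (c i).eval l := by
    intro i l hl
    rw [eval_finsetSum, Finset.sum_eq_single i]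
    · intro j _ hj
      exact hce i j hj.symm l hl
    · simp
  have hcop : IsCoprime (∑ i, c i) B.charpoly := by
    rw [Polynomial.isCoprime_iff_aeval_ne_zero_of_isAlgClosed ℂ ℂ]
    intro l
    simp only [coe_aeval_eq_eval]
    by_contra! h
    obtain ⟨h1, h2⟩ := h
    rw [← hp, eval_prod, Finset.prod_eq_zero_iff] at h2
    obtain ⟨i, _, hi⟩ := h2
    rw [hse i l hi] at h1
    simp only [hc, eval_prod, Finset.prod_eq_zero_iff] at h1
    obtain ⟨j, hj, hj0⟩ := h1
    exact hd i j (Finset.ne_of_mem_erase hj).symm l hi hj0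
  obtain ⟨a, b, hab⟩ := hcop
  have hinv : (∑ i, aeval B (c i)) * aeval B a = 1 := by
    have := congrArg (aeval B) hab
    rw [map_add, map_mul, map_mul, Matrix.aeval_self_charpoly, mul_zero, add_zero, map_one] at this
    rw [← map_sum, ← map_mul, mul_comm, map_mul, this]
  refine ⟨IsUnit.of_mul_eq_one _ hinv, fun E hE => ?_⟩
  rw [Matrix.inv_eq_right_inv hinv] at hE
  have hE' : ∀ i, E i = aeval B (c i * a) := fun i => by rw [hE, map_mul]
  have hsum : ∑ i, E i = 1 := by
    rw [← hinv, Finset.sum_mul]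
    exact Finset.sum_congr rfl fun i _ => hE i
  have horth : ∀ i j, i ≠ j → E i * E j = 0 := by
    intro i j hij
    have hdvd : B.charpoly ∣ c i * a * (c j * a) := by
      have h1 : p i ∣ c j := Finset.dvd_prod_of_mem _ (Finset.mem_erase.2 ⟨hij, Finset.mem_univ i⟩)
      have h2 : B.charpoly = c i * p i := by
        rw [← hp, hc, Finset.prod_erase_mul _ _ (Finset.mem_univ i)]
      rw [h2]
      exact mul_dvd_mul (dvd_mul_right _ _) (h1.trans (dvd_mul_right _ _))
    obtain ⟨q, hq⟩ := hdvd
    rw [hE', hE', ← map_mul, hq, map_mul, Matrix.aeval_self_charpoly, zero_mul]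
  refine ⟨fun i => ?_, horth, hsum, fun i => ?_, fun i l u hl hu => ?_⟩
  · have := congrArg (E i * ·) hsum
    simp only [Finset.mul_sum, mul_one] at this
    rw [Finset.sum_eq_single i] at this
    · exact this
    · intro j _ hj
      exact horth i j hj.symm
    · simp
  · rw [hE']
    have : B * aeval B (c i * a) = aeval B (Polynomial.X * (c i * a)) := by
      rw [map_mul (aeval B) Polynomial.X, aeval_X]
    rw [this, mul_comm, map_mul (aeval B) _ Polynomial.X, aeval_X]
  · rw [hE', aux_aeval B l u hu]
    have h1 := congrArg (eval l) hab
    have h2 : B.charpoly.eval l = 0 := by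
      rw [← hp, eval_prod]; exact Finset.prod_eq_zero (Finset.mem_univ i) hl
    rw [eval_add, eval_mul, eval_mul, h2, hse i l hl, mul_zero, add_zero, eval_one] at h1
    rw [eval_mul, mul_comm, h1, one_smul]

theorem aux_basis {n k : ℕ} (E : Fin k → Matrix (Fin n) (Fin n) ℂ)
    (hidem : ∀ i, E i * E i = E i) (horth : ∀ i j, i ≠ j → E i * E j = 0)
    (hsum : ∑ i, E i = 1) :
    ∃ (nn : Fin k → ℕ) (e : ((i : Fin k) × Fin (nn i)) ≃ Fin n) (T : Matrix (Fin n) (Fin n) ℂ),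
      IsUnit T ∧
      ∀ i, E i * T = T * Matrix.diagonal fun s => if (e.symm s).1 = i then (1 : ℂ) else 0 := by
  classical
  let V : Fin k → Submodule ℂ (Fin n → ℂ) := fun i => LinearMap.range (E i).mulVecLin
  have hV : ∀ i (v : V i), E i *ᵥ (v : Fin n → ℂ) = v := by
    rintro i ⟨_, x, rfl⟩
    simp [Matrix.mulVec_mulVec, hidem]
  have hV' : ∀ i j, i ≠ j → ∀ (v : V j), E i *ᵥ (v : Fin n → ℂ) = 0 := by
    rintro i j hij ⟨_, x, rfl⟩
    simp [Matrix.mulVec_mulVec, horth i j hij]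
  let f : (∀ j, V j) →ₗ[ℂ] (Fin n → ℂ) :=
    ∑ j, (V j).subtype ∘ₗ LinearMap.proj j
  have hf : ∀ w, f w = ∑ j, (w j : Fin n → ℂ) := fun w => by simp [f]
  have hEf : ∀ i w, E i *ᵥ (f w) = w i := by
    intro i w
    rw [hf, Matrix.mulVec_sum, Finset.sum_eq_single i]
    · exact hV i _
    · intro j _ hj
      exact hV' i j hj.symm _
    · simp
  have hbij : Function.Bijective f := by
    constructor
    · intro w w' h
      funext i
      apply Subtype.ext
      rw [← hEf i w, ← hEf i w', h]
    · intro v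
      refine ⟨fun j => ⟨E j *ᵥ v, ⟨v, rfl⟩⟩, ?_⟩
      rw [hf]
      simp only
      rw [← Matrix.sum_mulVec, hsum, Matrix.one_mulVec]
  let F := LinearEquiv.ofBijective f hbij
  let b := (Pi.basis fun j => Module.finBasis ℂ (V j)).map F
  let e := b.indexEquiv (Pi.basisFun ℂ (Fin n))
  let b' := b.reindex e
  refine ⟨fun j => Module.finrank ℂ (V j), e, (Pi.basisFun ℂ (Fin n)).toMatrix b', ?_, ?_⟩
  · exact IsUnit.of_mul_eq_one _ ((Pi.basisFun ℂ (Fin n)).toMatrix_mul_toMatrix_flip b')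
  · intro i
    ext r s
    rw [Matrix.mul_diagonal]
    have h1 : (E i * (Pi.basisFun ℂ (Fin n)).toMatrix b') r s = (E i *ᵥ (b' s)) r := rfl
    have h2 : (Pi.basisFun ℂ (Fin n)).toMatrix b' r s = b' s r := rfl
    rw [h1, h2]
    have h3 : b' s = f (Pi.single (e.symm s).1 (Module.finBasis ℂ (V (e.symm s).1) (e.symm s).2)) := by
      simp only [b', b, Module.Basis.reindex_apply, Module.Basis.map_apply, Pi.basis_apply]
      rfl
    have h4 := hEf i (Pi.single (e.symm s).1 (Module.finBasis ℂ (V (e.symm s).1) (e.symm s).2))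
    rw [h3, h4]
    split_ifs with h
    · subst h
      rw [mul_one, hf, Finset.sum_eq_single (e.symm s).1]
      · intro j _ hj
        rw [Pi.single_eq_of_ne hj]; rfl
      · simp
    · rw [Pi.single_eq_of_ne (Ne.symm h)]; simp

theorem aux_block {n k : ℕ} (nn : Fin k → ℕ) (e : ((i : Fin k) × Fin (nn i)) ≃ Fin n)
    (B T : Matrix (Fin n) (Fin n) ℂ) (hT : IsUnit T) (E : Fin k → Matrix (Fin n) (Fin n) ℂ)
    (hBE : ∀ i, B * E i = E i * B)
    (hET : ∀ i, E i * T = T * Matrix.diagonal fun s => if (e.symm s).1 = i then (1 : ℂ) else 0)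
    (Ai : (i : Fin k) → Matrix (Fin (nn i)) (Fin (nn i)) ℂ)
    (hAi : ∀ i a b, Ai i a b = (T⁻¹ * B * T) (e ⟨i, a⟩) (e ⟨i, b⟩)) :
    T⁻¹ * B * T = (Matrix.blockDiagonal' Ai).submatrix e.symm e.symm ∧
    ∀ i l, l ∈ spectrum ℂ (Ai i) ↔ ∃ u, u ≠ 0 ∧ B *ᵥ u = l • u ∧ E i *ᵥ u = u := by
  classical
  have hd := (Matrix.isUnit_iff_isUnit_det _).1 hT
  set M := T⁻¹ * B * T with hM
  have hTM : T * M = B * T := by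
    rw [hM, Matrix.mul_assoc, Matrix.mul_nonsing_inv_cancel_left _ _ hd]
  set D : Fin k → Matrix (Fin n) (Fin n) ℂ :=
    fun i => Matrix.diagonal fun s => if (e.symm s).1 = i then (1 : ℂ) else 0 with hD
  have hinj : ∀ x y, T *ᵥ x = T *ᵥ y → x = y := by
    intro x y h
    have := congrArg (T⁻¹ *ᵥ ·) h
    simpa [Matrix.mulVec_mulVec, Matrix.nonsing_inv_mul _ hd] using this
  have hcomm : ∀ i, M * D i = D i * M := by
    intro i
    have h : T * (M * D i) = T * (D i * M) := by
      rw [← Matrix.mul_assoc, hTM, Matrix.mul_assoc, ← hET i, ← Matrix.mul_assoc, hBE,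
        Matrix.mul_assoc, ← hTM, ← Matrix.mul_assoc, hET i, Matrix.mul_assoc]
    have := congrArg (T⁻¹ * ·) h
    simpa only [Matrix.nonsing_inv_mul_cancel_left _ _ hd] using this
  have hblk : M = (Matrix.blockDiagonal' Ai).submatrix e.symm e.symm := by
    ext r s
    obtain ⟨⟨i, a⟩, rfl⟩ := e.surjective r
    obtain ⟨⟨j, b⟩, rfl⟩ := e.surjective s
    simp only [Matrix.submatrix_apply, Equiv.symm_apply_apply]
    by_cases h : i = j
    · subst h
      rw [Matrix.blockDiagonal'_apply_eq, hAi]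
    · rw [Matrix.blockDiagonal'_apply_ne _ _ _ h]
      have := congrFun (congrFun (hcomm i) (e ⟨i, a⟩)) (e ⟨j, b⟩)
      simp only [hD, Matrix.mul_diagonal, Matrix.diagonal_mul, Equiv.symm_apply_apply] at this
      simpa [Ne.symm h] using this.symm
  refine ⟨hblk, fun i l => ?_⟩
  let flat : (∀ j, Fin (nn j) → ℂ) → (Fin n → ℂ) := fun w s => w (e.symm s).1 (e.symm s).2
  have hfa : ∀ w j a, flat w (e ⟨j, a⟩) = w j a := by
    intro w j a
    change (fun t : (i : Fin k) × Fin (nn i) => w t.1 t.2) (e.symm (e ⟨j, a⟩)) = w j a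
    rw [Equiv.symm_apply_apply]
  have hflat : ∀ w w', flat w = flat w' → w = w' := by
    intro w w' h
    funext j a
    simpa only [hfa] using congrFun h (e ⟨j, a⟩)
  have hMf : ∀ w, M *ᵥ flat w = flat fun j => Ai j *ᵥ w j := by
    intro w
    rw [hblk]
    ext r
    obtain ⟨⟨i, a⟩, rfl⟩ := e.surjective r
    simp only [hfa, Matrix.mulVec, dotProduct, Matrix.submatrix_apply, Equiv.symm_apply_apply]
    rw [← e.sum_comp]
    simp only [Equiv.symm_apply_apply]
    rw [Fintype.sum_sigma, Finset.sum_eq_single i]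
    · simp [hfa]
    · intro j _ hj
      exact Finset.sum_eq_zero fun b _ => by
        rw [Matrix.blockDiagonal'_apply_ne _ _ _ hj.symm, zero_mul]
    · simp
  have hDf : ∀ w, D i *ᵥ flat w = flat (Pi.single i (w i)) := by
    intro w
    ext r
    obtain ⟨⟨j, a⟩, rfl⟩ := e.surjective r
    simp only [hD, Matrix.mulVec_diagonal, Equiv.symm_apply_apply, hfa]
    by_cases h : j = i
    · subst h; simp
    · simp [h]
  rw [aux_eig]
  constructor
  · rintro ⟨v, hv0, hv⟩
    have hs : (fun j => Ai j *ᵥ (Pi.single i v : ∀ j, Fin (nn j) → ℂ) j) =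
        l • (Pi.single i v : ∀ j, Fin (nn j) → ℂ) := by
      funext j
      by_cases h : j = i
      · subst h; simp [hv]
      · simp [h]
    refine ⟨T *ᵥ flat (Pi.single i v), ?_, ?_, ?_⟩
    · intro h
      have h1 : flat (Pi.single i v) = 0 := hinj _ _ (by rw [h, Matrix.mulVec_zero])
      have h2 := hflat (Pi.single i v) 0 h1
      exact hv0 (by simpa using h2)
    · rw [Matrix.mulVec_mulVec, ← hTM, ← Matrix.mulVec_mulVec, hMf, hs, ← Matrix.mulVec_smul]
      rfl
    · rw [Matrix.mulVec_mulVec, hET i, ← Matrix.mulVec_mulVec, hDf]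
      simp
  · rintro ⟨u, hu0, hu, hEu⟩
    obtain ⟨w, rfl⟩ : ∃ w, u = T *ᵥ flat w := by
      refine ⟨fun j a => (T⁻¹ *ᵥ u) (e ⟨j, a⟩), ?_⟩
      have : flat (fun j a => (T⁻¹ *ᵥ u) (e ⟨j, a⟩)) = T⁻¹ *ᵥ u := by
        funext s; simp [flat]
      rw [this, Matrix.mulVec_mulVec, Matrix.mul_nonsing_inv _ hd, Matrix.one_mulVec]
    rw [Matrix.mulVec_mulVec, hET i, ← Matrix.mulVec_mulVec, hDf] at hEu
    have hw := hflat _ _ (hinj _ _ hEu)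
    rw [Matrix.mulVec_mulVec, ← hTM, ← Matrix.mulVec_mulVec, hMf, ← Matrix.mulVec_smul] at hu
    have hfl : flat (l • w) = l • flat w := by
      funext s
      rfl
    have hu' := hinj _ _ hu
    rw [← hfl] at hu'
    have hl := hflat (fun j => Ai j *ᵥ w j) (l • w) hu'
    have hli : Ai i *ᵥ w i = l • w i := by
      have := congrFun hl i
      rwa [Pi.smul_apply] at this
    refine ⟨w i, fun h0 => hu0 ?_, hli⟩
    rw [h0, Pi.single_zero] at hw
    rw [← hw]
    have : flat 0 = 0 := rfl
    rw [this, Matrix.mulVec_zero]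

/-- block-diagonal decomposition of a continuous matrix family over a compact
contractible parameter set along a pairwise pointwise disjoint continuous spectral family
`Γ_1, …, Γ_k` (continuity with respect to the Hausdorff metric on nonempty compact
subsets of `ℂ`). -/
theorem stmt_4 {n k : ℕ} (P : Set ℂ) (hP : IsCompact P) (hPne : P.Nonempty)
    [ContractibleSpace P]
    (A : P → Matrix (Fin n) (Fin n) ℂ) (hA : Continuous A)
    (Γ : Fin k → P → TopologicalSpace.NonemptyCompacts ℂ)
    (hΓcont : ∀ i, Continuous (Γ i))
    (hΓdisj : ∀ i j, i ≠ j → ∀ θ : P, Disjoint (Γ i θ : Set ℂ) (Γ j θ : Set ℂ))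
    (hΓspec : ∀ θ : P, (⋃ i : Fin k, (Γ i θ : Set ℂ)) = spectrum ℂ (A θ)) :
    ∃ nn : Fin k → ℕ, (∀ i, 0 < nn i) ∧
      ∃ (e : ((i : Fin k) × Fin (nn i)) ≃ Fin n)
        (T : P → Matrix (Fin n) (Fin n) ℂ)
        (Ai : (i : Fin k) → P → Matrix (Fin (nn i)) (Fin (nn i)) ℂ),
        Continuous T ∧ (∀ θ : P, IsUnit (T θ)) ∧ (∀ i, Continuous (Ai i)) ∧
        (∀ θ : P, (T θ)⁻¹ * A θ * T θ =
          (Matrix.blockDiagonal' fun i => Ai i θ).submatrix e.symm e.symm) ∧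
        (∀ (i : Fin k) (θ : P), spectrum ℂ (Ai i θ) = (Γ i θ : Set ℂ)) := by
  have : CompactSpace P := isCompact_iff_compactSpace.1 hP
  have hcinv : ∀ T : P → Matrix (Fin n) (Fin n) ℂ, Continuous T → (∀ x, IsUnit (T x)) →
      Continuous fun x => (T x)⁻¹ := by
    intro T hT hu
    simp only [Matrix.inv_def, Ring.inverse_eq_inv']
    exact (hT.matrix_det.inv₀ fun x => ((Matrix.isUnit_iff_isUnit_det _).1 (hu x)).ne_zero).smul
      hT.matrix_adjugate
  obtain ⟨p, hpc, hpp, hpr⟩ := aux_cont A hA Γ hΓcont hΓdisj hΓspec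
  have hd : ∀ θ, ∀ i j, i ≠ j → ∀ l, (p i θ).eval l = 0 → (p j θ).eval l ≠ 0 := by
    intro θ i j hij l hi hj
    rw [hpr] at hi hj
    exact Set.disjoint_left.1 (hΓdisj i j hij θ) hi hj
  have halg := fun θ => aux_alg (A θ) (fun i => p i θ) (hpp θ) (hd θ)
  let c : Fin k → P → Matrix (Fin n) (Fin n) ℂ := fun i θ =>
    aeval (A θ) (∏ j ∈ Finset.univ.erase i, p j θ)
  have hc : ∀ i, Continuous (c i) := by
    intro i
    have : c i = fun θ => ((Finset.univ.erase i).toList.map fun j => aeval (A θ) (p j θ)).prod := by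
      funext θ
      simp only [c]
      rw [← Finset.prod_map_toList, map_list_prod, List.map_map]
      rfl
    rw [this]
    exact continuous_list_prod _ fun j _ => hpc j
  let E : Fin k → P → Matrix (Fin n) (Fin n) ℂ := fun i θ => c i θ * (∑ i, c i θ)⁻¹
  have hE : ∀ i, Continuous (E i) := fun i =>
    (hc i).mul (hcinv (fun θ => ∑ i, c i θ) (continuous_finsetSum _ fun i _ => hc i)
      fun θ => (halg θ).1)
  have hEp := fun θ => (halg θ).2 (fun i => E i θ) fun i => rfl
  obtain ⟨x₀, T₀, hT₀, hT₀u, hT₀E⟩ := aux_triv E hE (fun i θ => (hEp θ).1 i)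
    (fun i j θ => (hEp θ).2.1 i j) (fun θ => (hEp θ).2.2.1)
  obtain ⟨nn, e, C, hC, hCE⟩ := aux_basis (fun i => E i x₀) (hEp x₀).1 (hEp x₀).2.1 (hEp x₀).2.2.1
  let T : P → Matrix (Fin n) (Fin n) ℂ := fun θ => T₀ θ * C
  have hT : Continuous T := hT₀.mul continuous_const
  have hTu : ∀ θ, IsUnit (T θ) := fun θ => (hT₀u θ).mul hC
  let Ai : (i : Fin k) → P → Matrix (Fin (nn i)) (Fin (nn i)) ℂ := fun i θ =>
    Matrix.of fun a b => ((T θ)⁻¹ * A θ * T θ) (e ⟨i, a⟩) (e ⟨i, b⟩)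
  have hblock := fun θ => aux_block nn e (A θ) (T θ) (hTu θ) (fun i => E i θ) (hEp θ).2.2.2.1
    (fun i => by
      simp only [T]
      rw [← Matrix.mul_assoc, hT₀E, Matrix.mul_assoc, hCE, Matrix.mul_assoc])
    (fun i => Ai i θ) (fun i a b => rfl)
  have hspec : ∀ (i : Fin k) (θ : P), spectrum ℂ (Ai i θ) = (Γ i θ : Set ℂ) := by
    intro i θ
    ext l
    rw [(hblock θ).2 i l]
    constructor
    · rintro ⟨u, hu0, hu, hEu⟩
      have hl : l ∈ spectrum ℂ (A θ) := (aux_eig _ _).2 ⟨u, hu0, hu⟩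
      rw [← hΓspec θ] at hl
      obtain ⟨j, hj⟩ := Set.mem_iUnion.1 hl
      by_cases h : i = j
      · rw [h]; exact hj
      · exfalso
        have h1 := (hEp θ).2.2.2.2 j l u ((hpr j θ l).2 hj) hu
        have h2 := (hEp θ).2.1 i j h
        apply hu0
        rw [← hEu, ← h1, Matrix.mulVec_mulVec, h2, Matrix.zero_mulVec]
    · intro hl
      have hl' : l ∈ spectrum ℂ (A θ) := by
        rw [← hΓspec θ]; exact Set.mem_iUnion.2 ⟨i, hl⟩
      obtain ⟨u, hu0, hu⟩ := (aux_eig _ _).1 hl'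
      exact ⟨u, hu0, hu, (hEp θ).2.2.2.2 i l u ((hpr i θ l).2 hl) hu⟩
  refine ⟨nn, fun i => ?_, e, T, Ai, hT, hTu, fun i => ?_, fun θ => (hblock θ).1, hspec⟩
  · obtain ⟨l, hl⟩ := (Γ i x₀).nonempty
    rw [← hspec, aux_eig] at hl
    obtain ⟨v, hv, _⟩ := hl
    by_contra h0
    apply hv
    funext a
    have := a.2
    omega
  · refine continuous_matrix fun a b => ?_
    exact (((hcinv T hT hTu).mul hA).mul hT).matrix_elem _ _
end

section
/- Let P ⊆ ℂ be nonempty, compact and contractible, let A : P → ℂ^{n×n} and B : P → ℂ^{n×m} be continuous, and let Γ_1, …, Γ_k be maps from P to the nonempty compact subsets of ℂ, continuous with respect to the Hausdorff metric, with Γ_1(θ) ∪ ⋯ ∪ Γ_k(θ) = σ(A(θ)) for all θ ∈ P and pairwise strictly disjoint, i.e. Γ_i(P) ∩ Γ_j(P) = ∅ for i ≠ j, where Γ_i(P) := ∪_{θ∈P} Γ_i(θ). Let T : P → GL_n(ℂ) be continuous with T(θ)^{−1} A(θ) T(θ) = diag(A_1(θ), …, A_k(θ)), where A_i(θ) ∈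 ℂ^{n_i×n_i} and σ(A_i(θ)) = Γ_i(θ) for all θ, and let B_i(θ) ∈ ℂ^{n_i×m} denote the i-th block row of T(θ)^{−1} B(θ). Then: (a) if (A, B) is uniformly ensemble reachable on C(P, ℂ^n), then each subpair (A_i, B_i) is uniformly ensemble reachable on C(P, ℂ^{n_i}); (b) conversely, if each subpair (A_i, B_i) is uniformly ensemble reachable on C(P, ℂ^{n_i}) and additionally ℂ \ Γ_i(P) is connected for every i, then (A, B) is uniformly ensemble reachable on C(P, ℂ^n). -/
open Polynomial Matrix

section
open Filter Topology

lemma ER.mem_of_dual {E : Type*} [NormedAddCommGroup E] [NormedSpace ℂ E] (S : Submodule ℂ E)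
    (hS : IsClosed (S : Set E)) (x : E)
    (h : ∀ l : E →L[ℂ] ℂ, (∀ s ∈ S, l s = 0) → l x = 0) : x ∈ S := by
  by_contra hx
  have hx' : x ∉ (S : Set E) := hx
  obtain ⟨f, u, hf, hu⟩ := RCLike.geometric_hahn_banach_closed_point (𝕜 := ℂ)
    (s := (S : Set E)) (S.restrictScalars ℝ).convex hS hx'
  have h0 : ∀ s ∈ S, f s = 0 := by
    intro s hs
    by_contra hne
    have := hf (((u : ℂ) / f s) • s) (S.smul_mem _ hs)
    rw [map_smul, smul_eq_mul, div_mul_cancel₀ _ hne] at this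
    simp at this
  have h1 := h f h0
  have h2 := hf 0 S.zero_mem
  rw [h1] at hu
  simp at h2 hu
  linarith

lemma ER.idem_mem {A : Type*} [NormedRing A] [NormedAlgebra ℂ A] [CompleteSpace A] {k : ℕ}
    (D : A) (d e : Fin k → A) (K : Fin k → Set ℂ) (hK : ∀ i, IsCompact (K i))
    (hdisj : ∀ i j, i ≠ j → Disjoint (K i) (K j))
    (hsum : ∑ i, e i = 1) (hDe : ∀ i, D * e i = d i * e i) (hcomm : ∀ i, d i * e i = e i * d i)
    (hd : ∀ i, spectrum ℂ (d i) ⊆ K i) (hD : spectrum ℂ D = ⋃ i, K i)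
    (hconn : IsPreconnected (⋃ i, K i)ᶜ) (i : Fin k) :
    e i ∈ Algebra.elemental ℂ D := by
  set S := Algebra.elemental ℂ D with hSdef
  have hScl : IsClosed (S : Set A) := Algebra.elemental.isClosed ℂ D
  -- resolvents lie in S
  have hres : ∀ z ∉ (⋃ i, K i), resolvent D z ∈ S := by
    intro z hz
    have h1 := Subalgebra.spectrum_eq_of_isPreconnected_compl (𝕜 := ℂ) S
      (⟨D, Algebra.elemental.self_mem ℂ D⟩ : S) (by simpa [hD] using hconn)
    have hz1 : z ∉ spectrum ℂ (⟨D, Algebra.elemental.self_mem ℂ D⟩ : S) := by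
      rw [h1]; simpa [hD] using hz
    rw [spectrum.notMem_iff] at hz1
    obtain ⟨u, hu⟩ := hz1
    have hu' : (Units.map S.val.toMonoidHom u : A) = algebraMap ℂ A z - D := by
      have := congrArg (fun s : S => (s : A)) hu
      simpa using this
    have : resolvent D z = ((u⁻¹ : Sˣ) : S) := by
      unfold resolvent
      rw [← hu', Ring.inverse_unit]
      rfl
    rw [this]
    exact Subtype.coe_prop _
  refine ER.mem_of_dual (Subalgebra.toSubmodule S) hScl (e i) ?_
  intro l hl
  have hl' : ∀ s ∈ S, l s = 0 := hl
  let F : Fin k → ℂ → ℂ := fun j z => l (e j * resolvent (d j) z)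
  have hdres : ∀ j z, z ∉ K j → z ∈ resolventSet ℂ (d j) := by
    intro j z hz
    by_contra h
    exact hz (hd j h)
  have hunit : ∀ j z, z ∉ K j → (algebraMap ℂ A z - d j) * resolvent (d j) z = 1 := by
    intro j z hz
    exact Ring.mul_inverse_cancel _ (hdres j z hz)
  have hFsum : ∀ z ∉ (⋃ i, K i), ∑ j, F j z = 0 := by
    intro z hz
    have hzD : z ∈ resolventSet ℂ D := by
      by_contra h
      exact hz (hD ▸ h)
    have hj : ∀ j, e j * resolvent (d j) z = resolvent D z * e j := by
      intro j
      have hzj : z ∉ K j := fun h => hz (Set.mem_iUnion.2 ⟨j, h⟩)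
      have h1 : (algebraMap ℂ A z - D) * (e j * resolvent (d j) z) = e j := by
        rw [← mul_assoc, sub_mul, hDe, hcomm, Algebra.commutes z (e j), ← mul_sub, mul_assoc,
          hunit j z hzj, mul_one]
      calc e j * resolvent (d j) z
          = (resolvent D z * (algebraMap ℂ A z - D)) * (e j * resolvent (d j) z) := by
            rw [show resolvent D z * (algebraMap ℂ A z - D) = 1 from
              Ring.inverse_mul_cancel _ hzD, one_mul]
        _ = _ := by rw [mul_assoc, h1]
    change ∑ j, l (e j * resolvent (d j) z) = 0
    simp_rw [hj]
    rw [← map_sum, ← Finset.mul_sum, hsum, mul_one]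
    exact hl' _ (hres z hz)
  have hFdiff : ∀ j z, z ∉ K j → DifferentiableAt ℂ (F j) z := by
    intro j z hz
    have h1 : DifferentiableAt ℂ (resolvent (d j)) z :=
      (spectrum.hasDerivAt_resolvent_const_left (hdres j z hz)).differentiableAt
    exact l.differentiableAt.comp z ((differentiableAt_const _).mul h1)
  classical
  let G : ℂ → ℂ := fun z => if z ∈ K i then -∑ j ∈ Finset.univ.erase i, F j z else F i z
  have hG1 : ∀ z, (∀ j, j ≠ i → z ∉ K j) → G z = -∑ j ∈ Finset.univ.erase i, F j z := by
    intro z hz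
    by_cases hzi : z ∈ K i
    · simp [G, hzi]
    · have : z ∉ ⋃ j, K j := by
        simp only [Set.mem_iUnion, not_exists]
        intro j
        by_cases hji : j = i
        · rwa [hji]
        · exact hz j hji
      have h2 := hFsum z this
      rw [← Finset.add_sum_erase _ _ (Finset.mem_univ i)] at h2
      simp only [G, hzi, if_false]
      exact eq_neg_of_add_eq_zero_left h2
  have hGdiff : Differentiable ℂ G := by
    intro z
    by_cases hzi : z ∈ K i
    · have hz : ∀ j, j ≠ i → z ∉ K j := fun j hji h =>
        Set.disjoint_left.1 (hdisj j i hji) h hzi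
      have hev : G =ᶠ[𝓝 z] fun z => -∑ j ∈ Finset.univ.erase i, F j z := by
        have : ∀ᶠ w in 𝓝 z, ∀ j, j ≠ i → w ∉ K j := by
          rw [eventually_all]
          intro j
          by_cases hji : j = i
          · simp [hji]
          · filter_upwards [(hK j).isClosed.isOpen_compl.mem_nhds (hz j hji)] with w hw _
            exact hw
        filter_upwards [this] with w hw using hG1 w hw
      refine DifferentiableAt.congr_of_eventuallyEq ?_ hev
      refine DifferentiableAt.neg ?_
      refine DifferentiableAt.fun_sum ?_
      intro j hj
      exact hFdiff j z (hz j (Finset.ne_of_mem_erase hj))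
    · have hev : G =ᶠ[𝓝 z] F i := by
        filter_upwards [(hK i).isClosed.isOpen_compl.mem_nhds hzi] with w hw
        simp only [G]
        rw [if_neg hw]
      exact (hFdiff i z hzi).congr_of_eventuallyEq hev
  have hevK : ∀ᶠ z in cocompact ℂ, z ∉ K i := (hK i).compl_mem_cocompact
  have hRt : Tendsto (resolvent (d i)) (cocompact ℂ) (𝓝 0) := by
    have := spectrum.resolvent_tendsto_cobounded (𝕜 := ℂ) (d i)
    rwa [Metric.cobounded_eq_cocompact] at this
  have hGt : Tendsto G (cocompact ℂ) (𝓝 0) := by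
    have h1 : Tendsto (F i) (cocompact ℂ) (𝓝 0) := by
      have := (l.continuous.tendsto _).comp (hRt.const_mul (e i))
      rw [mul_zero, map_zero] at this
      exact this
    refine h1.congr' ?_
    filter_upwards [hevK] with z hz
    simp only [G]
    rw [if_neg hz]
  have hG0 : ∀ z, G z = 0 := fun z => hGdiff.apply_eq_of_tendsto_cocompact z hGt
  have hfin : Tendsto (fun z => -l (e i * d i * resolvent (d i) z)) (cocompact ℂ) (𝓝 0) := by
    have := ((l.continuous.tendsto _).comp (hRt.const_mul (e i * d i))).neg
    simpa using this
  have hconst : (fun z => -l (e i * d i * resolvent (d i) z)) =ᶠ[cocompact ℂ] fun _ => l (e i) := by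
    filter_upwards [hevK] with z hz
    have h1 : F i z = 0 := by
      have := hG0 z
      simp only [G] at this
      rwa [if_neg hz] at this
    have h2 : e i = z • (e i * resolvent (d i) z) - e i * d i * resolvent (d i) z := by
      have h3 := congrArg (fun t => e i * t) (hunit i z hz)
      simp only [mul_one, sub_mul, mul_sub] at h3
      rw [← Algebra.smul_def, mul_smul_comm, ← mul_assoc (e i) (d i)] at h3
      exact h3.symm
    rw [congrArg l h2, map_sub, map_smul]
    change _ = z • F i z - _
    rw [h1]; simp
  have := (tendsto_congr' hconst).1 hfin
  exact tendsto_nhds_unique tendsto_const_nhds this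

lemma ER.log_step (K : Set ℂ) (p p' : ℂ) (h : ∀ z ∈ K, ‖p - p'‖ < ‖z - p'‖)
    (hlog : ∃ g : ℂ → ℂ, ContinuousOn g K ∧ ∀ z ∈ K, Complex.exp (g z) = z - p') :
    ∃ g : ℂ → ℂ, ContinuousOn g K ∧ ∀ z ∈ K, Complex.exp (g z) = z - p := by
  obtain ⟨g, hg, hge⟩ := hlog
  have hne : ∀ z ∈ K, z - p' ≠ 0 := fun z hz h0 => by
    have := h z hz
    rw [h0, norm_zero] at this
    exact absurd this (not_lt.2 (norm_nonneg _))
  have hslit : ∀ z ∈ K, 1 + (p' - p) / (z - p') ∈ Complex.slitPlane := by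
    intro z hz
    apply Complex.mem_slitPlane_of_norm_lt_one
    rw [norm_div, div_lt_one (norm_pos_iff.2 (hne z hz)), norm_sub_rev]
    exact h z hz
  refine ⟨fun z => g z + Complex.log (1 + (p' - p) / (z - p')), ?_, ?_⟩
  · refine hg.add (ContinuousOn.clog ?_ hslit)
    exact continuousOn_const.add (continuousOn_const.div (by fun_prop) hne)
  · intro z hz
    rw [Complex.exp_add, hge z hz, Complex.exp_log (Complex.slitPlane_ne_zero (hslit z hz))]
    have := hne z hz
    field_simp
    ring

lemma ER.exists_log (K : Set ℂ) (hK : IsCompact K) (hc : IsPreconnected Kᶜ) (p : ℂ) (hp : p ∉ K) :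
    ∃ g : ℂ → ℂ, ContinuousOn g K ∧ ∀ z ∈ K, Complex.exp (g z) = z - p := by
  let V : Set ℂ := {p | p ∈ Kᶜ ∧ ∃ g : ℂ → ℂ, ContinuousOn g K ∧ ∀ z ∈ K, Complex.exp (g z) = z - p}
  have hball : ∀ q ∈ Kᶜ, ∃ δ > 0, ∀ z ∈ K, δ ≤ ‖z - q‖ := by
    intro q hq
    obtain ⟨δ, hδ, hb⟩ := Metric.isOpen_iff.1 hK.isClosed.isOpen_compl q hq
    refine ⟨δ, hδ, fun z hz => ?_⟩
    by_contra hlt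
    exact hb (show z ∈ Metric.ball q δ by rw [mem_ball_iff_norm]; linarith) hz
  have hVo : IsOpen V := by
    rw [Metric.isOpen_iff]
    rintro q ⟨hq, hlog⟩
    obtain ⟨δ, hδ, hb⟩ := hball q hq
    refine ⟨δ, hδ, fun w hw => ⟨fun hwK => ?_, ER.log_step K w q (fun z hz => ?_) hlog⟩⟩
    · have := hb w hwK
      rw [mem_ball_iff_norm] at hw
      linarith
    · have := hb z hz
      rw [mem_ball_iff_norm] at hw
      linarith
  have hVcl : closure V ∩ Kᶜ ⊆ V := by
    rintro q ⟨hq, hqK⟩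
    obtain ⟨δ, hδ, hb⟩ := hball q hqK
    obtain ⟨w, hw, hd⟩ := Metric.mem_closure_iff.1 hq (δ / 2) (by positivity)
    refine ⟨hqK, ER.log_step K q w (fun z hz => ?_) hw.2⟩
    rw [dist_eq_norm] at hd
    have h1 := hb z hz
    have h2 : ‖z - q‖ ≤ ‖z - w‖ + ‖q - w‖ := by
      rw [show z - q = (z - w) - (q - w) by ring]; exact norm_sub_le _ _
    linarith
  have hVne : (Kᶜ ∩ V).Nonempty := by
    obtain ⟨R, hR⟩ := hK.isBounded.exists_norm_le
    set q : ℂ := ((|R| + 1 : ℝ) : ℂ) with hqd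
    have hqn : ‖q‖ = |R| + 1 := by
      rw [hqd, Complex.norm_real, Real.norm_eq_abs, abs_of_pos (by positivity)]
    have hlt : ∀ z ∈ K, ‖z‖ < ‖q‖ := fun z hz => by
      rw [hqn]; have := hR z hz; have := le_abs_self R; linarith
    have hqK : q ∈ Kᶜ := fun h => lt_irrefl _ (hlt q h)
    have hq0 : q ≠ 0 := by
      rw [← norm_pos_iff, hqn]; positivity
    have hslit : ∀ z ∈ K, 1 + (-z / q) ∈ Complex.slitPlane := by
      intro z hz
      apply Complex.mem_slitPlane_of_norm_lt_one
      rw [norm_div, norm_neg, div_lt_one (norm_pos_iff.2 hq0)]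
      exact hlt z hz
    refine ⟨q, hqK, hqK, fun z => Complex.log (-q) + Complex.log (1 + (-z / q)), ?_, ?_⟩
    · exact continuousOn_const.add (ContinuousOn.clog (by fun_prop) hslit)
    · intro z hz
      rw [Complex.exp_add, Complex.exp_log (neg_ne_zero.2 hq0),
        Complex.exp_log (Complex.slitPlane_ne_zero (hslit z hz))]
      field_simp
      ring
  exact (hc.subset_of_closure_inter_subset hVo hVne hVcl hp).2

lemma ER.no_ext (F : ℂ → ℂ) (hF : Continuous F) (hF0 : ∀ z, F z ≠ 0) (p : ℂ) (R : ℝ)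
    (h : ∀ z, R < ‖z‖ → F z = z - p) : False := by
  let F' : C(ℂ, {z : ℂ // z ≠ 0}) := ⟨fun z => ⟨F z, hF0 z⟩, by fun_prop⟩
  obtain ⟨L, ⟨-, hL⟩, -⟩ := Complex.isCoveringMap_exp.existsUnique_continuousMap_lifts F' 0
    (Complex.log (F 0)) (by ext; simp [F', Complex.exp_log (hF0 0)])
  have hL' : ∀ z, Complex.exp (L z) = F z := fun z => congrArg Subtype.val (congrFun hL z)
  set ρ : ℝ := |R| + ‖p‖ + 1 with hρ
  have hρ0 : 0 < ρ := by positivity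
  have hn : ∀ t : ℝ, R < ‖p + ρ * Complex.exp (t * Complex.I)‖ := by
    intro t
    have h1 : ‖(ρ : ℂ) * Complex.exp (t * Complex.I)‖ = ρ := by
      rw [norm_mul, Complex.norm_exp_ofReal_mul_I, mul_one, Complex.norm_real, Real.norm_eq_abs,
        abs_of_pos hρ0]
    have h2 := norm_sub_le (p + ρ * Complex.exp (t * Complex.I)) p
    rw [add_sub_cancel_left, h1] at h2
    have := le_abs_self R
    linarith
  have key : (fun t : ℝ => L (p + ρ * Complex.exp (t * Complex.I)))
      = fun t : ℝ => t * Complex.I + L (p + ρ) := by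
    refine Complex.isCoveringMap_exp.eq_of_comp_eq (by fun_prop) (by fun_prop) ?_ 0 (by simp)
    funext t
    ext
    simp only [Function.comp]
    have h0 := hn 0
    simp only [Complex.ofReal_zero, zero_mul, Complex.exp_zero, mul_one] at h0
    rw [hL', h _ (hn t), Complex.exp_add, hL', h _ h0]
    ring
  have h2 := congrFun key (2 * Real.pi)
  simp only [Complex.ofReal_mul, Complex.ofReal_ofNat, Complex.exp_two_pi_mul_I, mul_one] at h2
  have h3 : 2 * (Real.pi : ℂ) * Complex.I = 0 := by
    linear_combination -h2
  exact Complex.two_pi_I_ne_zero h3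

lemma ER.no_sep (K U V : Set ℂ) (hK : IsCompact K) (hU : IsOpen U) (hV : IsOpen V)
    (hUV : Disjoint U V) (hVK : Disjoint V K) (hcov : ∀ z, z ∈ K ∨ z ∈ U ∨ z ∈ V) (R : ℝ)
    (hR : ∀ z, R < ‖z‖ → z ∈ V) (p : ℂ) (hp : p ∈ U)
    (hlog : ∃ g : ℂ → ℂ, ContinuousOn g K ∧ ∀ z ∈ K, Complex.exp (g z) = z - p) : False := by
  classical
  obtain ⟨g, hg, hge⟩ := hlog
  obtain ⟨G, hG⟩ := ContinuousMap.exists_extension' (hK.isClosed.isClosedEmbedding_subtypeVal)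
    (⟨K.domRestrict g, hg.domRestrict⟩ : C(K, ℂ))
  have hG' : ∀ z ∈ K, G z = g z := fun z hz => congrFun hG ⟨z, hz⟩
  refine ER.no_ext (fun z => if z ∈ V then z - p else Complex.exp (G z)) ?_ ?_ p R ?_
  · refine Continuous.if ?_ (by fun_prop) (by fun_prop)
    intro z hz
    have hz : z ∈ frontier V := hz
    have hzV : z ∉ V := by
      rw [hV.frontier_eq] at hz; exact hz.2
    have hzU : z ∉ U := by
      intro h
      have := (hUV.closure_right hU)
      exact Set.disjoint_left.1 this h (frontier_subset_closure hz)
    have hzK : z ∈ K := by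
      rcases hcov z with h | h | h
      · exact h
      · exact absurd h hzU
      · exact absurd h hzV
    rw [hG' z hzK, hge z hzK]
  · intro z
    split_ifs with h
    · intro h0
      rw [sub_eq_zero] at h0
      exact Set.disjoint_left.1 hUV hp (h0 ▸ h)
    · exact Complex.exp_ne_zero _
  · intro z hz
    rw [if_pos (hR z hz)]

lemma ER.exterior_preconnected (R : ℝ) : IsPreconnected {z : ℂ | R < ‖z‖} := by
  have : {z : ℂ | R < ‖z‖} =
      (fun x : ℝ × ℝ => (x.1 : ℂ) * Complex.exp (x.2 * Complex.I)) '' (Set.Ioi R ×ˢ Set.univ) := by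
    ext z
    constructor
    · intro hz
      exact ⟨(‖z‖, z.arg), ⟨hz, trivial⟩, Complex.norm_mul_exp_arg_mul_I z⟩
    · rintro ⟨⟨r, t⟩, ⟨hr, -⟩, rfl⟩
      have hr' : R < r := hr
      simp only [Set.mem_ofPred_eq]
      rw [norm_mul, Complex.norm_exp_ofReal_mul_I, mul_one, Complex.norm_real, Real.norm_eq_abs]
      exact lt_of_lt_of_le hr' (le_abs_self r)
  rw [this]
  exact (isPreconnected_Ioi.prod isPreconnected_univ).image _ (by fun_prop)

lemma ER.preconnected_compl (K : Set ℂ) (hK : IsCompact K)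
    (hlog : ∀ p ∉ K, ∃ g : ℂ → ℂ, ContinuousOn g K ∧ ∀ z ∈ K, Complex.exp (g z) = z - p) :
    IsPreconnected Kᶜ := by
  obtain ⟨R, hR⟩ := hK.isBounded.exists_norm_le
  have hext : {z : ℂ | |R| < ‖z‖} ⊆ Kᶜ := fun z hz hzK => by
    have h1 := hR z hzK
    have h2 := le_abs_self R
    have h3 : |R| < ‖z‖ := hz
    linarith
  intro u v hu hv huv ⟨a, haK, hau⟩ ⟨b, hbK, hbv⟩
  by_contra hne
  rw [Set.not_nonempty_iff_eq_empty] at hne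
  have hd : ∀ z, z ∉ K → z ∈ u → z ∈ v → False := fun z h1 h2 h3 => by
    have : z ∈ Kᶜ ∩ (u ∩ v) := ⟨h1, h2, h3⟩
    rw [hne] at this; exact this
  have hKo := hK.isClosed.isOpen_compl
  have hcov : ∀ z, z ∈ K ∨ z ∈ u ∩ Kᶜ ∨ z ∈ v ∩ Kᶜ := by
    intro z
    by_cases hz : z ∈ K
    · exact Or.inl hz
    · rcases huv hz with h | h
      · exact Or.inr (Or.inl ⟨h, hz⟩)
      · exact Or.inr (Or.inr ⟨h, hz⟩)
  have hdis : Disjoint (u ∩ Kᶜ) (v ∩ Kᶜ) :=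
    Set.disjoint_left.2 fun z h1 h2 => hd z h1.2 h1.1 h2.1
  have hpre := ER.exterior_preconnected |R|
  rw [isPreconnected_iff_subset_of_disjoint] at hpre
  rcases hpre u v hu hv (hext.trans huv) (by
      ext z
      simp only [Set.mem_inter_iff, Set.mem_empty_iff_false, iff_false]
      rintro ⟨h1, h2, h3⟩
      exact hd z (hext h1) h2 h3) with h | h
  · exact ER.no_sep K (v ∩ Kᶜ) (u ∩ Kᶜ) hK (hv.inter hKo) (hu.inter hKo) hdis.symm
      (Set.disjoint_left.2 fun z h1 h2 => h1.2 h2)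
      (fun z => (hcov z).imp id Or.symm) |R| (fun z hz => ⟨h hz, hext hz⟩) b ⟨hbv, hbK⟩
      (hlog b hbK)
  · exact ER.no_sep K (u ∩ Kᶜ) (v ∩ Kᶜ) hK (hu.inter hKo) (hv.inter hKo) hdis
      (Set.disjoint_left.2 fun z h1 h2 => h1.2 h2)
      hcov |R| (fun z hz => ⟨h hz, hext hz⟩) a ⟨hau, haK⟩
      (hlog a haK)

lemma ER.preconnected_compl_iUnion {k : ℕ} (K : Fin k → Set ℂ) (hK : ∀ i, IsCompact (K i))
    (hdisj : ∀ i j, i ≠ j → Disjoint (K i) (K j)) (hc : ∀ i, IsPreconnected (K i)ᶜ) :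
    IsPreconnected (⋃ i, K i)ᶜ := by
  classical
  refine ER.preconnected_compl _ (isCompact_iUnion hK) ?_
  intro p hp
  have hp' : ∀ i, p ∉ K i := fun i h => hp (Set.mem_iUnion.2 ⟨i, h⟩)
  choose g hg hge using fun i => ER.exists_log (K i) (hK i) (hc i) p (hp' i)
  let f : ℂ → ℂ := fun z => if h : ∃ i, z ∈ K i then g h.choose z else 0
  have hf : ∀ i, ∀ z ∈ K i, f z = g i z := by
    intro i z hz
    have h : ∃ i, z ∈ K i := ⟨i, hz⟩
    have hi : h.choose = i := by
      by_contra hne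
      exact Set.disjoint_left.1 (hdisj _ _ hne) h.choose_spec hz
    simp only [f, dif_pos h]
    rw [hi]
  refine ⟨f, ?_, ?_⟩
  · have hlf : LocallyFinite K := locallyFinite_of_finite K
    exact hlf.continuousOn_iUnion (fun i => (hK i).isClosed)
      (fun i => (hg i).congr (fun z hz => hf i z hz))
  · intro z hz
    obtain ⟨i, hi⟩ := Set.mem_iUnion.1 hz
    rw [hf i z hi, hge i z hi]

end

section

lemma ER.spectrum_cm {R : Type*} [NormedRing R] [NormedAlgebra ℂ R] [CompleteSpace R]
    {X : Type*} [TopologicalSpace X] [CompactSpace X] (a : C(X, R)) :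
    spectrum ℂ a = ⋃ θ, spectrum ℂ (a θ) := by
  ext z
  rw [Set.mem_iUnion, spectrum.mem_iff, ContinuousMap.isUnit_iff_forall_isUnit]
  push Not
  rfl

lemma ER.isCompact_spec {R : Type*} [NormedRing R] [NormedAlgebra ℂ R] [CompleteSpace R]
    {X : Type*} [TopologicalSpace X] [CompactSpace X] (a : X → R) (ha : Continuous a) :
    IsCompact (⋃ θ, spectrum ℂ (a θ)) := by
  have := spectrum.isCompact (𝕜 := ℂ) (⟨a, ha⟩ : C(X, R))
  rwa [ER.spectrum_cm] at this

lemma ER.ens {R : Type*} [NormedRing R] [NormedAlgebra ℂ R] [CompleteSpace R]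
    {X : Type*} [TopologicalSpace X] [CompactSpace X] {k : ℕ}
    (D : X → R) (d e : Fin k → X → R) (hDc : Continuous D) (hdc : ∀ i, Continuous (d i))
    (hec : ∀ i, Continuous (e i))
    (K : Fin k → Set ℂ) (hK : ∀ i, IsCompact (K i))
    (hdisj : ∀ i j, i ≠ j → Disjoint (K i) (K j))
    (hsum : ∀ θ, ∑ i, e i θ = 1) (hDe : ∀ i θ, D θ * e i θ = d i θ * e i θ)
    (hcomm : ∀ i θ, d i θ * e i θ = e i θ * d i θ)
    (hd : ∀ i θ, spectrum ℂ (d i θ) ⊆ K i) (hD : ⋃ θ, spectrum ℂ (D θ) = ⋃ i, K i)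
    (hconn : IsPreconnected (⋃ i, K i)ᶜ) (i : Fin k) (ε : ℝ) (hε : 0 < ε) :
    ∃ q : Polynomial ℂ, ∀ θ, ‖Polynomial.aeval (D θ) q - e i θ‖ < ε := by
  let D' : C(X, R) := ⟨D, hDc⟩
  let d' : Fin k → C(X, R) := fun i => ⟨d i, hdc i⟩
  let e' : Fin k → C(X, R) := fun i => ⟨e i, hec i⟩
  have h := ER.idem_mem D' d' e' K hK hdisj
    (by ext θ; simpa [e'] using hsum θ) (fun i => by ext θ; exact hDe i θ)
    (fun i => by ext θ; exact hcomm i θ)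
    (fun i => by rw [ER.spectrum_cm]; exact Set.iUnion_subset (hd i))
    (by rw [ER.spectrum_cm]; exact hD) hconn i
  have h' : e' i ∈ closure ((Algebra.adjoin ℂ {D'} : Subalgebra ℂ C(X, R)) : Set C(X, R)) := h
  obtain ⟨b, hb, hbd⟩ := Metric.mem_closure_iff.1 h' ε hε
  have hb' : b ∈ Algebra.adjoin ℂ {D'} := hb
  rw [Algebra.adjoin_singleton_eq_range_aeval] at hb'
  obtain ⟨q, rfl⟩ := hb'
  refine ⟨q, fun θ => ?_⟩
  have h1 : Polynomial.aeval (D θ) q = (Polynomial.aeval D' q) θ := by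
    let ev : C(X, R) →ₐ[ℂ] R :=
      { toFun := fun g => g θ
        map_one' := rfl
        map_mul' := fun _ _ => rfl
        map_zero' := rfl
        map_add' := fun _ _ => rfl
        commutes' := fun _ => rfl }
    exact Polynomial.aeval_algHom_apply ev D' q
  rw [h1, ← dist_eq_norm, dist_comm]
  exact lt_of_le_of_lt (ContinuousMap.dist_apply_le_dist (f := e' i) θ) hbd

end

section
open scoped Matrix.Norms.Operator

lemma ER.bound {X : Type*} [TopologicalSpace X] [CompactSpace X] {ι κ : Type*} [Fintype ι]
    [Fintype κ] (M : X → Matrix ι κ ℂ) (hM : Continuous M) :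
    ∃ C : ℝ, 0 < C ∧ ∀ θ v, ‖(M θ).mulVec v‖ ≤ C * ‖v‖ := by
  obtain ⟨C, hC⟩ := isCompact_univ.exists_bound_of_continuousOn (f := M) hM.continuousOn
  refine ⟨|C| + 1, by positivity, fun θ v => ?_⟩
  refine (Matrix.linfty_opNorm_mulVec _ _).trans ?_
  have h1 := hC θ trivial
  have h2 := le_abs_self C
  gcongr
  linarith

lemma ER.mat_compact {X : Type*} [TopologicalSpace X] [CompactSpace X] {ι : Type*} [Fintype ι]
    [DecidableEq ι] (M : X → Matrix ι ι ℂ) (hM : Continuous M) :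
    IsCompact (⋃ θ, spectrum ℂ (M θ)) := ER.isCompact_spec M hM

lemma ER.mat_ens {ι : Type*} [Fintype ι] [DecidableEq ι]
    {X : Type*} [TopologicalSpace X] [CompactSpace X] {k : ℕ}
    (D : X → Matrix ι ι ℂ) (d e : Fin k → X → Matrix ι ι ℂ) (hDc : Continuous D)
    (hdc : ∀ i, Continuous (d i)) (hec : ∀ i, Continuous (e i))
    (K : Fin k → Set ℂ) (hK : ∀ i, IsCompact (K i))
    (hdisj : ∀ i j, i ≠ j → Disjoint (K i) (K j))
    (hsum : ∀ θ, ∑ i, e i θ = 1) (hDe : ∀ i θ, D θ * e i θ = d i θ * e i θ)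
    (hcomm : ∀ i θ, d i θ * e i θ = e i θ * d i θ)
    (hd : ∀ i θ, spectrum ℂ (d i θ) ⊆ K i) (hD : ⋃ θ, spectrum ℂ (D θ) = ⋃ i, K i)
    (hconn : IsPreconnected (⋃ i, K i)ᶜ) (i : Fin k) (ε : ℝ) (hε : 0 < ε) :
    ∃ q : Polynomial ℂ, ∀ θ v,
      ‖(Polynomial.aeval (D θ) q - e i θ).mulVec v‖ ≤ ε * ‖v‖ := by
  obtain ⟨q, hq⟩ := ER.ens D d e hDc hdc hec K hK hdisj hsum hDe hcomm hd hD hconn i ε hε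
  refine ⟨q, fun θ v => (Matrix.linfty_opNorm_mulVec _ _).trans ?_⟩
  gcongr
  exact (hq θ).le

end

lemma ER.continuous_inv {X : Type*} [TopologicalSpace X] {ι : Type*} [Fintype ι] [DecidableEq ι]
    (T : X → Matrix ι ι ℂ) (hT : Continuous T) (hu : ∀ θ, IsUnit (T θ)) :
    Continuous fun θ => (T θ)⁻¹ := by
  simp only [Matrix.inv_def, Ring.inverse_eq_inv']
  refine Continuous.smul (hT.matrix_det.inv₀ fun θ => ?_) hT.matrix_adjugate
  exact ((Matrix.isUnit_iff_isUnit_det _).1 (hu θ)).ne_zero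

lemma ER.aeval_conj {ι : Type*} [Fintype ι] [DecidableEq ι] (A T : Matrix ι ι ℂ) (hT : IsUnit T)
    (p : Polynomial ℂ) : Polynomial.aeval A p * T = T * Polynomial.aeval (T⁻¹ * A * T) p := by
  have hd := (Matrix.isUnit_iff_isUnit_det _).1 hT
  have h1 : A * T = T * (T⁻¹ * A * T) := by
    rw [← mul_assoc, ← mul_assoc, Matrix.mul_nonsing_inv _ hd, one_mul]
  set D := T⁻¹ * A * T
  have hpow : ∀ n : ℕ, A ^ n * T = T * D ^ n := by
    intro n
    induction n with
    | zero => simp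
    | succ n ih => rw [pow_succ, mul_assoc, h1, ← mul_assoc, ih, mul_assoc, pow_succ]
  induction p using Polynomial.induction_on' with
  | add p q hp hq => rw [map_add, map_add, add_mul, mul_add, hp, hq]
  | monomial n a =>
    rw [Polynomial.aeval_monomial, Polynomial.aeval_monomial, mul_assoc, hpow, ← mul_assoc,
      ← mul_assoc, Algebra.commutes a T]

lemma ER.reach_conj {P : Set ℂ} [CompactSpace P] {ι κ : Type*} [Fintype ι] [DecidableEq ι]
    [Fintype κ] (A T : P → Matrix ι ι ℂ) (B : P → Matrix ι κ ℂ) (hT : Continuous T)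
    (hu : ∀ θ, IsUnit (T θ)) (h : UniformEnsembleReachable P A B) :
    UniformEnsembleReachable P (fun θ => (T θ)⁻¹ * A θ * T θ) (fun θ => (T θ)⁻¹ * B θ) := by
  intro f hf ε hε
  obtain ⟨C, hC0, hC⟩ := ER.bound _ (ER.continuous_inv T hT hu)
  obtain ⟨p, hp⟩ := h (fun θ => (T θ).mulVec (f θ)) (hT.matrix_mulVec hf) (ε / C) (by positivity)
  refine ⟨p, fun θ => ?_⟩
  have hd := (Matrix.isUnit_iff_isUnit_det _).1 (hu θ)
  have key : (∑ j : κ, (Polynomial.aeval ((T θ)⁻¹ * A θ * T θ) (p j)).mulVec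
      fun i => ((T θ)⁻¹ * B θ) i j) - f θ = ((T θ)⁻¹).mulVec
      ((∑ j : κ, (Polynomial.aeval (A θ) (p j)).mulVec fun i => B θ i j)
        - (T θ).mulVec (f θ)) := by
    rw [Matrix.mulVec_sub, Matrix.mulVec_mulVec, Matrix.nonsing_inv_mul _ hd, Matrix.one_mulVec,
      Matrix.mulVec_sum]
    congr 1
    refine Finset.sum_congr rfl fun j _ => ?_
    have h1 : (fun i => ((T θ)⁻¹ * B θ) i j) = ((T θ)⁻¹).mulVec fun i => B θ i j := by
      funext i; rfl
    rw [h1, Matrix.mulVec_mulVec, Matrix.mulVec_mulVec]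
    congr 1
    have h2 := ER.aeval_conj (A θ) (T θ) (hu θ) (p j)
    calc _ = (T θ)⁻¹ * (T θ * Polynomial.aeval ((T θ)⁻¹ * A θ * T θ) (p j)) * (T θ)⁻¹ := by
          rw [← mul_assoc, Matrix.nonsing_inv_mul _ hd, one_mul]
      _ = _ := by
          rw [← h2, mul_assoc, mul_assoc, Matrix.mul_nonsing_inv _ hd, mul_one]
  rw [key]
  refine (hC θ _).trans_lt ?_
  have := hp θ
  rw [lt_div_iff₀ hC0] at this
  linarith

lemma ER.aeval_block {k : ℕ} {nn : Fin k → ℕ} (M : (i : Fin k) → Matrix (Fin (nn i)) (Fin (nn i)) ℂ)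
    (p : Polynomial ℂ) :
    Polynomial.aeval (Matrix.blockDiagonal' M) p
      = Matrix.blockDiagonal' fun i => Polynomial.aeval (M i) p := by
  induction p using Polynomial.induction_on' with
  | add p q hp hq =>
    simp only [map_add, hp, hq]
    exact (Matrix.blockDiagonal'_add _ _).symm
  | monomial n a =>
    simp only [Polynomial.aeval_monomial, ← Algebra.smul_def]
    rw [← Matrix.blockDiagonal'_pow]
    exact (Matrix.blockDiagonal'_smul a (M ^ n)).symm

lemma ER.block_mulVec {k : ℕ} {nn : Fin k → ℕ}
    (M : (i : Fin k) → Matrix (Fin (nn i)) (Fin (nn i)) ℂ)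
    (v : ((i : Fin k) × Fin (nn i)) → ℂ) (l : Fin k) (a : Fin (nn l)) :
    (Matrix.blockDiagonal' M).mulVec v ⟨l, a⟩ = (M l).mulVec (fun b => v ⟨l, b⟩) a := by
  simp only [Matrix.mulVec, dotProduct, Fintype.sum_sigma]
  rw [Finset.sum_eq_single l]
  · simp [Matrix.blockDiagonal'_apply_eq]
  · intro j _ hj
    refine Finset.sum_eq_zero fun b _ => ?_
    rw [Matrix.blockDiagonal'_apply_ne _ _ _ hj.symm, zero_mul]
  · simp

lemma ER.block_sum {k : ℕ} {nn : Fin k → ℕ} {κ : Type*} [Fintype κ]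
    (M : (i : Fin k) → Matrix (Fin (nn i)) (Fin (nn i)) ℂ)
    (C : Matrix ((i : Fin k) × Fin (nn i)) κ ℂ) (p : κ → Polynomial ℂ)
    (l : Fin k) (a : Fin (nn l)) :
    (∑ j : κ, (Polynomial.aeval (Matrix.blockDiagonal' M) (p j)).mulVec fun i => C i j) ⟨l, a⟩
      = (∑ j : κ, (Polynomial.aeval (M l) (p j)).mulVec fun i => C ⟨l, i⟩ j) a := by
  simp only [Finset.sum_apply, ER.aeval_block, ER.block_mulVec]

lemma ER.part_a {k : ℕ} {nn : Fin k → ℕ} {κ : Type*} [Fintype κ] {P : Set ℂ}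
    (M : (i : Fin k) → P → Matrix (Fin (nn i)) (Fin (nn i)) ℂ)
    (C : P → Matrix ((i : Fin k) × Fin (nn i)) κ ℂ)
    (h : UniformEnsembleReachable P (fun θ => Matrix.blockDiagonal' fun i => M i θ) C) (l : Fin k) :
    UniformEnsembleReachable P (M l) (fun θ => fun a j => C θ ⟨l, a⟩ j) := by
  intro f hf ε hε
  let f' : P → ((i : Fin k) × Fin (nn i)) → ℂ := fun θ x =>
    if hx : x.1 = l then f θ (hx ▸ x.2) else 0
  have hf' : Continuous f' := by
    refine continuous_pi fun x => ?_
    by_cases hx : x.1 = l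
    · simp only [f', dif_pos hx]
      exact (continuous_apply _).comp hf
    · simp only [f', dif_neg hx]
      exact continuous_const
  obtain ⟨p, hp⟩ := h f' hf' ε hε
  refine ⟨p, fun θ => ?_⟩
  rw [pi_norm_lt_iff hε]
  intro a
  have h1 := (pi_norm_lt_iff hε).1 (hp θ) ⟨l, a⟩
  rw [Pi.sub_apply, ER.block_sum] at h1
  simpa [f'] using h1

lemma ER.part_b {k : ℕ} {nn : Fin k → ℕ} {κ : Type*} [Fintype κ] {P : Set ℂ} [CompactSpace P]
    (M : (i : Fin k) → P → Matrix (Fin (nn i)) (Fin (nn i)) ℂ) (hM : ∀ i, Continuous (M i))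
    (C : P → Matrix ((i : Fin k) × Fin (nn i)) κ ℂ) (hC : Continuous C)
    (K : Fin k → Set ℂ) (hKne : ∀ i, (K i).Nonempty)
    (hdisj : ∀ i j, i ≠ j → Disjoint (K i) (K j))
    (hMK : ∀ i, ⋃ θ, spectrum ℂ (M i θ) = K i)
    (hD : ⋃ θ, spectrum ℂ (Matrix.blockDiagonal' fun i => M i θ) = ⋃ i, K i)
    (hconn : ∀ i, IsPreconnected (K i)ᶜ)
    (h : ∀ l, UniformEnsembleReachable P (M l) (fun θ => fun a j => C θ ⟨l, a⟩ j)) :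
    UniformEnsembleReachable P (fun θ => Matrix.blockDiagonal' fun i => M i θ) C := by
  intro f hf ε hε
  have hK : ∀ i, IsCompact (K i) := fun i => hMK i ▸ ER.mat_compact (M i) (hM i)
  have hDc : Continuous fun θ => Matrix.blockDiagonal' fun i => M i θ :=
    Continuous.matrix_blockDiagonal' (continuous_pi hM)
  set D : P → Matrix ((i : Fin k) × Fin (nn i)) ((i : Fin k) × Fin (nn i)) ℂ :=
    fun θ => Matrix.blockDiagonal' fun i => M i θ with hDdef
  choose c hc using hKne
  let φ := Matrix.blockDiagonal'RingHom (fun i => Fin (nn i)) ℂ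
  let e : Fin k → P → Matrix ((i : Fin k) × Fin (nn i)) ((i : Fin k) × Fin (nn i)) ℂ :=
    fun i _ => φ (Pi.single i 1)
  let dd : (i : Fin k) → P → (j : Fin k) → Matrix (Fin (nn j)) (Fin (nn j)) ℂ :=
    fun i θ => Function.update (fun j => algebraMap ℂ _ (c i)) i (M i θ)
  let d : Fin k → P → Matrix ((i : Fin k) × Fin (nn i)) ((i : Fin k) × Fin (nn i)) ℂ :=
    fun i θ => φ (dd i θ)
  have hens := ER.mat_ens D d e hDc
    (fun i => by
      refine Continuous.matrix_blockDiagonal' ?_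
      exact continuous_const.update i (hM i))
    (fun i => continuous_const) K hK hdisj
    (fun θ => by
      change ∑ i, φ (Pi.single i 1) = 1
      rw [← map_sum, ← map_one φ]
      congr 1
      exact Finset.univ_sum_single (1 : (j : Fin k) → Matrix (Fin (nn j)) (Fin (nn j)) ℂ))
    (fun i θ => by
      change φ (fun i => M i θ) * φ _ = φ _ * φ _
      rw [← map_mul, ← map_mul]
      congr 1
      funext j
      by_cases hj : j = i
      · subst hj; simp [dd]
      · simp [hj])
    (fun i θ => by
      change φ _ * φ _ = φ _ * φ _
      rw [← map_mul, ← map_mul]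
      congr 1
      funext j
      by_cases hj : j = i
      · subst hj; simp
      · simp [hj])
    (fun i θ z hz => by
      by_contra hzK
      refine hz ?_
      have h1 : algebraMap ℂ _ z - d i θ = φ (algebraMap ℂ _ z - dd i θ) := by
        rw [map_sub]
        congr 1
        rw [Algebra.algebraMap_eq_smul_one, Algebra.algebraMap_eq_smul_one]
        change _ = Matrix.blockDiagonal' _
        rw [Matrix.blockDiagonal'_smul, Matrix.blockDiagonal'_one]
      change IsUnit _
      rw [h1]
      refine IsUnit.map φ ?_
      rw [Pi.isUnit_iff]
      intro j
      by_cases hj : j = i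
      · subst hj
        have h2 : z ∉ spectrum ℂ (M j θ) := fun h3 => hzK (by
          rw [← hMK j]; exact Set.mem_iUnion.2 ⟨θ, h3⟩)
        rw [spectrum.notMem_iff] at h2
        simpa [dd] using h2
      · have h2 : z - c i ≠ 0 := fun h3 => hzK (by rw [sub_eq_zero.1 h3]; exact hc i)
        have h3 := (isUnit_iff_ne_zero.2 h2).map
          (algebraMap ℂ (Matrix (Fin (nn j)) (Fin (nn j)) ℂ))
        rw [map_sub] at h3
        simpa [dd, hj] using h3)
    hD (ER.preconnected_compl_iUnion K hK hdisj hconn)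
  -- block approximations
  choose p hp using fun l => h l (fun θ a => f θ ⟨l, a⟩) (by fun_prop) (ε / 2) (by positivity)
  let v : Fin k → P → ((i : Fin k) × Fin (nn i)) → ℂ := fun i θ =>
    ∑ j : κ, (Polynomial.aeval (D θ) (p i j)).mulVec fun x => C θ x j
  have hv : ∀ i, Continuous (v i) := by
    intro i
    refine continuous_finsetSum _ fun j _ => ?_
    refine Continuous.matrix_mulVec ?_ ?_
    · exact (Polynomial.continuous_aeval (p i j)).comp hDc
    · exact continuous_pi fun x => hC.matrix_elem x j
  have hvb : ∀ i, ∃ b : ℝ, ∀ θ, ‖v i θ‖ ≤ b := fun i => by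
    obtain ⟨b, hb⟩ := isCompact_univ.exists_bound_of_continuousOn (f := v i) (hv i).continuousOn
    exact ⟨b, fun θ => hb θ trivial⟩
  choose b hb using hvb
  set S : ℝ := ∑ i, |b i| with hS
  have hS0 : 0 ≤ S := Finset.sum_nonneg fun i _ => abs_nonneg _
  set δ : ℝ := ε / (2 * (S + 1)) with hδ
  have hδ0 : 0 < δ := by positivity
  choose q hq using fun i => hens i δ hδ0
  refine ⟨fun j => ∑ i, q i * p i j, fun θ => ?_⟩
  have hsum : (∑ j : κ, (Polynomial.aeval (D θ) (∑ i, q i * p i j)).mulVec fun x => C θ x j)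
      = ∑ i, (Polynomial.aeval (D θ) (q i)).mulVec (v i θ) := by
    simp only [v, map_sum, map_mul, Matrix.mulVec_sum, Matrix.sum_mulVec, Matrix.mulVec_mulVec]
    rw [Finset.sum_comm]
  have hsplit : (∑ i, (Polynomial.aeval (D θ) (q i)).mulVec (v i θ)) - f θ
      = (∑ i, (Polynomial.aeval (D θ) (q i) - e i θ).mulVec (v i θ))
        + ((∑ i, (e i θ).mulVec (v i θ)) - f θ) := by
    simp only [Matrix.sub_mulVec, Finset.sum_sub_distrib]
    abel
  have h1 : ‖∑ i, (Polynomial.aeval (D θ) (q i) - e i θ).mulVec (v i θ)‖ ≤ ε / 2 := by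
    calc _ ≤ ∑ i, δ * |b i| := by
          refine norm_sum_le_of_le _ fun i _ => (hq i θ _).trans ?_
          gcongr
          exact (hb i θ).trans (le_abs_self _)
      _ = δ * S := by rw [hS, Finset.mul_sum]
      _ ≤ δ * (S + 1) := by gcongr; linarith
      _ = ε / 2 := by rw [hδ]; field_simp
  have h2 : ‖(∑ i, (e i θ).mulVec (v i θ)) - f θ‖ < ε / 2 := by
    rw [pi_norm_lt_iff (by positivity)]
    rintro ⟨l, a⟩
    have h3 := (pi_norm_lt_iff (by positivity)).1 (hp l θ) a
    have h4 : (∑ i, (e i θ).mulVec (v i θ)) ⟨l, a⟩ = v l θ ⟨l, a⟩ := by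
      rw [Finset.sum_apply, Finset.sum_eq_single l]
      · change (Matrix.blockDiagonal' _).mulVec _ _ = _
        rw [ER.block_mulVec]
        simp
      · intro j _ hj
        change (Matrix.blockDiagonal' _).mulVec _ _ = _
        rw [ER.block_mulVec]
        simp [hj.symm]
      · simp
    rw [Pi.sub_apply, h4]
    simp only [v, D]
    rw [ER.block_sum]
    exact h3
  change ‖(∑ j : κ, (Polynomial.aeval (D θ) (∑ i, q i * p i j)).mulVec fun x => C θ x j)
    - f θ‖ < ε
  rw [hsum, hsplit]
  refine (norm_add_le _ _).trans_lt ?_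
  linarith

/-- decomposition theorem.  The state space is indexed by
`(i : Fin k) × Fin (nn i)` (encoding `n = nn 1 + ⋯ + nn k`); `T` conjugates `A` to the
block-diagonal matrix with blocks `Ai i` whose spectra are the pairwise strictly disjoint
continuous spectral family `Γ_i`, and `Bi i` is the `i`-th block row of `T⁻¹ B`.
(a) If `(A, B)` is uniformly ensemble reachable then so is each subpair `(Ai i, Bi i)`;
(b) conversely, if each subpair is uniformly ensemble reachable and each spectral set
`Γ_i(P)` does not separate the plane, then `(A, B)` is uniformly ensemble reachable. -/
theorem stmt_5 {k m : ℕ} (P : Set ℂ) (hP : IsCompact P) (hPne : P.Nonempty)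
    [ContractibleSpace P]
    (nn : Fin k → ℕ)
    (A : P → Matrix ((i : Fin k) × Fin (nn i)) ((i : Fin k) × Fin (nn i)) ℂ)
    (B : P → Matrix ((i : Fin k) × Fin (nn i)) (Fin m) ℂ)
    (hA : Continuous A) (hB : Continuous B)
    (Γ : Fin k → P → TopologicalSpace.NonemptyCompacts ℂ)
    (hΓcont : ∀ i, Continuous (Γ i))
    (hΓspec : ∀ θ : P, (⋃ i : Fin k, (Γ i θ : Set ℂ)) = spectrum ℂ (A θ))
    (hΓdisj : ∀ i j, i ≠ j →
      Disjoint (⋃ θ : P, (Γ i θ : Set ℂ)) (⋃ θ : P, (Γ j θ : Set ℂ)))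
    (T : P → Matrix ((i : Fin k) × Fin (nn i)) ((i : Fin k) × Fin (nn i)) ℂ)
    (hT : Continuous T) (hTunit : ∀ θ : P, IsUnit (T θ))
    (Ai : (i : Fin k) → P → Matrix (Fin (nn i)) (Fin (nn i)) ℂ)
    (hdiag : ∀ θ : P, (T θ)⁻¹ * A θ * T θ = Matrix.blockDiagonal' fun i => Ai i θ)
    (hAispec : ∀ (i : Fin k) (θ : P), spectrum ℂ (Ai i θ) = (Γ i θ : Set ℂ))
    (Bi : (i : Fin k) → P → Matrix (Fin (nn i)) (Fin m) ℂ)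
    (hBi : ∀ (i : Fin k) (θ : P) (a : Fin (nn i)) (j : Fin m),
      Bi i θ a j = ((T θ)⁻¹ * B θ) ⟨i, a⟩ j) :
    (UniformEnsembleReachable P A B →
      ∀ i : Fin k, UniformEnsembleReachable P (Ai i) (Bi i)) ∧
    ((∀ i : Fin k, UniformEnsembleReachable P (Ai i) (Bi i)) →
      (∀ i : Fin k, IsConnected ((⋃ θ : P, (Γ i θ : Set ℂ))ᶜ)) →
      UniformEnsembleReachable P A B) := by
  have : CompactSpace P := isCompact_iff_compactSpace.1 hP
  have hTi := ER.continuous_inv T hT hTunit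
  have hTdet : ∀ θ, IsUnit (T θ).det := fun θ => (Matrix.isUnit_iff_isUnit_det _).1 (hTunit θ)
  have hBi' : ∀ i, Bi i = fun θ => fun a j => ((T θ)⁻¹ * B θ) ⟨i, a⟩ j := by
    intro i; funext θ a j; exact hBi i θ a j
  have hD' : (fun θ => (T θ)⁻¹ * A θ * T θ) = fun θ => Matrix.blockDiagonal' fun i => Ai i θ :=
    funext hdiag
  have hDc : Continuous fun θ => Matrix.blockDiagonal' fun i => Ai i θ := by
    rw [← hD']; exact (hTi.mul hA).mul hT
  have hAic : ∀ i, Continuous (Ai i) := by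
    intro i
    have h1 := hDc.matrix_blockDiag'
    simp only [Matrix.blockDiag'_blockDiagonal'] at h1
    exact (continuous_apply i).comp h1
  constructor
  · intro h i
    have h1 := ER.reach_conj A T B hT hTunit h
    rw [hD'] at h1
    rw [hBi' i]
    exact ER.part_a Ai _ h1 i
  · intro h hconn
    obtain ⟨θ₀, hθ₀⟩ := hPne
    have h1 : UniformEnsembleReachable P (fun θ => Matrix.blockDiagonal' fun i => Ai i θ)
        (fun θ => (T θ)⁻¹ * B θ) := by
      refine ER.part_b Ai hAic _ (hTi.matrix_mul hB) (fun i => ⋃ θ : P, (Γ i θ : Set ℂ)) ?_ hΓdisj ?_ ?_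
        (fun i => (hconn i).isPreconnected) (fun l => hBi' l ▸ h l)
      · intro i
        obtain ⟨z, hz⟩ := (Γ i ⟨θ₀, hθ₀⟩).nonempty
        exact ⟨z, Set.mem_iUnion.2 ⟨_, hz⟩⟩
      · intro i
        simp only [hAispec]
      · rw [Set.iUnion_comm]
        refine Set.iUnion_congr fun θ => ?_
        rw [hΓspec θ, ← hdiag θ]
        obtain ⟨u, hu⟩ := hTunit θ
        rw [← hu, ← Matrix.coe_units_inv]
        have := spectrum.units_conjugate (R := ℂ) (a := A θ) (u := u⁻¹)
        rwa [inv_inv] at this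
    have hTiu : ∀ θ, IsUnit ((T θ)⁻¹) := fun θ => (Matrix.isUnit_nonsing_inv_iff).2 (hTunit θ)
    have h2 := ER.reach_conj _ (fun θ => (T θ)⁻¹) _ hTi hTiu h1
    convert h2 using 1
    · funext θ
      rw [← hdiag θ, Matrix.nonsing_inv_nonsing_inv _ (hTdet θ), ← mul_assoc, ← mul_assoc,
        Matrix.mul_nonsing_inv _ (hTdet θ), one_mul, mul_assoc, Matrix.mul_nonsing_inv _ (hTdet θ),
        mul_one]
    · funext θ
      rw [Matrix.nonsing_inv_nonsing_inv _ (hTdet θ), ← Matrix.mul_assoc,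
        Matrix.mul_nonsing_inv _ (hTdet θ), Matrix.one_mul]
end

section
/- Let P ⊆ ℂ be nonempty, compact and contractible with empty interior in ℂ, and let a, b : P → ℂ be continuous. Then the scalar pair (a, b) is uniformly ensemble reachable on C(P, ℂ) — i.e. for every continuous f : P → ℂ and every ε > 0 there exists a polynomial p ∈ ℂ[z] with sup_{θ∈P} |p(a(θ)) b(θ) − f(θ)| < ε — if and only if a is injective and b(θ) ≠ 0 for all θ ∈ P. -/
open Polynomial

/-- `f` has a continuous logarithm. -/
def HasLog8 {X : Type*} [TopologicalSpace X] (f : X → ℂ) : Prop :=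
  ∃ g : X → ℂ, Continuous g ∧ ∀ x, Complex.exp (g x) = f x

lemma HasLog8.comp {X Y : Type*} [TopologicalSpace X] [TopologicalSpace Y] {f : X → ℂ}
    (h : HasLog8 f) {u : Y → X} (hu : Continuous u) : HasLog8 (fun y => f (u y)) := by
  obtain ⟨g, hg, hgf⟩ := h
  exact ⟨fun y => g (u y), hg.comp hu, fun y => hgf _⟩

lemma HasLog8.homotopy {X : Type*} [TopologicalSpace X] (H : unitInterval × X → ℂ)
    (hH : Continuous H) (hne : ∀ p, H p ≠ 0) (h0 : HasLog8 (fun x => H (0, x))) :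
    HasLog8 (fun x => H (1, x)) := by
  obtain ⟨g, hg, hgf⟩ := h0
  let H' : C(unitInterval × X, {z : ℂ // z ≠ 0}) := ⟨fun p => ⟨H p, hne p⟩, by fun_prop⟩
  have H0 : ∀ a, H' (0, a) = ⟨_, (g a).exp_ne_zero⟩ := fun a => Subtype.ext (hgf a).symm
  refine ⟨fun x => Complex.isCoveringMap_exp.liftHomotopy H' ⟨g, hg⟩ H0 (1, x), by fun_prop, ?_⟩
  intro x
  have := congr_fun (Complex.isCoveringMap_exp.liftHomotopy_lifts H' ⟨g, hg⟩ H0) (1, x)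
  exact congrArg Subtype.val this

lemma HasLog8.const {X : Type*} [TopologicalSpace X] {c : ℂ} (hc : c ≠ 0) :
    HasLog8 (fun _ : X => c) :=
  ⟨fun _ => Complex.log c, continuous_const, fun _ => Complex.exp_log hc⟩

lemma HasLog8.of_contractible {X : Type*} [TopologicalSpace X] [ContractibleSpace X] {f : X → ℂ}
    (hf : Continuous f) (hne : ∀ x, f x ≠ 0) : HasLog8 f := by
  obtain ⟨x0, ⟨F⟩⟩ := id_nullhomotopic X
  have := HasLog8.homotopy (X := X) (fun p => f (F.symm p)) (by fun_prop) (fun p => hne _)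
    (by simpa using HasLog8.const (hne x0))
  simpa using this

/-- Borsuk: an odd function on the circle has no continuous logarithm. -/
lemma not_hasLog8_odd (f : Metric.sphere (0 : ℂ) 1 → ℂ) (hodd : ∀ z, f (-z) = - f z) :
    ¬ HasLog8 f := by
  rintro ⟨g, hg, hgf⟩
  have hconn : PreconnectedSpace (Metric.sphere (0 : ℂ) 1) := by
    apply Subtype.preconnectedSpace
    apply isPreconnected_sphere
    rw [Complex.rank_real_complex]; norm_num
  have key : ∀ z, ∃ n : ℤ, g (-z) - g z = (2 * n + 1) * (Real.pi * Complex.I) := by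
    intro z
    have : Complex.exp (g (-z)) = Complex.exp (g z + Real.pi * Complex.I) := by
      rw [Complex.exp_add, Complex.exp_pi_mul_I, hgf, hgf, hodd]; ring
    obtain ⟨n, hn⟩ := Complex.exp_eq_exp_iff_exists_int.1 this
    exact ⟨n, by rw [hn]; ring⟩
  choose n hn using key
  have hpi : (Real.pi : ℂ) * Complex.I ≠ 0 :=
    mul_ne_zero (by exact_mod_cast Real.pi_ne_zero) Complex.I_ne_zero
  have hcont : Continuous n := by
    have h1 : Continuous (fun z => ((n z : ℤ) : ℂ)) := by
      have : (fun z => ((n z : ℤ) : ℂ)) =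
          fun z => ((g (-z) - g z) / (Real.pi * Complex.I) - 1) / 2 := by
        funext z; rw [hn z]; field_simp; ring
      rw [this]; fun_prop
    have h2 : Continuous (fun z => ((n z : ℤ) : ℝ)) := by
      have := Complex.continuous_re.comp h1
      refine this.congr (fun z => ?_)
      simp
    exact Int.isClosedEmbedding_coe_real.isInducing.continuous_iff.2 h2
  let z0 : Metric.sphere (0 : ℂ) 1 := ⟨1, by simp⟩
  have heq : n z0 = n (-z0) := PreconnectedSpace.constant hconn hcont
  have h1 := hn z0
  have h2 := hn (-z0)
  rw [neg_neg, ← heq] at h2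
  have : ((2 * n z0 + 1 : ℤ) : ℂ) * (Real.pi * Complex.I) = 0 := by
    push_cast
    linear_combination (-1/2 : ℂ) * h1 - (1/2 : ℂ) * h2
  rcases mul_eq_zero.1 this with h | h
  · have : (2 * n z0 + 1 : ℤ) = 0 := by exact_mod_cast h
    omega
  · exact hpi h

/-- A planar compactum all of whose non-vanishing functions have logarithms does not separate. -/
lemma isPreconnected_compl8 (K : Set ℂ) (hK : IsCompact K)
    (hlog : ∀ f : K → ℂ, Continuous f → (∀ x, f x ≠ 0) → HasLog8 f) : IsPreconnected Kᶜ := by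
  obtain ⟨R, hR⟩ := hK.isBounded.subset_ball (0 : ℂ)
  let O : Set ℂ := (Metric.ball (0 : ℂ) (max R 1))ᶜ
  have hOK : O ⊆ Kᶜ := by
    intro z hz hzK
    exact hz (Metric.ball_subset_ball (le_max_left _ _) (hR hzK))
  have hO : IsPreconnected O := by
    have hs : IsPreconnected (Metric.sphere (0 : ℂ) 1) := by
      apply isPreconnected_sphere
      rw [Complex.rank_real_complex]; norm_num
    have himg := (isPreconnected_Ici (a := max R 1)).prod hs |>.image
      (fun q : ℝ × ℂ => (q.1 : ℂ) * q.2) (by fun_prop)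
    convert himg using 1
    ext z
    simp only [O, Set.mem_compl_iff, Metric.mem_ball, dist_zero_right, not_lt, Set.mem_image,
      Set.mem_prod, Set.mem_Ici, mem_sphere_zero_iff_norm, Prod.exists]
    constructor
    · intro hz
      have hz0 : 0 < ‖z‖ := lt_of_lt_of_le (by positivity) hz
      refine ⟨‖z‖, z / ‖z‖, ⟨hz, ?_⟩, ?_⟩
      · simp [hz0.ne']
      · have : (‖z‖ : ℂ) ≠ 0 := by exact_mod_cast hz0.ne'
        field_simp
    · rintro ⟨r, y, ⟨hr, hy⟩, rfl⟩
      have : 0 ≤ r := le_trans (by positivity) hr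
      simpa [hy, abs_of_nonneg this] using hr
  by_cases hcase : ∀ w ∈ Kᶜ, (connectedComponentIn Kᶜ w ∩ O).Nonempty
  · let p : ℂ := (max R 1 : ℝ)
    have hp : p ∈ O := by
      have h0 : (0 : ℝ) ≤ max R 1 := by positivity
      simp only [O, p, Set.mem_compl_iff, Metric.mem_ball, dist_zero_right, Complex.norm_real,
        Real.norm_of_nonneg h0, lt_irrefl, not_false_eq_true]
    apply isPreconnected_of_forall p
    intro w hw
    obtain ⟨q, hq1, hq2⟩ := hcase w hw
    refine ⟨connectedComponentIn Kᶜ w ∪ O, ?_, Or.inr hp, Or.inl (mem_connectedComponentIn hw), ?_⟩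
    · exact Set.union_subset (connectedComponentIn_subset _ _) hOK
    · exact IsPreconnected.union q hq1 hq2 isPreconnected_connectedComponentIn hO
  · exfalso
    push Not at hcase
    obtain ⟨w, hw, hwO⟩ := hcase
    set U := connectedComponentIn Kᶜ w with hU
    have hUo : IsOpen U := hK.isClosed.isOpen_compl.connectedComponentIn
    have hwU : w ∈ U := mem_connectedComponentIn hw
    have hfr : frontier U ⊆ K := by
      intro z hz
      by_contra hzK
      have hzU : z ∉ U := by
        rw [hUo.frontier_eq] at hz; exact hz.2
      have hV : IsOpen (connectedComponentIn Kᶜ z) := hK.isClosed.isOpen_compl.connectedComponentIn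
      have hzV : z ∈ connectedComponentIn Kᶜ z := mem_connectedComponentIn hzK
      obtain ⟨y, hy1, hy2⟩ := mem_closure_iff.1 (frontier_subset_closure hz) _ hV hzV
      have e1 := connectedComponentIn_eq hy1
      have e2 := connectedComponentIn_eq hy2
      exact hzU (by rw [hU, e2, ← e1]; exact hzV)
    obtain ⟨g, hg, hgf⟩ := hlog (fun z => (z : ℂ) - w) (by fun_prop)
      (fun z h => hw (by have := sub_eq_zero.1 h; rw [← this]; exact z.2))
    obtain ⟨G, hG⟩ := ContinuousMap.exists_restrict_eq hK.isClosed (⟨g, hg⟩ : C(K, ℂ))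
    have hGK : ∀ z (hz : z ∈ K), Complex.exp (G z) = z - w := by
      intro z hz
      have : G z = g ⟨z, hz⟩ := by
        have := congrArg (fun (f : C(K, ℂ)) => f ⟨z, hz⟩) hG
        simpa using this
      rw [this, hgf]
    classical
    let F : ℂ → ℂ := fun z => if z ∈ U then Complex.exp (G z) else z - w
    have hF : Continuous F := by
      apply continuous_if
      · intro z hz
        exact hGK z (hfr hz)
      · fun_prop
      · fun_prop
    have hFne : ∀ z, F z ≠ 0 := by
      intro z
      simp only [F]
      split_ifs with h
      · exact Complex.exp_ne_zero _
      · intro h'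
        rw [sub_eq_zero.1 h'] at h
        exact h hwU
    have hFlog := HasLog8.of_contractible hF hFne
    let M : ℝ := ‖w‖ + max R 1 + 1
    have hM : 0 < M := by positivity
    have hc : Continuous (fun z : Metric.sphere (0 : ℂ) 1 => w + M * (z : ℂ)) := by fun_prop
    refine not_hasLog8_odd _ ?_ (hFlog.comp hc)
    have : ∀ z : Metric.sphere (0 : ℂ) 1, F (w + M * (z : ℂ)) = M * (z : ℂ) := by
      intro z
      have hz1 : ‖(z : ℂ)‖ = 1 := mem_sphere_zero_iff_norm.1 z.2
      have : w + M * (z : ℂ) ∉ U := by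
        intro hin
        have : w + M * (z : ℂ) ∈ O := by
          simp only [O, Set.mem_compl_iff, Metric.mem_ball, dist_zero_right, not_lt]
          have h1 : ‖(M : ℂ) * z‖ = M := by
            rw [norm_mul, hz1, mul_one, Complex.norm_real, Real.norm_of_nonneg hM.le]
          have h2 : ‖(M : ℂ) * z‖ ≤ ‖w + M * z‖ + ‖w‖ := by
            have := norm_sub_le (w + M * (z : ℂ)) w
            simpa using this
          simp only [M] at h1 h2 ⊢
          linarith
        have := Set.mem_inter hin this
        rw [hwO] at this
        exact this
      simp [F, this]
    intro z
    rw [this, this]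
    simp

/-- Invariance-of-domain style lemma. -/
lemma interior_empty8 (P K : Set ℂ) (hint : interior P = ∅) (h : K → ℂ)
    (hc : Continuous h) (hinj : Function.Injective h) (hm : ∀ x, h x ∈ P) : interior K = ∅ := by
  by_contra hne
  obtain ⟨w, hw⟩ := Set.nonempty_iff_ne_empty.2 hne
  obtain ⟨ρ, hρ, hball⟩ := Metric.nhds_basis_closedBall.mem_iff.1 (mem_interior_iff_mem_nhds.1 hw)
  have hmem : ∀ z : ℂ, ‖z‖ ≤ 1 → w + ρ * z ∈ K := by
    intro z hz
    apply hball
    simp only [Metric.mem_closedBall, dist_self_add_left, norm_mul, Complex.norm_real,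
      Real.norm_of_nonneg hρ.le]
    nlinarith
  let D := Metric.closedBall (0 : ℂ) 1
  let S := Metric.sphere (0 : ℂ) 1
  have hD : ∀ z : D, ‖(z : ℂ)‖ ≤ 1 := fun z => mem_closedBall_zero_iff.1 z.2
  have hS : ∀ z : S, ‖(z : ℂ)‖ = 1 := fun z => mem_sphere_zero_iff_norm.1 z.2
  let k : D → ℂ := fun z => h ⟨w + ρ * z, hmem z (hD z)⟩
  have hk : Continuous k := by
    apply hc.comp; fun_prop
  have hkinj : ∀ x y : D, k x = k y → (x : ℂ) = y := by
    intro x y hxy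
    have := congrArg Subtype.val (hinj hxy)
    have hρ' : (ρ : ℂ) ≠ 0 := by exact_mod_cast hρ.ne'
    simpa [hρ'] using this
  have hkP : ∀ x, k x ∈ P := fun x => hm _
  let i : S → D := fun z => ⟨z, mem_closedBall_zero_iff.2 (hS z).le⟩
  have hi : Continuous i := by fun_prop
  let o : D := ⟨0, by simp [D]⟩
  -- distance
  have hcpt : IsCompact (Set.range fun z : S => k (i z)) :=
    haveI : CompactSpace S := isCompact_iff_compactSpace.1 (isCompact_sphere _ _)
    isCompact_range (hk.comp hi)
  have hnot : k o ∈ (Set.range fun z : S => k (i z))ᶜ := by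
    rintro ⟨z, hz⟩
    have := hkinj _ _ hz
    have h2 := hS z
    simp only [i, o] at this
    rw [this] at h2; simp at h2
  obtain ⟨ε, hε, hεb⟩ := Metric.isOpen_iff.1 hcpt.isClosed.isOpen_compl _ hnot
  have : ¬ (Metric.ball (k o) ε ⊆ P) := by
    intro hsub
    have : k o ∈ interior P := mem_interior.2 ⟨_, hsub, Metric.isOpen_ball, Metric.mem_ball_self hε⟩
    rw [hint] at this; exact this
  obtain ⟨p, hpb, hpP⟩ := Set.not_subset.1 this
  haveI : ContractibleSpace D :=
    (convex_closedBall (0 : ℂ) 1).contractibleSpace ⟨0, by simp⟩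
  have L1 : HasLog8 (fun z : D => k z - p) :=
    HasLog8.of_contractible (by fun_prop) (fun z hz => hpP (by rw [← sub_eq_zero.1 hz]; exact hkP z))
  have L2 : HasLog8 (fun z : S => k (i z) - p) := L1.comp hi
  have L3 : HasLog8 (fun z : S => k (i z) - k o) := by
    have := HasLog8.homotopy (X := S)
      (fun q => k (i q.2) - ((1 - ((q.1 : ℝ) : ℂ)) * p + ((q.1 : ℝ) : ℂ) * k o)) (by fun_prop) ?_
      (by simpa using L2)
    · simpa using this
    · rintro ⟨t, z⟩ hz
      have h1 := sub_eq_zero.1 hz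
      have h2 : (1 - ((t : ℝ) : ℂ)) * p + ((t : ℝ) : ℂ) * k o ∈ Metric.ball (k o) ε := by
        have := (convex_ball (k o) ε) hpb (Metric.mem_ball_self hε)
          (a := 1 - (t : ℝ)) (b := t) (by linarith [t.2.2]) t.2.1 (by ring)
        simpa using this
      exact hεb h2 ⟨z, h1⟩
  -- second homotopy
  have hA : ∀ q : unitInterval × S, ‖(q.2 : ℂ) / (1 + ((q.1 : ℝ) : ℂ))‖ ≤ 1 ∧
      ‖-(((q.1 : ℝ) : ℂ) * q.2 / (1 + ((q.1 : ℝ) : ℂ)))‖ ≤ 1 ∧ (1 + ((q.1 : ℝ) : ℂ)) ≠ 0 := by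
    rintro ⟨t, z⟩
    have h0 := t.2.1
    have h1 := t.2.2
    have e : ‖(1 + ((t : ℝ) : ℂ))‖ = 1 + t := by
      rw [← Complex.ofReal_one, ← Complex.ofReal_add, Complex.norm_real, Real.norm_of_nonneg]
      linarith
    refine ⟨?_, ?_, ?_⟩
    · rw [norm_div, e, hS, div_le_one (by linarith)]; linarith
    · rw [norm_neg, norm_div, norm_mul, e, hS, div_le_one (by linarith), Complex.norm_real,
        Real.norm_of_nonneg h0]; linarith
    · rw [← norm_ne_zero_iff, e]; linarith
  let u1 : unitInterval × S → D := fun q => ⟨(q.2 : ℂ) / (1 + ((q.1 : ℝ) : ℂ)), by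
    simpa only [D, Metric.mem_closedBall, dist_zero_right] using (hA q).1⟩
  let u2 : unitInterval × S → D := fun q => ⟨-(((q.1 : ℝ) : ℂ) * q.2 / (1 + ((q.1 : ℝ) : ℂ))), by
    simpa only [D, Metric.mem_closedBall, dist_zero_right] using (hA q).2.1⟩
  have hu1 : Continuous u1 := by
    apply Continuous.subtype_mk
    exact Continuous.div (by fun_prop) (by fun_prop) (fun q => (hA q).2.2)
  have hu2 : Continuous u2 := by
    apply Continuous.subtype_mk
    exact (Continuous.div (by fun_prop) (by fun_prop) (fun q => (hA q).2.2)).neg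
  have L4 := HasLog8.homotopy (X := S) (fun q => k (u1 q) - k (u2 q)) (by fun_prop) ?_ ?_
  · refine not_hasLog8_odd _ ?_ L4
    intro z
    have e1 : u1 (1, -z) = u2 (1, z) := by
      apply Subtype.ext; simp [u1, u2]; ring
    have e2 : u2 (1, -z) = u1 (1, z) := by
      apply Subtype.ext; simp [u1, u2]; ring
    simp only [e1, e2]; ring
  · intro q hq
    have := hkinj _ _ (sub_eq_zero.1 hq)
    simp only [u1, u2] at this
    have h3 := (hA q).2.2
    have h4 : (q.2 : ℂ) * (1 + ((q.1 : ℝ) : ℂ)) = 0 := by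
      field_simp at this
      linear_combination this
    rcases mul_eq_zero.1 h4 with h5 | h5
    · have := hS q.2
      rw [h5] at this; simp at this
    · exact h3 h5
  · have e1 : ∀ z : S, u1 (0, z) = i z := fun z => by apply Subtype.ext; simp [u1, i]
    have e2 : ∀ z : S, u2 (0, z) = o := fun z => by apply Subtype.ext; simp [u2, o]
    simpa [e1, e2] using L3


/-- The uniform closure of the polynomials on `K`. -/
noncomputable def PK8 (K : Set ℂ) [CompactSpace K] : Subalgebra ℂ C(K, ℂ) :=
  (polynomialFunctions K).topologicalClosure

lemma PK8_closed (K : Set ℂ) [CompactSpace K] : IsClosed (PK8 K : Set C(K, ℂ)) :=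
  Subalgebra.isClosed_topologicalClosure _

/-- The coordinate function. -/
def idK8 (K : Set ℂ) : C(K, ℂ) := ⟨fun z => z, continuous_subtype_val⟩

lemma idK8_mem (K : Set ℂ) [CompactSpace K] : idK8 K ∈ PK8 K := by
  apply Subalgebra.le_topologicalClosure
  refine ⟨X, trivial, ?_⟩
  ext z
  simp [idK8]

lemma PK8_inv (K : Set ℂ) [CompactSpace K] (hconn : IsPreconnected Kᶜ) {a : ℂ} (ha : a ∉ K) :
    ∃ v ∈ PK8 K, ∀ z : K, v z * (z - a) = 1 := by
  have : IsClosed (PK8 K : Set C(K, ℂ)) := PK8_closed K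
  have hsp : spectrum ℂ (idK8 K) = K := by
    rw [ContinuousMap.spectrum_eq_range]
    ext z; simp [idK8]
  let x : PK8 K := ⟨idK8 K, idK8_mem K⟩
  have := Subalgebra.spectrum_eq_of_isPreconnected_compl (𝕜 := ℂ) (PK8 K) x (by
    show IsPreconnected (spectrum ℂ (idK8 K))ᶜ
    rwa [hsp])
  have ha' : a ∉ spectrum ℂ x := by
    rw [this]
    show a ∉ spectrum ℂ (idK8 K)
    rwa [hsp]
  rw [spectrum.notMem_iff] at ha'
  obtain ⟨v, hv⟩ := ha'.exists_left_inv
  refine ⟨-v, neg_mem v.2, fun z => ?_⟩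
  have h1 := congrArg (fun f : PK8 K => (f : C(K, ℂ)) z) hv
  have h2 : (v : C(K, ℂ)) z * (a - z) = 1 := by
    simpa [x, idK8] using h1
  simp only [ContinuousMap.neg_apply]
  linear_combination h2

lemma sq_nhds8 (B : Type*) [NormedCommRing B] [NormedAlgebra ℂ B] [CompleteSpace B] :
    (fun x : B => x * x) '' (Metric.ball 1 1) ∈ nhds (1 : B) := by
  have hd := (hasStrictFDerivAt_id (𝕜 := ℂ) (1 : B)).mul (hasStrictFDerivAt_id (1 : B))
  have hmap := hd.map_nhds_eq_of_surj (by
    rw [LinearMap.range_eq_top]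
    intro y
    refine ⟨(1/2 : ℂ) • y, ?_⟩
    simp
    rw [← add_smul]; norm_num)
  have := Filter.image_mem_map (m := fun x : B => x * x) (Metric.ball_mem_nhds (1 : B) one_pos)
  have e : nhds (1 : B) = Filter.map (fun x : B => x * x) (nhds 1) := by
    rw [show (fun x : B => x * x) = id * id from rfl, hmap]
    simp
  rw [e]
  exact this

lemma PK8_sqrt (K : Set ℂ) [CompactSpace K] :
    ∃ η > 0, ∀ u ∈ PK8 K, ‖u‖ < η → ∃ h ∈ PK8 K, ∀ z : K, h z ^ 2 = 1 + u z ∧ 0 < (h z).re := by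
  have : IsClosed (PK8 K : Set C(K, ℂ)) := PK8_closed K
  have : CompleteSpace (PK8 K) := IsClosed.completeSpace_coe (hs := PK8_closed K)
  have hmem := sq_nhds8 (PK8 K)
  obtain ⟨η, hη, hsub⟩ := Metric.mem_nhds_iff.1 hmem
  refine ⟨η, hη, fun u hu hun => ?_⟩
  have : (1 + ⟨u, hu⟩ : PK8 K) ∈ Metric.ball (1 : PK8 K) η := by
    rw [mem_ball_iff_norm, add_sub_cancel_left]
    exact hun
  obtain ⟨h, hh1, hh2⟩ := hsub this
  refine ⟨h, h.2, fun z => ⟨?_, ?_⟩⟩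
  · have h1 := congrArg (fun f : PK8 K => (f : C(K, ℂ)) z) hh2
    simpa [sq] using h1
  · rw [mem_ball_iff_norm] at hh1
    have h2 : ‖((h - 1 : PK8 K) : C(K, ℂ)) z‖ < 1 := lt_of_le_of_lt (ContinuousMap.norm_coe_le_norm _ z) hh1
    have h3 := (abs_le.1 (Complex.abs_re_le_norm (((h - 1 : PK8 K) : C(K, ℂ)) z))).1
    simp at h3 h2
    linarith

/-- Principal square root on the right half-plane. -/
noncomputable def sq8 (w : ℂ) : ℂ := Complex.exp (Complex.log w / 2)

lemma sq8_sq {w : ℂ} (hw : 0 < w.re) : sq8 w ^ 2 = w := by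
  have : w ≠ 0 := by rintro rfl; simp at hw
  rw [sq8, ← Complex.exp_nat_mul]
  push_cast
  rw [mul_div_cancel₀ _ two_ne_zero, Complex.exp_log this]

lemma sq8_ne (w : ℂ) : sq8 w ≠ 0 := Complex.exp_ne_zero _

lemma sq8_div_re {w v : ℂ} (hw : 0 < w.re) (hv : 0 < v.re) : 0 < (sq8 w / sq8 v).re := by
  rw [sq8, sq8, ← Complex.exp_sub, Complex.exp_re]
  have h1 := abs_lt.1 (Complex.abs_arg_lt_pi_div_two_iff.2 (Or.inl hw))
  have h2 := abs_lt.1 (Complex.abs_arg_lt_pi_div_two_iff.2 (Or.inl hv))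
  apply mul_pos (Real.exp_pos _)
  apply Real.cos_pos_of_mem_Ioo
  have e : (Complex.log w / 2 - Complex.log v / 2).im = w.arg / 2 - v.arg / 2 := by
    simp [Complex.log_im]
  rw [e]
  constructor <;> linarith [h1.1, h1.2, h2.1, h2.2]

lemma sq_eq_of_re8 {h k : ℂ} (e : h ^ 2 = k ^ 2) (hh : 0 < h.re) (hk : 0 < k.re) : h = k := by
  rcases sq_eq_sq_iff_eq_or_eq_neg.1 e with h1 | h1
  · exact h1
  · rw [h1] at hh; simp at hh; linarith

lemma re_ratio8 {a c z : ℂ} {r : ℝ} (ha : ‖a - c‖ < r) (hz : r ≤ ‖z - c‖) :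
    0 < ((z - a) / (z - c)).re := by
  have hz0 : z - c ≠ 0 := by
    rw [← norm_pos_iff]; exact lt_of_le_of_lt (norm_nonneg _) (lt_of_lt_of_le ha hz)
  have e : (z - a) / (z - c) = 1 - (a - c) / (z - c) := by field_simp; ring
  have h1 : ‖(a - c) / (z - c)‖ < 1 := by
    rw [norm_div, div_lt_one (norm_pos_iff.2 hz0)]; linarith
  have := Complex.re_le_norm ((a - c) / (z - c))
  rw [e, Complex.sub_re, Complex.one_re]; linarith

lemma PK8_path (K : Set ℂ) [CompactSpace K] (hconn : IsPreconnected Kᶜ) (c : ℂ) (r : ℝ)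
    (T : Set ℂ) (hT : IsPreconnected T) (hTK : T ⊆ Kᶜ) (hTr : ∀ x ∈ T, ‖x - c‖ < r)
    {a b : ℂ} (ha : a ∈ T) (hb : b ∈ T) :
    ∃ h ∈ PK8 K, ∀ z : K, h z ^ 2 * (z - a) = (z - b) ∧
      (r ≤ ‖(z : ℂ) - c‖ → h z = sq8 ((z - b) / (z - c)) / sq8 ((z - a) / (z - c))) := by
  have hne : ∀ x ∈ T, ∀ z : K, (z : ℂ) - x ≠ 0 := by
    intro x hx z hz
    exact hTK hx (by rw [← sub_eq_zero.1 hz]; exact z.2)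
  refine hT.induction₂' (fun a b => ∃ h ∈ PK8 K, ∀ z : K, h z ^ 2 * (z - a) = (z - b) ∧
      (r ≤ ‖(z : ℂ) - c‖ → h z = sq8 ((z - b) / (z - c)) / sq8 ((z - a) / (z - c)))) ?_ ?_ ha hb
  · intro x hx
    obtain ⟨η, hη, hs⟩ := PK8_sqrt K
    obtain ⟨v, hv, hvz⟩ := PK8_inv K hconn (hTK hx)
    have hnear : ∀ᶠ y in nhdsWithin x T, ‖(x - y) • v‖ < η := by
      apply eventually_nhdsWithin_of_eventually_nhds
      have : Filter.Tendsto (fun y => ‖(x - y) • v‖) (nhds x) (nhds ‖(x - x) • v‖) :=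
        Continuous.tendsto (by fun_prop) x
      simp only [sub_self, zero_smul, norm_zero] at this
      exact this.eventually (gt_mem_nhds hη)
    filter_upwards [hnear, self_mem_nhdsWithin] with y hy hyT
    obtain ⟨h, hh, hhz⟩ := hs _ ((PK8 K).smul_mem hv (x - y)) hy
    have e1 : ∀ z : K, h z ^ 2 * (z - x) = z - y := by
      intro z
      rw [(hhz z).1]
      simp only [ContinuousMap.smul_apply, smul_eq_mul]
      linear_combination (x - y) * hvz z
    have e2 : ∀ z : K, (r ≤ ‖(z : ℂ) - c‖ →
        h z = sq8 ((z - y) / (z - c)) / sq8 ((z - x) / (z - c))) := by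
      intro z hz
      have hry := re_ratio8 (hTr y hyT) hz
      have hrx := re_ratio8 (hTr x hx) hz
      apply sq_eq_of_re8 _ (hhz z).2 (sq8_div_re hry hrx)
      have hzc : (z : ℂ) - c ≠ 0 := by
        rintro h0; rw [h0] at hrx; simp at hrx
      have hzx := hne x hx z
      rw [div_pow, sq8_sq hry, sq8_sq hrx, ← e1 z]
      field_simp
    refine ⟨⟨h, hh, fun z => ⟨e1 z, e2 z⟩⟩, ?_⟩
    obtain ⟨v', hv', hvz'⟩ := PK8_inv K hconn (hTK hyT)
    have hy0 := hne y hyT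
    have hx0 := hne x hx
    have hhne : ∀ z : K, h z ≠ 0 := by
      intro z h0
      have := e1 z
      rw [h0] at this
      exact hy0 z (by rw [← this]; ring)
    have einv : ∀ z : K, (h * (idK8 K - algebraMap ℂ C(K, ℂ) x) * v') z = (h z)⁻¹ := by
      intro z
      have h3 : v' z = ((z : ℂ) - y)⁻¹ := eq_inv_of_mul_eq_one_left (hvz' z)
      have h4 := hhne z
      simp only [ContinuousMap.mul_apply, ContinuousMap.sub_apply, h3, ← e1 z]
      have h5 : (idK8 K) z = z := rfl
      have h6 : (algebraMap ℂ C(K, ℂ) x) z = x := by simp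
      have h7 := hx0 z
      rw [h5, h6]
      field_simp
    refine ⟨h * (idK8 K - algebraMap ℂ C(K, ℂ) x) * v', ?_, fun z => ?_⟩
    · exact mul_mem (mul_mem hh (sub_mem (idK8_mem K) (algebraMap_mem _ _))) hv'
    · rw [einv]
      constructor
      · rw [← e1 z]; have := hhne z; field_simp
      · intro hz
        rw [e2 z hz, inv_div]
  · rintro x y w hx hy hw ⟨h, hh, hhz⟩ ⟨k, hk, hkz⟩
    refine ⟨h * k, mul_mem hh hk, fun z => ⟨?_, fun hz => ?_⟩⟩
    · rw [ContinuousMap.mul_apply, ← (hkz z).1, ← (hhz z).1]; ring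
    · rw [ContinuousMap.mul_apply, (hhz z).2 hz, (hkz z).2 hz]
      have := sq8_ne ((z - y) / (z - c))
      have := sq8_ne ((z - x) / (z - c))
      field_simp


lemma exists_path8 (K : Set ℂ) (hK : IsCompact K) (hconn : IsPreconnected Kᶜ)
    (hint : interior K = ∅) (c : ℂ) {r : ℝ} (hr : 0 < r) :
    ∃ T : Set ℂ, IsPreconnected T ∧ T ⊆ Kᶜ ∧ (∀ x ∈ T, ‖x - c‖ < r) ∧
      ∃ a ∈ T, ∃ b ∈ T, ‖a - b‖ = r / 2 := by
  have h1 : ¬ (Metric.ball c (r / 4) ⊆ K) := by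
    intro hsub
    have : c ∈ interior K :=
      mem_interior.2 ⟨_, hsub, Metric.isOpen_ball, Metric.mem_ball_self (by positivity)⟩
    rw [hint] at this; exact this
  obtain ⟨a, hac, haK⟩ := Set.not_subset.1 h1
  rw [mem_ball_iff_norm] at hac
  have hpc : IsPathConnected Kᶜ :=
    hK.isClosed.isOpen_compl.isConnected_iff_isPathConnected.1 ⟨⟨a, haK⟩, hconn⟩
  obtain ⟨R, hR⟩ := hK.isBounded.subset_ball a
  let M : ℝ := max R r
  have hM : 0 < M := lt_of_lt_of_le hr (le_max_right _ _)
  have hnM : ‖(M : ℂ)‖ = M := by rw [Complex.norm_real, Real.norm_of_nonneg hM.le]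
  have hy : a + (M : ℂ) ∈ Kᶜ := by
    intro h
    have := hR h
    rw [mem_ball_iff_norm, add_sub_cancel_left, hnM] at this
    exact absurd this (not_lt.2 (le_max_left _ _))
  obtain ⟨γ, hγ⟩ := hpc.joinedIn a haK _ hy
  let f : ℝ → ℝ := fun t => ‖γ.extend t - a‖
  have hγc : Continuous γ.extend := γ.continuous_extend
  have hf : Continuous f := by fun_prop
  have hγK : ∀ t, γ.extend t ∈ Kᶜ := by
    intro t
    have : γ.extend t ∈ Set.range γ := by
      rw [← γ.extend_range]; exact Set.mem_range_self t
    obtain ⟨u, hu⟩ := this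
    rw [← hu]
    exact hγ _
  have hf0 : f 0 = 0 := by simp [f]
  have hf1 : r / 2 ≤ f 1 := by
    simp only [f, Path.extend_one, add_sub_cancel_left, hnM]
    have : r ≤ M := le_max_right _ _
    linarith
  have hZ : IsCompact (Set.Icc (0 : ℝ) 1 ∩ {t | r / 2 ≤ f t}) :=
    isCompact_Icc.inter_right (isClosed_le continuous_const hf)
  obtain ⟨s, ⟨⟨hs0, hs1⟩, hs2⟩, hleast⟩ := hZ.exists_isLeast ⟨1, by simp, hf1⟩
  have hlt : ∀ t ∈ Set.Icc 0 s, f t ≤ r / 2 ∧ (t < s → f t < r / 2) := by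
    have aux : ∀ t, 0 ≤ t → t < s → f t < r / 2 := by
      intro t ht0 hts
      by_contra hcon
      exact absurd (hleast ⟨⟨ht0, by linarith⟩, not_lt.1 hcon⟩) (not_le.2 hts)
    obtain ⟨t, ht, hft⟩ := intermediate_value_Icc hs0 hf.continuousOn
      (show r / 2 ∈ Set.Icc (f 0) (f s) from ⟨by rw [hf0]; positivity, hs2⟩)
    have hts : t = s := by
      by_contra hne
      have := aux t ht.1 (lt_of_le_of_ne ht.2 hne)
      linarith
    subst hts
    intro u hu
    refine ⟨?_, aux u hu.1⟩
    rcases hu.2.lt_or_eq with h | h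
    · exact (aux u hu.1 h).le
    · rw [h, hft]
  refine ⟨γ.extend '' Set.Icc 0 s, isPreconnected_Icc.image _ hγc.continuousOn, ?_, ?_,
    a, ⟨0, by simp [hs0], by simp⟩, γ.extend s, ⟨s, by simp [hs0], rfl⟩, ?_⟩
  · rintro _ ⟨t, -, rfl⟩; exact hγK t
  · rintro _ ⟨t, ht, rfl⟩
    have h2 : ‖γ.extend t - a‖ ≤ r / 2 := (hlt t ht).1
    have h3 := norm_add_le (γ.extend t - a) (a - c)
    rw [sub_add_sub_cancel] at h3
    linarith
  · rw [norm_sub_rev]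
    exact le_antisymm (hlt s ⟨hs0, le_rfl⟩).1 hs2

/-- The basic estimate: an approximation to the Cauchy kernel by uniform limits of polynomials. -/
lemma kernel8 (K : Set ℂ) [CompactSpace K] (hconn : IsPreconnected Kᶜ)
    (hint : interior K = ∅) (c : ℂ) {r : ℝ} (hr : 0 < r) :
    ∃ q ∈ PK8 K, ∃ m : ℂ, ‖m - c‖ ≤ r ∧
      (∀ z : K, ‖(z : ℂ) - c‖ ≤ 5 * r → ‖q z‖ ≤ 384 / r) ∧
      (∀ z : K, 3 * r ≤ ‖(z : ℂ) - c‖ → ‖q z - ((z : ℂ) - m)⁻¹‖ ≤ r ^ 2 / (16 * ‖(z : ℂ) - m‖ ^ 3)) := by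
  obtain ⟨T, hT, hTK, hTr, a, ha, b, hb, hab⟩ :=
    exists_path8 K (isCompact_iff_compactSpace.2 inferInstance) hconn hint c hr
  obtain ⟨h, hh, hhz⟩ := PK8_path K hconn c r T hT hTK hTr ha hb
  have hac := hTr a ha
  have hbc := hTr b hb
  let m : ℂ := (a + b) / 2
  let d : ℂ := (a - b) / 2
  have hd : ‖d‖ = r / 4 := by simp only [d, norm_div, hab]; norm_num; ring
  have hd0 : d ≠ 0 := by rw [← norm_pos_iff, hd]; positivity
  have hmc : ‖m - c‖ ≤ r := by
    have e : m - c = ((a - c) + (b - c)) / 2 := by simp only [m]; ring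
    rw [e, norm_div]
    have := norm_add_le (a - c) (b - c)
    simp only [Complex.norm_ofNat]
    linarith
  let t : C(K, ℂ) := (idK8 K - algebraMap ℂ C(K, ℂ) a) * h
  let g : C(K, ℂ) := idK8 K - algebraMap ℂ C(K, ℂ) m - t
  have htz : ∀ z : K, t z = (z - a) * h z := by
    intro z
    simp [t, idK8]
  have hgz : ∀ z : K, g z = (z - m) - t z := by
    intro z
    simp [g, idK8]
  have ht2 : ∀ z : K, t z ^ 2 = (z - a) * (z - b) := by
    intro z
    rw [htz, ← (hhz z).1]; ring
  have hsq : ∀ z : K, g z * (2 * (z - m) - g z) = d ^ 2 := by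
    intro z
    have := ht2 z
    rw [hgz]
    simp only [m, d]
    linear_combination -this
  have hgmem : g ∈ PK8 K :=
    sub_mem (sub_mem (idK8_mem K) (algebraMap_mem _ _))
      (mul_mem (sub_mem (idK8_mem K) (algebraMap_mem _ _)) hh)
  refine ⟨(2 / d ^ 2) • g, (PK8 K).smul_mem hgmem _, m, hmc, ?_, ?_⟩
  · intro z hz
    have h1 : ‖(z : ℂ) - m‖ ≤ 6 * r := by
      have := norm_sub_le ((z : ℂ) - c) (m - c)
      rw [sub_sub_sub_cancel_right] at this; linarith
    have h2 : ‖(z : ℂ) - a‖ ≤ 6 * r := by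
      have := norm_sub_le ((z : ℂ) - c) (a - c)
      rw [sub_sub_sub_cancel_right] at this; linarith
    have h3 : ‖(z : ℂ) - b‖ ≤ 6 * r := by
      have := norm_sub_le ((z : ℂ) - c) (b - c)
      rw [sub_sub_sub_cancel_right] at this; linarith
    have h4 : ‖t z‖ ≤ 6 * r := by
      have h5 : ‖t z‖ ^ 2 ≤ (6 * r) ^ 2 := by
        rw [← norm_pow, ht2, norm_mul, sq]
        exact mul_le_mul h2 h3 (norm_nonneg _) (by positivity)
      exact le_of_sq_le_sq h5 (by positivity)
    have h5 : ‖g z‖ ≤ 12 * r := by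
      rw [hgz]
      linarith [norm_sub_le ((z : ℂ) - m) (t z)]
    rw [ContinuousMap.smul_apply, smul_eq_mul, norm_mul, norm_div, norm_pow, hd]
    simp only [Complex.norm_ofNat]
    calc 2 / (r / 4) ^ 2 * ‖g z‖ ≤ 2 / (r / 4) ^ 2 * (12 * r) := by gcongr
      _ = 384 / r := by field_simp; norm_num
  · intro z hz
    have hz' : r ≤ ‖(z : ℂ) - c‖ := by linarith
    have hzm : 2 * r ≤ ‖(z : ℂ) - m‖ := by
      have := norm_sub_norm_le ((z : ℂ) - c) (m - c)
      rw [sub_sub_sub_cancel_right] at this; linarith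
    have hzm0 : (z : ℂ) - m ≠ 0 := by rw [← norm_pos_iff]; linarith
    have hzc0 : (z : ℂ) - c ≠ 0 := by rw [← norm_pos_iff]; linarith
    have hra := re_ratio8 hac hz'
    have hrb := re_ratio8 hbc hz'
    set A := sq8 ((z - a) / (z - c)) with hA
    set B := sq8 ((z - b) / (z - c)) with hB
    have hA0 : A ≠ 0 := sq8_ne _
    have hB0 : B ≠ 0 := sq8_ne _
    have hA2 : A ^ 2 * (z - c) = z - a := by rw [hA, sq8_sq hra]; field_simp
    have hB2 : B ^ 2 * (z - c) = z - b := by rw [hB, sq8_sq hrb]; field_simp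
    have htAB : t z = A * B * (z - c) := by
      rw [htz, (hhz z).2 hz', ← hA, ← hB]
      have : (z : ℂ) - a = A ^ 2 * (z - c) := hA2.symm
      rw [this]
      field_simp
    have hzmAB : (z : ℂ) - m = (A ^ 2 + B ^ 2) / 2 * (z - c) := by
      have : (z : ℂ) - m = ((z - a) + (z - b)) / 2 := by simp only [m]; ring
      rw [this, ← hA2, ← hB2]; ring
    have hre : 0 ≤ (t z / (z - m)).re := by
      have hs0 : A ^ 2 + B ^ 2 ≠ 0 := by
        intro h0; rw [hzmAB, h0] at hzm0; simp at hzm0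
      have e : t z / (z - m) = 2 * (A / B + B / A)⁻¹ := by
        rw [htAB, hzmAB]
        have : A / B + B / A = (A ^ 2 + B ^ 2) / (A * B) := by field_simp
        rw [this]; field_simp
      have h1 := sq8_div_re hra hrb
      have h2 := sq8_div_re hrb hra
      have h3 : 0 ≤ ((A / B + B / A)⁻¹).re := by
        rw [Complex.inv_re]
        apply div_nonneg _ (Complex.normSq_nonneg _)
        rw [Complex.add_re]; linarith
      rw [e]
      simpa using h3
    have hlow : ‖(z : ℂ) - m‖ ≤ ‖2 * (z - m) - g z‖ := by
      have e : 2 * (z - m) - g z = (z - m) * (1 + t z / (z - m)) := by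
        rw [hgz]; field_simp; ring
      rw [e, norm_mul]
      have h1 : 1 ≤ ‖1 + t z / (z - m)‖ := by
        have := Complex.re_le_norm (1 + t z / (z - m))
        rw [Complex.add_re, Complex.one_re] at this
        linarith
      nlinarith [norm_nonneg ((z : ℂ) - m)]
    have hpos : 0 < ‖(z : ℂ) - m‖ := norm_pos_iff.2 hzm0
    have hg : ‖g z‖ ≤ ‖d‖ ^ 2 / ‖(z : ℂ) - m‖ := by
      rw [le_div_iff₀ hpos, ← norm_pow, ← hsq z, norm_mul]
      gcongr
    have e : ((2 / d ^ 2) • g) z - ((z : ℂ) - m)⁻¹ = g z ^ 2 / (d ^ 2 * (z - m)) := by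
      rw [ContinuousMap.smul_apply, smul_eq_mul]
      have := hsq z
      field_simp
      linear_combination this
    rw [e, norm_div, norm_mul, norm_pow, norm_pow]
    have hdp : 0 < ‖d‖ := norm_pos_iff.2 hd0
    calc ‖g z‖ ^ 2 / (‖d‖ ^ 2 * ‖(z : ℂ) - m‖)
        ≤ (‖d‖ ^ 2 / ‖(z : ℂ) - m‖) ^ 2 / (‖d‖ ^ 2 * ‖(z : ℂ) - m‖) := by gcongr
      _ = r ^ 2 / (16 * ‖(z : ℂ) - m‖ ^ 3) := by
        rw [← mul_div_mul_left _ _ (show (16:ℝ) ≠ 0 by norm_num)]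
        have : r = 4 * ‖d‖ := by linarith
        rw [this]; field_simp; norm_num

lemma kernel8' (K : Set ℂ) [CompactSpace K] (hconn : IsPreconnected Kᶜ)
    (hint : interior K = ∅) (c : ℂ) {r : ℝ} (hr : 0 < r) :
    ∃ q ∈ PK8 K, ‖q‖ ≤ 400 / r ∧ ∀ ζ : ℂ, ‖ζ - c‖ ≤ r → ∀ z : K, (z : ℂ) ≠ ζ →
      ‖((z : ℂ) - ζ)⁻¹ - q z‖ ≤ 3200 * √r * (‖(z : ℂ) - ζ‖ * √‖(z : ℂ) - ζ‖)⁻¹ := by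
  obtain ⟨q, hq, m, hmc, h1, h2⟩ := kernel8 K hconn hint c hr
  have hfar : ∀ ζ : ℂ, ‖ζ - c‖ ≤ r → ∀ z : K, 4 * r ≤ ‖(z : ℂ) - ζ‖ →
      ‖((z : ℂ) - ζ)⁻¹ - q z‖ ≤ 5 * r / ‖(z : ℂ) - ζ‖ ^ 2 := by
    intro ζ hζ z hz
    set s := ‖(z : ℂ) - ζ‖ with hs
    have hs0 : 0 < s := by linarith
    have hmz : ‖m - ζ‖ ≤ 2 * r := by
      have := norm_sub_le (m - c) (ζ - c)
      rw [sub_sub_sub_cancel_right] at this; linarith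
    have hzm : s / 2 ≤ ‖(z : ℂ) - m‖ := by
      have := norm_sub_norm_le ((z : ℂ) - ζ) (m - ζ)
      rw [sub_sub_sub_cancel_right] at this; linarith
    have hzc : 3 * r ≤ ‖(z : ℂ) - c‖ := by
      have := norm_sub_norm_le ((z : ℂ) - ζ) (c - ζ)
      rw [sub_sub_sub_cancel_right, norm_sub_rev c ζ] at this; linarith
    have hz0 : (z : ℂ) - ζ ≠ 0 := norm_pos_iff.1 hs0
    have hm0 : (z : ℂ) - m ≠ 0 := norm_pos_iff.1 (by linarith)
    have e : ((z : ℂ) - ζ)⁻¹ - q z = (ζ - m) / ((z - ζ) * (z - m)) - (q z - ((z : ℂ) - m)⁻¹) := by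
      field_simp; ring
    have hA : ‖(ζ - m) / (((z : ℂ) - ζ) * (z - m))‖ ≤ 2 * r / (s * (s / 2)) := by
      rw [norm_div, norm_mul, norm_sub_rev ζ m]
      gcongr
    have hB : ‖q z - ((z : ℂ) - m)⁻¹‖ ≤ r ^ 2 / (16 * (s / 2) ^ 3) :=
      (h2 z hzc).trans (by gcongr)
    have hB' : r ^ 2 / (16 * (s / 2) ^ 3) ≤ r / s ^ 2 := by
      rw [div_le_div_iff₀ (by positivity) (by positivity)]
      have : r * s ^ 2 * r * 4 ≤ r * s ^ 2 * s := by
        nlinarith [mul_pos hr (pow_pos hs0 2)]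
      nlinarith [mul_pos hr (pow_pos hs0 2), mul_pos hr hr, mul_pos (mul_pos hr (pow_pos hs0 2)) hr]
    have hA' : 2 * r / (s * (s / 2)) = 4 * r / s ^ 2 := by field_simp; norm_num
    rw [e]
    calc _ ≤ 2 * r / (s * (s / 2)) + r / s ^ 2 :=
          (norm_sub_le _ _).trans (add_le_add hA (hB.trans hB'))
      _ = 5 * r / s ^ 2 := by rw [hA']; ring
  refine ⟨q, hq, ?_, ?_⟩
  · rw [ContinuousMap.norm_le _ (by positivity)]
    intro z
    rcases le_total ‖(z : ℂ) - c‖ (5 * r) with h | h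
    · exact (h1 z h).trans (by gcongr; norm_num)
    · have h3 := hfar c (by simpa using hr.le) z (by linarith)
      have hs0 : 0 < ‖(z : ℂ) - c‖ := by linarith
      have h4 : ‖q z‖ ≤ ‖((z : ℂ) - c)⁻¹‖ + ‖((z : ℂ) - c)⁻¹ - q z‖ := by
        have := norm_sub_le ((z : ℂ) - c)⁻¹ (((z : ℂ) - c)⁻¹ - q z)
        simpa using this
      have h5 : ‖((z : ℂ) - c)⁻¹‖ ≤ (5 * r)⁻¹ := by
        rw [norm_inv]; gcongr
      have h6 : 5 * r / ‖(z : ℂ) - c‖ ^ 2 ≤ 5 * r / (5 * r) ^ 2 := by gcongr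
      have h7 : (5 * r)⁻¹ + 5 * r / (5 * r) ^ 2 ≤ 400 / r := by
        have : (5 * r)⁻¹ + 5 * r / (5 * r) ^ 2 = (2 / 5) / r := by field_simp; norm_num
        rw [this]; gcongr; norm_num
      linarith
  · intro ζ hζ z hz
    set s := ‖(z : ℂ) - ζ‖ with hs
    have hs0 : 0 < s := norm_pos_iff.2 (sub_ne_zero.2 hz)
    have hsr : 0 < √s := Real.sqrt_pos.2 hs0
    have hrr : 0 < √r := Real.sqrt_pos.2 hr
    have es : √s * √s = s := Real.mul_self_sqrt hs0.le
    have er : √r * √r = r := Real.mul_self_sqrt hr.le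
    rcases le_total (4 * r) s with h | h
    · refine (hfar ζ hζ z h).trans ?_
      rw [← hs, ← div_eq_mul_inv, div_le_div_iff₀ (by positivity) (by positivity)]
      have h3 : √r ≤ √s := Real.sqrt_le_sqrt (by linarith)
      have h4 : r * √s ≤ √r * s := by
        calc r * √s = √r * (√r * √s) := by rw [← mul_assoc, er]
          _ ≤ √r * (√s * √s) := by gcongr
          _ = √r * s := by rw [es]
      have h9 := mul_le_mul_of_nonneg_left h4 hs0.le
      nlinarith [mul_pos hrr (pow_pos hs0 2)]
    · have hzc : ‖(z : ℂ) - c‖ ≤ 5 * r := by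
        have := norm_add_le ((z : ℂ) - ζ) (ζ - c)
        rw [sub_add_sub_cancel] at this; linarith
      have h3 := h1 z hzc
      have h4 : ‖((z : ℂ) - ζ)⁻¹ - q z‖ ≤ s⁻¹ + 384 / r := by
        refine (norm_sub_le _ _).trans (add_le_add ?_ h3)
        rw [norm_inv]
      refine h4.trans ?_
      have h5 : √s ≤ 2 * √r := by
        rw [Real.sqrt_le_left (by positivity)]
        nlinarith
      have h6 : s⁻¹ + 384 / r ≤ 1600 * s⁻¹ := by
        have : r⁻¹ ≤ 4 * s⁻¹ := by
          rw [← div_eq_mul_inv, inv_le_comm₀ hr (by positivity), inv_div]; linarith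
        have h7 : 0 < s⁻¹ := by positivity
        rw [div_eq_mul_inv]; linarith
      refine h6.trans ?_
      rw [mul_inv]
      have h8 : 1 ≤ 2 * √r * (√s)⁻¹ := by
        rw [← div_eq_mul_inv, one_le_div hsr]; exact h5
      have h7 : 0 < s⁻¹ := by positivity
      nlinarith

open MeasureTheory in
theorem integrableOn_ker8 (ρ : ℝ) :
    IntegrableOn (fun ζ : ℂ => (‖ζ‖ * √‖ζ‖)⁻¹) (Metric.ball 0 ρ) := by
  have h := integrableOn_fun_norm_addHaar (E := ℂ) (F := ℝ) (volume : Measure ℂ)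
    (f := fun y => (y * √y)⁻¹) (r := ρ)
  rw [h]
  have h1 : IntegrableOn (fun y : ℝ => y ^ (-(1/2) : ℝ)) (Set.Ioo 0 ρ) := by
    rcases le_or_gt ρ 0 with h0 | h0
    · rw [Set.Ioo_eq_empty (by simpa using h0)]; exact integrableOn_empty
    rw [← intervalIntegrable_iff_integrableOn_Ioo_of_le h0.le]
    exact intervalIntegral.intervalIntegrable_rpow' (by norm_num)
  refine h1.congr_fun ?_ measurableSet_Ioo
  intro y hy
  have hy0 := hy.1
  have hs : 0 < √y := Real.sqrt_pos.2 hy0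
  simp only [Complex.finrank_real_complex, smul_eq_mul]
  rw [Real.rpow_neg hy0.le, ← Real.sqrt_eq_rpow]
  norm_num
  field_simp

open MeasureTheory in
theorem integrableOn_ker8_shift (R : ℝ) (z : ℂ) (hz : ‖z‖ < R) :
    IntegrableOn (fun ζ : ℂ => (‖z - ζ‖ * √‖z - ζ‖)⁻¹) (Metric.ball 0 R) ∧
    ∫ ζ in Metric.ball (0:ℂ) R, (‖z - ζ‖ * √‖z - ζ‖)⁻¹ ≤
      ∫ ζ in Metric.ball (0:ℂ) (2 * R), (‖ζ‖ * √‖ζ‖)⁻¹ := by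
  have hsub : Metric.ball (0:ℂ) R ⊆ (fun ζ => z - ζ) ⁻¹' Metric.ball (0:ℂ) (2 * R) := by
    intro ζ hζ
    simp only [Set.mem_preimage, Metric.mem_ball, dist_zero_right] at *
    have := norm_sub_le z ζ
    linarith
  have hmp : MeasurePreserving (fun ζ : ℂ => z - ζ) volume volume :=
    volume.measurePreserving_sub_left z
  have hemb : MeasurableEmbedding (fun ζ : ℂ => z - ζ) :=
    (Homeomorph.subLeft z).measurableEmbedding
  have h1 : IntegrableOn (fun ζ : ℂ => (‖z - ζ‖ * √‖z - ζ‖)⁻¹)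
      ((fun ζ => z - ζ) ⁻¹' Metric.ball (0:ℂ) (2 * R)) :=
    (hmp.integrableOn_comp_preimage hemb).2 (integrableOn_ker8 (2 * R))
  refine ⟨h1.mono_set hsub, ?_⟩
  rw [← hmp.setIntegral_preimage_emb hemb (fun ζ => (‖ζ‖ * √‖ζ‖)⁻¹)]
  refine setIntegral_mono_set h1 ?_ hsub.eventuallyLE
  exact Filter.Eventually.of_forall fun ζ => by positivity

open MeasureTheory in
theorem integrableOn_cauchy8 (R : ℝ) (z : ℂ) (hz : ‖z‖ < R) :
    IntegrableOn (fun ζ : ℂ => (z - ζ)⁻¹) (Metric.ball 0 R) := by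
  have h := (integrableOn_ker8_shift R z hz).1.const_mul (√(2 * R))
  refine Integrable.mono' h (by
    have : Measurable (fun ζ : ℂ => (z - ζ)⁻¹) := by fun_prop
    exact this.aestronglyMeasurable) ?_
  refine (ae_restrict_iff' measurableSet_ball).2 (Filter.Eventually.of_forall ?_)
  intro ζ hζ
  simp only [Metric.mem_ball, dist_zero_right] at hζ
  have h2 : ‖z - ζ‖ ≤ 2 * R := by
    have := norm_sub_le z ζ
    linarith
  rcases eq_or_ne (z - ζ) 0 with h0 | h0
  · simp [h0]
  have hp : 0 < ‖z - ζ‖ := norm_pos_iff.2 h0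
  have hs : 0 < √‖z - ζ‖ := Real.sqrt_pos.2 hp
  have hs2 : √‖z - ζ‖ ≤ √(2 * R) := Real.sqrt_le_sqrt h2
  rw [norm_inv, mul_inv]
  calc ‖z - ζ‖⁻¹ = √‖z - ζ‖ * (‖z - ζ‖⁻¹ * (√‖z - ζ‖)⁻¹) := by field_simp
    _ ≤ _ := by gcongr

theorem circ_avg8 (f : ℂ → ℂ) (ρ : ℝ) :
    ∫ θ in Set.Ioo (-Real.pi) Real.pi, f (circleMap 0 ρ θ) =
      2 * Real.pi * Real.circleAverage f 0 ρ := by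
  have hper : Function.Periodic (fun θ => f (circleMap 0 ρ θ)) (2 * Real.pi) := by
    intro θ
    simp only [periodic_circleMap 0 ρ θ]
  have h1 := hper.intervalIntegral_add_eq (-Real.pi) 0
  rw [← MeasureTheory.integral_Ioc_eq_integral_Ioo,
    ← intervalIntegral.integral_of_le (by linarith [Real.pi_pos]), Real.circleAverage_def]
  have e1 : -Real.pi + 2 * Real.pi = Real.pi := by ring
  rw [e1, zero_add] at h1
  rw [h1, Complex.real_smul]
  have : (Real.pi : ℂ) ≠ 0 := by exact_mod_cast Real.pi_ne_zero
  push_cast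
  field_simp

theorem circ_in8 (z : ℂ) (ρ : ℝ) (h0 : 0 < ρ) (h : ρ < ‖z‖) :
    ∫ θ in Set.Ioo (-Real.pi) Real.pi, (z - circleMap 0 ρ θ)⁻¹ = 2 * Real.pi / z := by
  rw [circ_avg8 (fun w => (z - w)⁻¹)]
  have hd : ∀ w ∈ Metric.closedBall (0:ℂ) |ρ|, DifferentiableAt ℂ (fun w => (z - w)⁻¹) w := by
    intro w hw
    have hw' : ‖w‖ ≤ ρ := by simpa [abs_of_pos h0] using hw
    have : z - w ≠ 0 := by
      intro hh
      rw [sub_eq_zero.1 hh] at h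
      linarith
    exact (by fun_prop : DifferentiableAt ℂ (fun w => z - w) w).inv this
  rw [circleAverage_of_differentiable_on_off_countable Set.countable_empty
    (fun w hw => (hd w hw).continuousAt.continuousWithinAt)
    (fun w hw => hd w (Metric.ball_subset_closedBall hw.1))]
  simp [div_eq_mul_inv]

theorem circ_out8 (z : ℂ) (ρ : ℝ) (hz : z ≠ 0) (h : ‖z‖ < ρ) :
    ∫ θ in Set.Ioo (-Real.pi) Real.pi, (z - circleMap 0 ρ θ)⁻¹ = 0 := by
  have hρ : 0 < ρ := (norm_nonneg z).trans_lt h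
  rw [circ_avg8 (fun w => (z - w)⁻¹)]
  have h1 : Real.circleAverage (fun w : ℂ => ((w - 0) / (w - z)) • (1:ℂ)) 0 ρ = 1 :=
    DiffContOnCl.circleAverage_smul_div (f := fun _ => (1:ℂ)) diffContOnCl_const
      (by simpa [abs_of_pos hρ] using h)
  have hne : ∀ w ∈ Metric.sphere (0:ℂ) |ρ|, w - z ≠ 0 := by
    intro w hw hh
    have : ‖w‖ = ρ := by simpa [abs_of_pos hρ] using hw
    rw [sub_eq_zero.1 hh] at this
    linarith
  have h2 : Real.circleAverage (fun w : ℂ => (z - w)⁻¹) 0 ρ =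
      Real.circleAverage (fun w : ℂ => 
        z⁻¹ • ((fun _ : ℂ => (1:ℂ)) - (fun w : ℂ => ((w - 0) / (w - z)) • (1:ℂ)) : ℂ → ℂ) w) 0 ρ := by
    apply Real.circleAverage_congr_sphere
    intro w hw
    have := hne w hw
    have h3 : z - w ≠ 0 := by rwa [← neg_sub, neg_ne_zero] at this
    simp only [Pi.sub_apply, smul_eq_mul, sub_zero, mul_one]
    field_simp
    ring
  rw [h2, Real.circleAverage_fun_smul, Real.circleAverage_sub, h1]
  · simp [Real.circleAverage_const]
  · exact continuousOn_const.circleIntegrable'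
  · apply ContinuousOn.circleIntegrable'
    intro w hw
    have := hne w hw
    apply ContinuousAt.continuousWithinAt
    fun_prop (disch := assumption)

open MeasureTheory in
theorem cauchy_integral8 (R : ℝ) (z : ℂ) (hz : ‖z‖ < R) :
    ∫ ζ in Metric.ball (0:ℂ) R, (z - ζ)⁻¹ = Real.pi * (starRingEnd ℂ) z := by
  have hR : 0 < R := (norm_nonneg z).trans_lt hz
  rcases eq_or_ne z 0 with rfl | hz0
  · have h := integral_neg_eq_self
      (fun ζ : ℂ => (Metric.ball (0:ℂ) R).indicator (fun ζ => (0 - ζ)⁻¹) ζ) volume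
    have h2 : ∀ ζ : ℂ, (Metric.ball (0:ℂ) R).indicator (fun ζ => (0 - ζ)⁻¹) (-ζ) =
        - (Metric.ball (0:ℂ) R).indicator (fun ζ => (0 - ζ)⁻¹) ζ := by
      intro ζ
      by_cases hζ : ‖ζ‖ < R <;> simp [Set.indicator, hζ]
    simp only [h2, integral_neg] at h
    rw [integral_indicator measurableSet_ball] at h
    have h3 := self_eq_neg.1 h.symm
    simpa using h3
  set g : ℂ → ℂ := (Metric.ball (0:ℂ) R).indicator (fun ζ => (z - ζ)⁻¹) with hg
  have hgm : Measurable g := Measurable.indicator (by fun_prop) measurableSet_ball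
  have hgi : Integrable g := (integrable_indicator_iff measurableSet_ball).2
    (integrableOn_cauchy8 R z hz)
  rw [← integral_indicator measurableSet_ball, ← hg, ← Complex.integral_comp_polarCoord_symm]
  have hpm : Measurable (fun p : ℝ × ℝ => Complex.polarCoord.symm p) := by
    simp only [Complex.polarCoord_symm_apply]
    fun_prop
  have hint : IntegrableOn (fun p : ℝ × ℝ => p.1 • g (Complex.polarCoord.symm p))
      (Set.Ioi (0 : ℝ) ×ˢ Set.Ioo (-Real.pi) Real.pi) (volume.prod volume) := by
    refine ⟨(measurable_fst.smul (hgm.comp hpm)).aestronglyMeasurable, ?_⟩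
    have h1 := Complex.lintegral_comp_polarCoord_symm (fun ζ => ‖g ζ‖ₑ)
    have h2 := hgi.2
    rw [hasFiniteIntegral_def, ← h1] at h2
    rw [hasFiniteIntegral_def]
    refine lt_of_eq_of_lt ?_ h2
    refine setLIntegral_congr_fun (measurableSet_Ioi.prod measurableSet_Ioo) ?_
    intro p hp
    have hp1 : 0 < p.1 := hp.1
    simp only [enorm_smul, smul_eq_mul]
    rw [Real.enorm_of_nonneg hp1.le]
  rw [polarCoord_target, Measure.volume_eq_prod, setIntegral_prod _ hint]
  have hmap : ∀ ρ θ : ℝ, Complex.polarCoord.symm (ρ, θ) = circleMap 0 ρ θ := by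
    intro ρ θ
    simp [circleMap, Complex.exp_mul_I]
  have hinner : ∀ ρ ∈ Set.Ioi (0:ℝ), ρ ≠ ‖z‖ →
      ∫ θ in Set.Ioo (-Real.pi) Real.pi, ρ • g (Complex.polarCoord.symm (ρ, θ)) =
      (Set.Ioo 0 ‖z‖).indicator (fun ρ : ℝ => (ρ : ℂ) * (2 * Real.pi / z)) ρ := by
    intro ρ hρ hne
    have hρ0 : 0 < ρ := hρ
    simp only [hmap]
    rw [integral_smul]
    have hn : ∀ θ, ‖circleMap 0 ρ θ‖ = ρ := by
      intro θ
      simp [abs_of_pos hρ0]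
    by_cases hρR : ρ < R
    · have hgc : ∀ θ, g (circleMap 0 ρ θ) = (z - circleMap 0 ρ θ)⁻¹ := by
        intro θ
        rw [hg, Set.indicator_of_mem]
        rw [Metric.mem_ball, dist_zero_right, hn]; exact hρR
      simp only [hgc]
      rcases lt_or_gt_of_ne hne with hl | hl
      · rw [circ_in8 z ρ hρ0 hl, Set.indicator_of_mem (show ρ ∈ Set.Ioo 0 ‖z‖ from ⟨hρ0, hl⟩),
          Complex.real_smul]
      · rw [circ_out8 z ρ hz0 hl, Set.indicator_of_notMem (fun hh => not_lt.2 hl.le hh.2),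
          smul_zero]
    · have hgc : ∀ θ, g (circleMap 0 ρ θ) = 0 := by
        intro θ
        rw [hg, Set.indicator_of_notMem]
        rw [Metric.mem_ball, dist_zero_right, hn]; exact hρR
      rw [Set.indicator_of_notMem (fun hh => hρR (hh.2.trans hz))]
      simp [hgc]
  have hae : ∀ᵐ ρ : ℝ, ρ ≠ ‖z‖ := by
    simp [ae_iff]
  rw [setIntegral_congr_ae (g := (Set.Ioo 0 ‖z‖).indicator (fun ρ : ℝ => (ρ : ℂ) * (2 * Real.pi / z)))
    measurableSet_Ioi (hae.mono fun ρ h1 h2 => hinner ρ h2 h1)]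
  rw [setIntegral_indicator measurableSet_Ioo,
    Set.inter_eq_right.2 (Set.Ioo_subset_Ioi_self : Set.Ioo 0 ‖z‖ ⊆ Set.Ioi 0), integral_mul_const,
    ← integral_Ioc_eq_integral_Ioo, ← intervalIntegral.integral_of_le (norm_nonneg z)]
  have : ∫ x in (0:ℝ)..‖z‖, (x : ℂ) = ((‖z‖ ^ 2 / 2 : ℝ) : ℂ) := by
    rw [intervalIntegral.integral_ofReal, integral_id]
    simp
  rw [this]
  have hcs : ((‖z‖ : ℝ) : ℂ) ^ 2 = z * (starRingEnd ℂ) z := (Complex.mul_conj' z).symm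
  push_cast
  rw [hcs]
  field_simp

open MeasureTheory in
theorem conj_approx8 (K : Set ℂ) [CompactSpace K] (hconn : IsPreconnected Kᶜ)
    (hint : interior K = ∅) (R : ℝ) (hR : ∀ z ∈ K, ‖z‖ < R) (r : ℝ) (hr : 0 < r) :
    ∃ Φ ∈ PK8 K, ∀ z : K, ‖Φ z - Real.pi * (starRingEnd ℂ) (z:ℂ)‖ ≤
      3200 * √r * ∫ ζ in Metric.ball (0:ℂ) (2 * R), (‖ζ‖ * √‖ζ‖)⁻¹ := by
  set δ : ℝ := r / 2 with hδ
  have hδ0 : 0 < δ := by positivity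
  choose q hq hqn hqk using fun c : ℂ => kernel8' K hconn hint c hr
  let S : Submodule ℂ C(K, ℂ) := Subalgebra.toSubmodule (PK8 K)
  have hSc : IsClosed (S : Set C(K, ℂ)) := PK8_closed K
  haveI : CompleteSpace S := hSc.completeSpace_coe
  let Q : ℤ × ℤ → S := fun n => ⟨q (((δ * n.1 : ℝ) : ℂ) + ((δ * n.2 : ℝ) : ℂ) * Complex.I), hq _⟩
  let N : ℂ → ℤ × ℤ := fun ζ => (⌊ζ.re / δ⌋, ⌊ζ.im / δ⌋)
  have hN : Measurable N := by
    refine Measurable.prodMk ?_ ?_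
    · exact Int.measurable_floor.comp (Complex.measurable_re.div_const δ)
    · exact Int.measurable_floor.comp (Complex.measurable_im.div_const δ)
  have hG : StronglyMeasurable (fun ζ => Q (N ζ)) :=
    (StronglyMeasurable.of_discrete (f := Q)).comp_measurable hN
  have hGn : ∀ ζ, ‖Q (N ζ)‖ ≤ 400 / r := fun ζ => hqn _
  have hGi : IntegrableOn (fun ζ => Q (N ζ)) (Metric.ball (0:ℂ) R) := by
    refine Measure.integrableOn_of_bounded (M := 400 / r) measure_ball_lt_top.ne
      hG.aestronglyMeasurable (Filter.Eventually.of_forall hGn)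
  have hfl : ∀ x : ℝ, |x - δ * ⌊x / δ⌋| ≤ δ := by
    intro x
    have h1 := Int.floor_le (x / δ)
    have h2 := Int.lt_floor_add_one (x / δ)
    rw [le_div_iff₀ hδ0] at h1
    rw [div_lt_iff₀ hδ0] at h2
    rw [abs_le]
    constructor <;> nlinarith
  have hc : ∀ ζ : ℂ, ‖ζ - (((δ * (N ζ).1 : ℝ) : ℂ) + ((δ * (N ζ).2 : ℝ) : ℂ) * Complex.I)‖ ≤ r := by
    intro ζ
    refine (Complex.norm_le_abs_re_add_abs_im _).trans ?_
    have h1 := hfl ζ.re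
    have h2 := hfl ζ.im
    have e1 : (ζ - (((δ * (N ζ).1 : ℝ) : ℂ) + ((δ * (N ζ).2 : ℝ) : ℂ) * Complex.I)).re
        = ζ.re - δ * ⌊ζ.re / δ⌋ := by simp [N]
    have e2 : (ζ - (((δ * (N ζ).1 : ℝ) : ℂ) + ((δ * (N ζ).2 : ℝ) : ℂ) * Complex.I)).im
        = ζ.im - δ * ⌊ζ.im / δ⌋ := by simp [N]
    rw [e1, e2]
    linarith
  let Φ : S := ∫ ζ in Metric.ball (0:ℂ) R, Q (N ζ)
  refine ⟨(Φ : C(K, ℂ)), Φ.2, ?_⟩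
  intro z
  have hzR := hR z z.2
  let L : S →L[ℂ] ℂ := (ContinuousMap.evalCLM ℂ z).comp S.subtypeL
  have hΦ : (Φ : C(K, ℂ)) z = ∫ ζ in Metric.ball (0:ℂ) R, L (Q (N ζ)) :=
    (L.integral_comp_comm hGi).symm
  have hLi : IntegrableOn (fun ζ => L (Q (N ζ))) (Metric.ball (0:ℂ) R) :=
    L.integrable_comp hGi
  rw [hΦ, ← cauchy_integral8 R z hzR,
    ← integral_sub hLi (integrableOn_cauchy8 R z hzR)]
  obtain ⟨hk1, hk2⟩ := integrableOn_ker8_shift R z hzR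
  calc ‖∫ ζ in Metric.ball (0:ℂ) R, (L (Q (N ζ)) - ((z:ℂ) - ζ)⁻¹)‖
      ≤ ∫ ζ in Metric.ball (0:ℂ) R, 3200 * √r * (‖(z:ℂ) - ζ‖ * √‖(z:ℂ) - ζ‖)⁻¹ := by
        refine norm_integral_le_of_norm_le (hk1.const_mul _) ?_
        have hae : ∀ᵐ ζ : ℂ ∂(volume.restrict (Metric.ball (0:ℂ) R)), ζ ≠ z := by
          refine ae_restrict_of_ae ?_
          simp [ae_iff]
        filter_upwards [hae] with ζ hζ
        rw [norm_sub_rev]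
        exact hqk _ ζ (hc ζ) z hζ.symm
    _ = 3200 * √r * ∫ ζ in Metric.ball (0:ℂ) R, (‖(z:ℂ) - ζ‖ * √‖(z:ℂ) - ζ‖)⁻¹ :=
        integral_const_mul _ _
    _ ≤ _ := by gcongr

theorem PK8_top (K : Set ℂ) [CompactSpace K] (hconn : IsPreconnected Kᶜ)
    (hint : interior K = ∅) (f : C(K, ℂ)) : f ∈ PK8 K := by
  have hcl := PK8_closed K
  obtain ⟨R, hR⟩ : ∃ R : ℝ, ∀ z ∈ K, ‖z‖ < R := by
    have hK : IsCompact K := isCompact_iff_compactSpace.2 inferInstance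
    obtain ⟨C, hC⟩ := hK.isBounded.exists_norm_le
    exact ⟨C + 1, fun z hz => (hC z hz).trans_lt (by linarith)⟩
  set I := ∫ ζ in Metric.ball (0:ℂ) (2 * R), (‖ζ‖ * √‖ζ‖)⁻¹ with hI
  have hI0 : 0 ≤ I := MeasureTheory.integral_nonneg fun ζ => by positivity
  have hπ : (Real.pi : ℂ) ≠ 0 := by exact_mod_cast Real.pi_ne_zero
  have hstar1 : (Real.pi : ℂ) • star (idK8 K) ∈ PK8 K := by
    change _ ∈ (PK8 K : Set C(K, ℂ))
    rw [← hcl.closure_eq, Metric.mem_closure_iff]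
    intro ε hε
    have hs : 0 < ε / (3200 * I + 1) / 2 := by positivity
    obtain ⟨Φ, hΦ, h⟩ := conj_approx8 K hconn hint R hR ((ε / (3200 * I + 1) / 2) ^ 2) (by positivity)
    refine ⟨Φ, hΦ, ?_⟩
    rw [dist_comm, dist_eq_norm]
    rw [← hI, Real.sqrt_sq hs.le] at h
    refine lt_of_le_of_lt ((ContinuousMap.norm_le _ (C := ε / 2) (by positivity)).2 ?_) (half_lt_self hε)
    intro z
    refine (h z).trans ?_
    have : 3200 * (ε / (3200 * I + 1) / 2) * I = ε / 2 * ((3200 * I) / (3200 * I + 1)) := by ring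
    rw [this]
    have h1 : (3200 * I) / (3200 * I + 1) ≤ 1 := by
      rw [div_le_one (by positivity)]; linarith
    calc _ ≤ ε / 2 * 1 := by gcongr
      _ = _ := mul_one _
  have hstar : star (idK8 K) ∈ PK8 K := by
    have := (PK8 K).smul_mem hstar1 (Real.pi : ℂ)⁻¹
    rwa [smul_smul, inv_mul_cancel₀ hπ, one_smul] at this
  refine ContinuousMap.induction_on_of_compact (p := fun f => f ∈ PK8 K) ?_ ?_ ?_ ?_ ?_ ?_ f
  · intro c
    exact (PK8 K).algebraMap_mem c
  · exact idK8_mem K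
  · exact hstar
  · exact fun f g => (PK8 K).add_mem
  · exact fun f g => (PK8 K).mul_mem
  · intro f hf
    exact hf.mem_of_closed hcl

theorem poly_approx8 (K : Set ℂ) (hK : IsCompact K) (hconn : IsPreconnected Kᶜ)
    (hint : interior K = ∅) (f : K → ℂ) (hf : Continuous f) (ε : ℝ) (hε : 0 < ε) :
    ∃ p : Polynomial ℂ, ∀ z : K, ‖p.eval (z : ℂ) - f z‖ < ε := by
  haveI : CompactSpace K := isCompact_iff_compactSpace.1 hK
  have h : (⟨f, hf⟩ : C(K, ℂ)) ∈ closure (polynomialFunctions K : Set C(K, ℂ)) :=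
    PK8_top K hconn hint ⟨f, hf⟩
  obtain ⟨g, hg, hd⟩ := Metric.mem_closure_iff.1 h ε hε
  rw [polynomialFunctions_coe] at hg
  obtain ⟨p, rfl⟩ := hg
  refine ⟨p, fun z => ?_⟩
  rw [dist_comm, dist_eq_norm] at hd
  exact (ContinuousMap.norm_coe_le_norm
    (Polynomial.toContinuousMapOnAlgHom K p - (⟨f, hf⟩ : C(K, ℂ))) z).trans_lt hd

/-- for a nonempty compact contractible parameter set `P ⊆ ℂ` with empty
interior, the scalar pair `(a, b)` is uniformly ensemble reachable on `C(P, ℂ)` iff `a`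
is injective and `b` vanishes nowhere. -/
theorem stmt_8 (P : Set ℂ) (hP : IsCompact P) (hPne : P.Nonempty)
    [ContractibleSpace P] (hint : interior P = ∅)
    (a b : P → ℂ) (ha : Continuous a) (hb : Continuous b) :
    (∀ f : P → ℂ, Continuous f → ∀ ε : ℝ, 0 < ε →
        ∃ p : Polynomial ℂ, ∀ θ : P, ‖p.eval (a θ) * b θ - f θ‖ < ε)
    ↔ (Function.Injective a ∧ ∀ θ : P, b θ ≠ 0) := by
  haveI : CompactSpace P := isCompact_iff_compactSpace.1 hP
  constructor
  · intro H
    have hb0 : ∀ θ : P, b θ ≠ 0 := by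
      intro θ h0
      obtain ⟨p, hp⟩ := H (fun _ => 1) continuous_const (1 / 2) (by norm_num)
      have := hp θ
      rw [h0, mul_zero, zero_sub, norm_neg, norm_one] at this
      norm_num at this
    refine ⟨?_, hb0⟩
    intro x y hxy
    by_contra hne
    have hne' : (y : ℂ) - x ≠ 0 := by
      rw [sub_ne_zero]
      exact fun h => hne (Subtype.ext h.symm)
    have hbx : 0 < ‖b x‖ := norm_pos_iff.2 (hb0 x)
    have hby : 0 < ‖b y‖ := norm_pos_iff.2 (hb0 y)
    obtain ⟨p, hp⟩ := H (fun θ => ((θ : ℂ) - x) / ((y : ℂ) - x)) (by fun_prop)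
      (‖b x‖ / (‖b x‖ + ‖b y‖)) (by positivity)
    have h1 := hp x
    have h2 := hp y
    simp only [sub_self, zero_div, sub_zero, div_self hne', norm_mul] at h1 h2
    rw [← hxy] at h2
    have h3 : 1 ≤ ‖p.eval (a x) * b y - 1‖ + ‖p.eval (a x)‖ * ‖b y‖ := by
      have := norm_sub_le (p.eval (a x) * b y) (p.eval (a x) * b y - 1)
      rw [sub_sub_cancel, norm_one, norm_mul] at this
      linarith
    rw [lt_div_iff₀ (by positivity)] at h1 h2
    have h4 : ‖p.eval (a x)‖ * (‖b x‖ + ‖b y‖) < 1 := by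
      have : (‖p.eval (a x)‖ * (‖b x‖ + ‖b y‖)) * ‖b x‖ < 1 * ‖b x‖ := by linarith
      exact lt_of_mul_lt_mul_right this hbx.le
    nlinarith [norm_nonneg (p.eval (a x))]
  · rintro ⟨hinj, hb0⟩ f hf ε hε
    have hemb : Topology.IsClosedEmbedding a := ha.isClosedEmbedding hinj
    let e : P ≃ₜ Set.range a := hemb.isEmbedding.toHomeomorph
    have hK : IsCompact (Set.range a) := isCompact_range ha
    haveI : ContractibleSpace (Set.range a) := e.symm.contractibleSpace
    have hconn : IsPreconnected (Set.range a)ᶜ :=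
      isPreconnected_compl8 _ hK fun f hf hne => HasLog8.of_contractible hf hne
    have hKint : interior (Set.range a) = ∅ :=
      interior_empty8 P (Set.range a) hint (fun x => (e.symm x : ℂ))
        (continuous_subtype_val.comp e.symm.continuous)
        (Subtype.val_injective.comp e.symm.injective) (fun x => (e.symm x).2)
    obtain ⟨C, hC⟩ : ∃ C : ℝ, ∀ θ, ‖b θ‖ ≤ C := by
      obtain ⟨C, hC⟩ := (isCompact_range hb).isBounded.exists_norm_le
      exact ⟨C, fun θ => hC _ ⟨θ, rfl⟩⟩
    have hC0 : 0 ≤ C := by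
      obtain ⟨x, hx⟩ := hPne
      exact (norm_nonneg _).trans (hC ⟨x, hx⟩)
    have hg : Continuous (fun x => f (e.symm x) / b (e.symm x)) :=
      (hf.comp e.symm.continuous).div (hb.comp e.symm.continuous) fun x => hb0 _
    obtain ⟨p, hp⟩ := poly_approx8 _ hK hconn hKint _ hg (ε / (C + 1)) (by positivity)
    refine ⟨p, fun θ => ?_⟩
    have h1 := hp (e θ)
    simp only [Homeomorph.symm_apply_apply] at h1
    have h2 : ((e θ : Set.range a) : ℂ) = a θ := rfl
    rw [h2] at h1
    have h3 : p.eval (a θ) * b θ - f θ = (p.eval (a θ) - f θ / b θ) * b θ := by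
      rw [sub_mul, div_mul_cancel₀ _ (hb0 θ)]
    rw [h3, norm_mul]
    rw [lt_div_iff₀ (by positivity)] at h1
    refine lt_of_le_of_lt ?_ h1
    have := hC θ
    gcongr
    linarith
end
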